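/- Let R be a Noetherian integral domain such that either ℚ ⊆ R or R is seminormal. Let m ≥ 1, r_1,…,r_m integers with r_i > 1 for all i, F(X_1,…,X_m,Z,T) = f(Z,T) + X_1⋯X_m·g(X_1,…,X_m,Z,T) ∈ R[X_1,…,X_m,Z,T] with f(Z,T) ≠ 0, let A_R = R[X_1,…,X_m,Y,Z,T]/(X_1^{r_1}⋯X_m^{r_m}Y − F), let G = X_1^{r_1}⋯X_m^{r_m}Y − F, and let x̃_1,…,x̃_m denote the images of X_1,…,X_m in A_R. Then the following statements are equivalent: (i) R[X_1,…,X_m,Y,Z,T] = R[X_1,…,X_m,G]^{[2]}; (ii) R[X_1,…,X_m,Y,Z,T] = R[G]^{[m+2]}; (iii) A_R = R[x̃_1,…,x̃_m]^{[2]}; (iv) A_R ≅ R^{[m+2]} as an R-algebra; (v) R[Z,T] = R[f(Z,T)]^{[1]}. -/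

import Mathlib

/-!
Common definitions: exponential maps, the Derksen and Makar-Limanov invariants,
𝔸ⁿ-fibrations, and the ring
`A = k[X_1,…,X_m,Y,Z,T]/(X_1^{r_1}⋯X_m^{r_m}·Y − F(X_1,…,X_m,Z,T))`.
-/

noncomputable section
open MvPolynomial

/-- An exponential map on a `k`-algebra `D`: a `k`-algebra homomorphism `φ : D → D[U]`
such that evaluating `U` at `0` gives the identity of `D`, and such that
`φ_V ∘ φ_U = φ_{U+V}` in `D[U,V]` (where `φ_V : D[U] → D[U,V]` extends `φ` with
`φ_V(U) = U`).  Here `D[U,V]` is modelled as `Polynomial (Polynomial D)`, with inner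
variable `U` and outer variable `V`. -/
structure ExpMap (k D : Type) [CommRing k] [CommRing D] [Algebra k D] where
  toAlgHom : D →ₐ[k] Polynomial D
  eval_zero : ∀ d, Polynomial.eval 0 (toAlgHom d) = d
  comp_add : ∀ d,
    Polynomial.eval₂ ((Polynomial.mapRingHom (Polynomial.C (R := D))).comp toAlgHom.toRingHom)
      (Polynomial.C Polynomial.X) (toAlgHom d)
    = Polynomial.eval₂ ((Polynomial.C (R := Polynomial D)).comp (Polynomial.C (R := D)))
      (Polynomial.C Polynomial.X + Polynomial.X) (toAlgHom d)

namespace ExpMap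
variable {k D : Type} [CommRing k] [CommRing D] [Algebra k D]

/-- The ring of invariants `D^φ = {d ∈ D | φ(d) = d}` of an exponential map. -/
def invariants (φ : ExpMap k D) : Subalgebra k D where
  carrier := {d | φ.toAlgHom d = Polynomial.C d}
  mul_mem' := fun ha hb => by
    simp only [Set.mem_setOf_eq] at *
    rw [map_mul, ha, hb, ← map_mul]
  add_mem' := fun ha hb => by
    simp only [Set.mem_setOf_eq] at *
    rw [map_add, ha, hb, ← map_add]
  algebraMap_mem' := fun c => by
    simp only [Set.mem_setOf_eq, AlgHom.commutes, Polynomial.algebraMap_apply]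

end ExpMap

/-- The Derksen invariant `DK(D)`: the `k`-subalgebra of `D` generated by the rings of
invariants of all non-trivial exponential maps on `D`. -/
def Derksen (k D : Type) [CommRing k] [CommRing D] [Algebra k D] : Subalgebra k D :=
  Algebra.adjoin k (⋃ φ ∈ {ψ : ExpMap k D | ψ.invariants ≠ ⊤}, (φ.invariants : Set D))

/-- The Makar-Limanov invariant `ML(D)`: the intersection of the rings of invariants of
all exponential maps on `D`. -/
def MakarLimanov (k D : Type) [CommRing k] [CommRing D] [Algebra k D] : Subalgebra k D :=
  ⨅ φ : ExpMap k D, φ.invariants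

/-- `D` is an `𝔸ⁿ`-fibration over `R`: a finitely generated flat `R`-algebra all of whose
fibres `D ⊗_R κ(p)` over primes `p` of `R` are polynomial rings `κ(p)^{[n]}`. -/
def IsAnFibration (R D : Type) [CommRing R] [CommRing D] [Algebra R D] (n : ℕ) : Prop :=
  Algebra.FiniteType R D ∧ Module.Flat R D ∧
  ∀ p : PrimeSpectrum R,
    Nonempty ((TensorProduct R (IsLocalRing.ResidueField (Localization.AtPrime p.asIdeal)) D)
      ≃ₐ[IsLocalRing.ResidueField (Localization.AtPrime p.asIdeal)]
      MvPolynomial (Fin n) (IsLocalRing.ResidueField (Localization.AtPrime p.asIdeal)))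

/-- The polynomial ring `k[X_1,…,X_m,Y,Z,T]`:
variables `Sum.inl i` are the `X i`; `Sum.inr 0 = Y`, `Sum.inr 1 = Z`, `Sum.inr 2 = T`. -/
abbrev BigP (k : Type) [CommRing k] (m : ℕ) := MvPolynomial (Fin m ⊕ Fin 3) k

/-- The inclusion `k[X_1,…,X_m,Z,T] → k[X_1,…,X_m,Y,Z,T]` (in the source,
`Sum.inr 0 = Z` and `Sum.inr 1 = T`). -/
def incl (k : Type) [CommRing k] (m : ℕ) : MvPolynomial (Fin m ⊕ Fin 2) k →ₐ[k] BigP k m :=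
  rename (Sum.map id Fin.succ)

/-- The polynomial `G = X_1^{r_1}⋯X_m^{r_m}·Y − F(X_1,…,X_m,Z,T)`. -/
def relG (k : Type) [CommRing k] (m : ℕ) (r : Fin m → ℕ) (F : MvPolynomial (Fin m ⊕ Fin 2) k) :
    BigP k m :=
  (∏ i, X (Sum.inl i) ^ r i) * X (Sum.inr 0) - incl k m F

/-- The ring `A = k[X_1,…,X_m,Y,Z,T]/(X_1^{r_1}⋯X_m^{r_m}·Y − F(X_1,…,X_m,Z,T))`. -/
abbrev RingA (k : Type) [CommRing k] (m : ℕ) (r : Fin m → ℕ)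
    (F : MvPolynomial (Fin m ⊕ Fin 2) k) :=
  BigP k m ⧸ Ideal.span {relG k m r F}

variable (k : Type) [CommRing k] (m : ℕ) (r : Fin m → ℕ) (F : MvPolynomial (Fin m ⊕ Fin 2) k)

/-- `x i`, the image of `X i` in `A`. -/
def xA (i : Fin m) : RingA k m r F := Ideal.Quotient.mk _ (X (Sum.inl i))
/-- `y`, the image of `Y` in `A`. -/
def yA : RingA k m r F := Ideal.Quotient.mk _ (X (Sum.inr 0))
/-- `z`, the image of `Z` in `A`. -/
def zA : RingA k m r F := Ideal.Quotient.mk _ (X (Sum.inr 1))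
/-- `t`, the image of `T` in `A`. -/
def tA : RingA k m r F := Ideal.Quotient.mk _ (X (Sum.inr 2))

/-- `f(Z,T) := F(0,…,0,Z,T) ∈ k[Z,T]`. -/
def fOf : MvPolynomial (Fin 2) k :=
  aeval (Sum.elim (fun _ => (0 : MvPolynomial (Fin 2) k)) X) F

/-- The subalgebra `E = k[x_1,…,x_m]` of `A`. -/
def EA : Subalgebra k (RingA k m r F) := Algebra.adjoin k (Set.range (xA k m r F))

/-- The subalgebra `B = k[x_1,…,x_m,z,t]` of `A`. -/
def BA : Subalgebra k (RingA k m r F) :=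
  Algebra.adjoin k (Set.range (xA k m r F) ∪ {zA k m r F, tA k m r F})

/-!
STATEMENT 13 (Theorem `geqv`).  Let `R` be a Noetherian integral domain such that either
`ℚ ⊆ R` or `R` is seminormal.  With `F = f(Z,T) + X_1⋯X_m·g`, `f ≠ 0`,
`A_R = R[X_1,…,X_m,Y,Z,T]/(X_1^{r_1}⋯X_m^{r_m}Y − F)` and
`G = X_1^{r_1}⋯X_m^{r_m}Y − F`, the following are equivalent:
(i) `R[X_1,…,X_m,Y,Z,T] = R[X_1,…,X_m,G]^{[2]}`;
(ii) `R[X_1,…,X_m,Y,Z,T] = R[G]^{[m+2]}`;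
(iii) `A_R = R[x̃_1,…,x̃_m]^{[2]}`;
(iv) `A_R ≅ R^{[m+2]}` as an `R`-algebra;
(v) `R[Z,T] = R[f(Z,T)]^{[1]}`.
-/

/-- A (Noetherian) integral domain `R` is seminormal if whenever `a` in its fraction
field satisfies `a² ∈ R` and `a³ ∈ R`, already `a ∈ R`. -/
def IsSeminormalDomain (R : Type) [CommRing R] [IsDomain R] : Prop :=
  ∀ a : FractionRing R,
    a ^ 2 ∈ (algebraMap R (FractionRing R)).range →
    a ^ 3 ∈ (algebraMap R (FractionRing R)).range →
    a ∈ (algebraMap R (FractionRing R)).range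

section

section TwoVariables

lemma ringHom_injective_of_surjective {A : Type} [CommRing A] [IsNoetherianRing A] (φ : A →+* A)
    (h : Function.Surjective φ) : Function.Injective φ := by
  have hmono : Monotone fun n : ℕ => RingHom.ker (φ ^ n) := by
    refine monotone_nat_of_le_succ fun n x hx => ?_
    rw [RingHom.mem_ker] at hx ⊢
    rw [pow_succ', RingHom.mul_def, RingHom.comp_apply, hx, map_zero]
  obtain ⟨n, hn⟩ := monotone_stabilizes_iff_noetherian.mpr (inferInstance : IsNoetherian A A)
    ⟨_, hmono⟩
  rw [injective_iff_map_eq_zero]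
  intro x hx
  have hs : Function.Surjective (φ ^ n : A →+* A) := by
    rw [RingHom.coe_pow]; exact h.iterate n
  obtain ⟨y, rfl⟩ := hs x
  have : y ∈ RingHom.ker (φ ^ (n + 1)) := by
    rw [RingHom.mem_ker, pow_succ', RingHom.mul_def, RingHom.comp_apply, hx]
  have h2 := hn (n + 1) (by omega)
  simp only [OrderHom.coe_mk] at h2
  rw [← h2, RingHom.mem_ker] at this
  exact this

/-- Substitution of a pair into a polynomial in two variables, the inner variable going to the
first entry. -/
def ev {R A : Type} [CommRing R] [CommRing A] [Algebra R A] (a b : A) :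
    Polynomial (Polynomial R) →ₐ[R] A :=
  Polynomial.eval₂AlgHom (Polynomial.aeval a) b (fun _ => mul_comm _ _)

section
variable {R A : Type} [CommRing R] [CommRing A] [Algebra R A] (a b : A)

@[simp] lemma ev_C (p : Polynomial R) : ev a b (Polynomial.C p) = Polynomial.aeval a p :=
  Polynomial.eval₂_C _ _

@[simp] lemma ev_X : ev (R := R) a b Polynomial.X = b :=
  Polynomial.eval₂_X _ _

lemma range_ev : (ev (R := R) a b).range = Algebra.adjoin R {a, b} := by
  apply le_antisymm
  · rintro _ ⟨p, rfl⟩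
    induction p using Polynomial.induction_on' with
    | add p q hp hq => simpa using add_mem hp hq
    | monomial n p =>
      have : ev a b (Polynomial.monomial n p) = Polynomial.aeval a p * b ^ n := by
        rw [← Polynomial.C_mul_X_pow_eq_monomial]; simp
      simp only [AlgHom.toRingHom_eq_coe, RingHom.coe_coe, this]
      refine mul_mem ?_ (pow_mem (Algebra.subset_adjoin (by simp)) _)
      exact Algebra.adjoin_mono (by simp) (Polynomial.aeval_mem_adjoin_singleton R a)
  · rw [Algebra.adjoin_le_iff]
    rintro x (rfl | rfl)
    · exact ⟨Polynomial.C Polynomial.X, by simp⟩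
    · exact ⟨Polynomial.X, by simp⟩

lemma mem_adjoin_pair {x : A} :
    x ∈ Algebra.adjoin R {a, b} ↔ ∃ p : Polynomial (Polynomial R), ev a b p = x := by
  rw [← range_ev]; rfl

end

variable {R S : Type} [CommRing R] [CommRing S]

/-- The two polynomials generate the polynomial ring in two variables. -/
def Gen (f h : MvPolynomial (Fin 2) R) : Prop := Algebra.adjoin R {f, h} = ⊤

/-- The polynomial is part of a pair of generators. -/
def IsVar (f : MvPolynomial (Fin 2) R) : Prop := ∃ h, Gen f h

lemma gen_iff_surjective {f h : MvPolynomial (Fin 2) R} :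
    Gen f h ↔ Function.Surjective (ev (R := R) f h) := by
  rw [Gen, ← range_ev, AlgHom.range_eq_top]

lemma gen_iff_X {f h : MvPolynomial (Fin 2) R} :
    Gen f h ↔ X 0 ∈ Algebra.adjoin R {f, h} ∧ X 1 ∈ Algebra.adjoin R {f, h} := by
  constructor
  · intro H; rw [H]; simp
  · rintro ⟨h0, h1⟩
    rw [Gen, eq_top_iff, ← MvPolynomial.adjoin_range_X, Algebra.adjoin_le_iff]
    rintro _ ⟨i, rfl⟩
    fin_cases i
    · exact h0
    · exact h1

lemma Gen.symm {f h : MvPolynomial (Fin 2) R} (H : Gen f h) : Gen h f := by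
  rw [Gen, Set.pair_comm]; exact H

lemma Gen.injective_aeval [IsNoetherianRing R] {f h : MvPolynomial (Fin 2) R} (H : Gen f h) :
    Function.Injective (aeval ![f, h] : MvPolynomial (Fin 2) R →ₐ[R] MvPolynomial (Fin 2) R) := by
  apply ringHom_injective_of_surjective
    (aeval ![f, h] : MvPolynomial (Fin 2) R →ₐ[R] MvPolynomial (Fin 2) R).toRingHom
  change Function.Surjective (aeval ![f, h] : MvPolynomial (Fin 2) R →ₐ[R] MvPolynomial (Fin 2) R)
  rw [← AlgHom.range_eq_top, ← Algebra.adjoin_range_eq_range_aeval]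
  rw [Matrix.range_cons, Matrix.range_cons, Matrix.range_empty, Set.union_empty,
    Set.singleton_union]
  exact H

lemma ev_eq_aeval (f h : MvPolynomial (Fin 2) R) (p : Polynomial (Polynomial R)) :
    ev f h p = aeval ![f, h] (Polynomial.Bivariate.equivMvPolynomial R p) := by
  have : ev (R := R) f h = (aeval ![f, h] : MvPolynomial (Fin 2) R →ₐ[R] _).comp
      (Polynomial.Bivariate.equivMvPolynomial R).toAlgHom := by
    refine Polynomial.algHom_ext' ?_ ?_
    · ext
      simp [Polynomial.Bivariate.equivMvPolynomial]
    · simp [Polynomial.Bivariate.equivMvPolynomial]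
  rw [this]; rfl

lemma Gen.injective_ev [IsNoetherianRing R] {f h : MvPolynomial (Fin 2) R} (H : Gen f h) :
    Function.Injective (ev (R := R) f h) := by
  intro p q hpq
  rw [ev_eq_aeval, ev_eq_aeval] at hpq
  exact (Polynomial.Bivariate.equivMvPolynomial R).injective (H.injective_aeval hpq)

lemma map_mem_adjoin_pair (φ : R →+* S) {σ : Type} {f h x : MvPolynomial σ R}
    (hx : x ∈ Algebra.adjoin R {f, h}) :
    map φ x ∈ Algebra.adjoin S {map φ f, map φ h} := by
  induction hx using Algebra.adjoin_induction with
  | mem x hx =>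
    apply Algebra.subset_adjoin
    rcases hx with rfl | rfl <;> simp
  | algebraMap r =>
    simp only [MvPolynomial.algebraMap_eq, map_C]
    exact (Algebra.adjoin S _).algebraMap_mem (φ r)
  | add x y _ _ hx hy => rw [map_add]; exact add_mem hx hy
  | mul x y _ _ hx hy => rw [map_mul]; exact mul_mem hx hy

lemma Gen.map {f h : MvPolynomial (Fin 2) R} (H : Gen f h) (φ : R →+* S) :
    Gen (MvPolynomial.map φ f) (MvPolynomial.map φ h) := by
  rw [gen_iff_X] at H ⊢
  constructor
  · simpa using map_mem_adjoin_pair φ H.1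
  · simpa using map_mem_adjoin_pair φ H.2

lemma map_ev (φ : R →+* S) {σ : Type} (f h : MvPolynomial σ R) (p : Polynomial (Polynomial R)) :
    map φ (ev f h p) = ev (map φ f) (map φ h) (p.map (Polynomial.mapRingHom φ)) := by
  induction p using Polynomial.induction_on' with
  | add p q hp hq => simp [hp, hq]
  | monomial n p =>
    rw [← Polynomial.C_mul_X_pow_eq_monomial]
    simp only [map_mul, map_pow, ev_C, ev_X, Polynomial.map_mul, Polynomial.map_C,
      Polynomial.map_pow, Polynomial.map_X]
    congr 1
    rw [Polynomial.coe_mapRingHom]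
    rw [Polynomial.aeval_def, Polynomial.hom_eval₂, Polynomial.aeval_def, Polynomial.eval₂_map]
    congr 1
    ext x; simp

/-- The Jacobian derivation of `f`. -/
def jac (f : MvPolynomial (Fin 2) R) :
    Derivation R (MvPolynomial (Fin 2) R) (MvPolynomial (Fin 2) R) :=
  pderiv 0 f • pderiv 1 - pderiv 1 f • pderiv 0

lemma jac_apply (f h : MvPolynomial (Fin 2) R) :
    jac f h = pderiv 0 f * pderiv 1 h - pderiv 1 f * pderiv 0 h := by
  simp [jac]

@[simp] lemma jac_self (f : MvPolynomial (Fin 2) R) : jac f f = 0 := by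
  rw [jac_apply]; ring

lemma jac_neg (f h : MvPolynomial (Fin 2) R) : jac f h = - jac h f := by
  rw [jac_apply, jac_apply]; ring

lemma map_jac (φ : R →+* S) (f h : MvPolynomial (Fin 2) R) :
    map φ (jac f h) = jac (map φ f) (map φ h) := by
  simp only [jac_apply, map_sub, map_mul, MvPolynomial.pderiv_map]

lemma derivation_dvd_of_mem_adjoin {f h c : MvPolynomial (Fin 2) R}
    (D : Derivation R (MvPolynomial (Fin 2) R) (MvPolynomial (Fin 2) R))
    (hf : c ∣ D f) (hh : c ∣ D h) {x} (hx : x ∈ Algebra.adjoin R {f, h}) : c ∣ D x := by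
  induction hx using Algebra.adjoin_induction with
  | mem x hx => rcases hx with rfl | rfl <;> assumption
  | algebraMap r => simp
  | add x y _ _ hx hy => rw [map_add]; exact dvd_add hx hy
  | mul x y _ _ hx hy =>
    rw [Derivation.leibniz]
    exact dvd_add (Dvd.dvd.mul_left hy _) (Dvd.dvd.mul_left hx _)

lemma Gen.isUnit_jac {f h : MvPolynomial (Fin 2) R} (H : Gen f h) : IsUnit (jac f h) := by
  have top : ∀ x, x ∈ Algebra.adjoin R {f, h} := fun x => by rw [H]; trivial
  have h1 : ∀ q, jac f h ∣ jac f q := fun q =>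
    derivation_dvd_of_mem_adjoin _ (by simp) dvd_rfl (top q)
  have h2 : ∀ q, jac f h ∣ jac h q := fun q => by
    refine derivation_dvd_of_mem_adjoin _ ?_ (by simp) (top q)
    rw [jac_neg h f]; simp
  have h3 : ∀ p q, jac f h ∣ jac p q := fun p q => by
    rw [jac_neg p q, dvd_neg]
    refine derivation_dvd_of_mem_adjoin _ ?_ ?_ (top p)
    · rw [jac_neg q f, dvd_neg]; exact h1 q
    · rw [jac_neg q h, dvd_neg]; exact h2 q
  have h4 := h3 (X 0) (X 1)
  have h5 : jac (X 0 : MvPolynomial (Fin 2) R) (X 1) = 1 := by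
    rw [jac_apply]; simp [pderiv_X]
  rw [h5] at h4
  exact isUnit_of_dvd_one h4

lemma Gen.C_mul {f h : MvPolynomial (Fin 2) R} (H : Gen f h) (u : Rˣ) :
    Gen f (C (u : R) * h) := by
  rw [Gen, eq_top_iff, ← H, Algebra.adjoin_le_iff]
  have e : h = algebraMap R _ (↑u⁻¹ : R) * (C (u : R) * h) := by
    rw [MvPolynomial.algebraMap_eq, ← mul_assoc, ← map_mul]; simp
  have m2 : C (u : R) * h ∈ Algebra.adjoin R {f, C (u : R) * h} :=
    Algebra.subset_adjoin (by simp)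
  have m3 := mul_mem (Subalgebra.algebraMap_mem _ (↑u⁻¹ : R)) m2
  rw [← e] at m3
  rintro x (rfl | rfl)
  · exact Algebra.subset_adjoin (by simp)
  · exact m3

lemma IsVar.exists_jac_eq_one [IsDomain R] {f : MvPolynomial (Fin 2) R} (H : IsVar f) :
    ∃ h, Gen f h ∧ jac f h = 1 := by
  obtain ⟨h, hh⟩ := H
  obtain ⟨u, hu, hu'⟩ := MvPolynomial.isUnit_iff_eq_C_of_isReduced.1 hh.isUnit_jac
  obtain ⟨u, rfl⟩ := hu
  refine ⟨C (↑u⁻¹ : R) * h, hh.C_mul u⁻¹, ?_⟩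
  rw [← smul_eq_C_mul, Derivation.map_smul, hu', smul_eq_C_mul, ← map_mul]
  simp

lemma jac_aeval_left (f : MvPolynomial (Fin 2) R) (p : Polynomial R) :
    jac f (Polynomial.aeval f p) = 0 := by
  simp

end TwoVariables

end

section

section Generators
variable {R A : Type} [CommRing R] [CommRing A] [Algebra R A]

lemma nonempty_algEquiv_of_algebraicIndependent {ι κ : Type} {x : ι → A} {y : κ → A}
    (h : AlgebraicIndependent R (Sum.elim y x)) {s : Set A} (hs : s = Set.range x)
    (ht : Algebra.adjoin R (s ∪ Set.range y) = ⊤) :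
    Nonempty (MvPolynomial κ ↥(Algebra.adjoin R s) ≃ₐ[↥(Algebra.adjoin R s)] A) := by
  subst hs
  have h2 := (AlgebraicIndependent.sumElim_iff.1 h).2
  refine ⟨AlgEquiv.ofBijective (aeval y) ⟨h2, ?_⟩⟩
  rw [← AlgHom.range_eq_top, ← Algebra.adjoin_range_eq_range_aeval]
  rw [Algebra.adjoin_union_eq_adjoin_adjoin] at ht
  exact Subalgebra.restrictScalars_injective R (ht.trans (Subalgebra.restrictScalars_top _).symm)

lemma exists_generators_of_algEquiv {κ : Type} {s : Set A}
    (e : MvPolynomial κ ↥(Algebra.adjoin R s) ≃ₐ[↥(Algebra.adjoin R s)] A) :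
    ∃ y : κ → A, Algebra.adjoin R (s ∪ Set.range y) = ⊤ := by
  refine ⟨fun i => e (X i), ?_⟩
  rw [eq_top_iff]
  intro a _
  obtain ⟨p, rfl⟩ := e.surjective a
  induction p using MvPolynomial.induction_on with
  | C c =>
    have : e (C c) = (c : A) := e.commutes c
    rw [this]
    exact Algebra.adjoin_mono Set.subset_union_left c.2
  | add p q hp hq => rw [map_add]; exact add_mem (hp trivial) (hq trivial)
  | mul_X p i hp =>
    rw [map_mul]
    exact mul_mem (hp trivial) (Algebra.subset_adjoin (Or.inr ⟨i, rfl⟩))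

lemma algebraicIndependent_of_adjoin_eq_top [IsNoetherianRing R] {σ τ : Type} [Finite σ]
    (e : τ ≃ σ) {v : τ → MvPolynomial σ R} (h : Algebra.adjoin R (Set.range v) = ⊤) :
    AlgebraicIndependent R v := by
  have : Function.Injective
      (((aeval v : MvPolynomial τ R →ₐ[R] _).comp (rename e.symm)).toRingHom) := by
    apply ringHom_injective_of_surjective
    have h1 : Function.Surjective (aeval v : MvPolynomial τ R →ₐ[R] MvPolynomial σ R) := by
      rw [← AlgHom.range_eq_top, ← Algebra.adjoin_range_eq_range_aeval, h]
    exact h1.comp (rename_surjective _ e.symm.surjective)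
  rw [AlgebraicIndependent]
  intro p q hpq
  have h2 : ∀ p : MvPolynomial τ R, rename e.symm (rename e p) = p := fun p => by
    rw [rename_rename]; simp
  have := @this (rename e p) (rename e q) (by
    change aeval v (rename e.symm (rename e p)) = aeval v (rename e.symm (rename e q))
    rw [h2, h2]; exact hpq)
  exact rename_injective _ e.injective this

end Generators

section Easy
variable {R : Type} [CommRing R] {m : ℕ}

lemma prod_dvd_prod_pow_pow (r : Fin m → ℕ) {A : Type} [CommRing A] (x : Fin m → A) :
    ∏ i, x i ^ r i ∣ (∏ i, x i) ^ (∑ i, r i) := by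
  rw [← Finset.prod_pow]
  apply Finset.prod_dvd_prod_of_dvd
  intro i _
  exact pow_dvd_pow _ (Finset.single_le_sum (f := r) (fun _ _ => Nat.zero_le _) (Finset.mem_univ i))

/-- The endomorphism of `R[X, Z, T]` moving only `Z`. -/
def moveZ (m : ℕ) (p : MvPolynomial (Fin m ⊕ Fin 2) R) :
    MvPolynomial (Fin m ⊕ Fin 2) R →ₐ[R] MvPolynomial (Fin m ⊕ Fin 2) R :=
  aeval (Sum.elim (fun i => X (Sum.inl i)) ![p, X (Sum.inr 1)])

lemma algHom_congr_dvd {σ A : Type} [CommRing A] [Algebra R A] (φ ψ : MvPolynomial σ R →ₐ[R] A)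
    (c : A) (h : ∀ i, c ∣ φ (X i) - ψ (X i)) (p : MvPolynomial σ R) : c ∣ φ p - ψ p := by
  have : (Ideal.Quotient.mkₐ R (Ideal.span {c})).comp φ
      = (Ideal.Quotient.mkₐ R (Ideal.span {c})).comp ψ := by
    ext i
    simp only [AlgHom.comp_apply, Ideal.Quotient.mkₐ_eq_mk]
    rw [Ideal.Quotient.eq, Ideal.mem_span_singleton]
    exact h i
  have := congrArg (fun f => f p) this
  simp only [AlgHom.comp_apply, Ideal.Quotient.mkₐ_eq_mk] at this
  rwa [Ideal.Quotient.eq, Ideal.mem_span_singleton] at this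

lemma moveZ_sub_dvd {p c : MvPolynomial (Fin m ⊕ Fin 2) R} (h : c ∣ p - X (Sum.inr 0))
    (a : MvPolynomial (Fin m ⊕ Fin 2) R) : c ∣ moveZ m p a - a := by
  refine algHom_congr_dvd (moveZ m p) (AlgHom.id R _) c (fun i => ?_) a
  rcases i with i | i
  · simp [moveZ]
  · fin_cases i
    · simpa [moveZ] using h
    · simp [moveZ]

lemma moveZ_pi (p : MvPolynomial (Fin m ⊕ Fin 2) R) :
    moveZ m p (∏ i : Fin m, X (Sum.inl i)) = ∏ i, X (Sum.inl i) := by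
  simp [moveZ]

lemma exists_moveZ_inverse (g : MvPolynomial (Fin m ⊕ Fin 2) R) (n : ℕ) :
    ∃ P, (∏ i : Fin m, X (Sum.inl i)) ^ n ∣
      moveZ m (X (Sum.inr 0) + (∏ i, X (Sum.inl i)) * g) P - X (Sum.inr 0) := by
  induction n with
  | zero => exact ⟨0, by simp⟩
  | succ n ih =>
    obtain ⟨P, c, hc⟩ := ih
    obtain ⟨d, hd⟩ := moveZ_sub_dvd (p := X (Sum.inr 0) + (∏ i, X (Sum.inl i)) * g)
      (c := ∏ i, X (Sum.inl i)) (by simp) c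
    refine ⟨P - (∏ i : Fin m, X (Sum.inl i)) ^ n * c, ⟨-d, ?_⟩⟩
    rw [map_sub, map_mul, map_pow, moveZ_pi]
    linear_combination hc - (∏ i : Fin m, X (Sum.inl i)) ^ n * hd

lemma dvd_of_dvd_moveZ [IsDomain R] {p : MvPolynomial (Fin m ⊕ Fin 2) R}
    (h : (∏ i : Fin m, X (Sum.inl i)) ∣ p - X (Sum.inr 0)) (n : ℕ)
    {a : MvPolynomial (Fin m ⊕ Fin 2) R}
    (ha : (∏ i : Fin m, X (Sum.inl i)) ^ n ∣ moveZ m p a) :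
    (∏ i : Fin m, X (Sum.inl i)) ^ n ∣ a := by
  induction n generalizing a with
  | zero => simp
  | succ n ih =>
    have h1 : (∏ i : Fin m, X (Sum.inl i)) ∣ a :=
      (dvd_sub_right (dvd_trans (dvd_pow_self _ (by omega)) ha)).1 (moveZ_sub_dvd h a)
    obtain ⟨b, rfl⟩ := h1
    rw [map_mul, moveZ_pi, pow_succ'] at ha
    rw [pow_succ']
    have hne : (∏ i : Fin m, X (Sum.inl i) : MvPolynomial (Fin m ⊕ Fin 2) R) ≠ 0 :=
      Finset.prod_ne_zero_iff.2 fun i _ => X_ne_zero _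
    exact mul_dvd_mul_left _ (ih ((mul_dvd_mul_iff_left hne).1 ha))

lemma incl_prod (r : Fin m → ℕ) : incl R m (∏ i, X (Sum.inl i) ^ r i) =
    ∏ i, X (Sum.inl i) ^ r i := by simp [incl]

lemma generators_of_coordinate [IsDomain R] (r : Fin m → ℕ)
    (g : MvPolynomial (Fin m ⊕ Fin 2) R) :
    ∃ y t : BigP R m, Algebra.adjoin R (Set.range (fun i : Fin m => (X (Sum.inl i) : BigP R m)) ∪
      {relG R m r (X (Sum.inr 0) + (∏ i, X (Sum.inl i)) * g)} ∪ {y, t}) = ⊤ := by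
  set F := X (Sum.inr 0) + (∏ i, X (Sum.inl i)) * g with hF
  set G := relG R m r F with hG
  set q : BigP R m := ∏ i, X (Sum.inl i) ^ r i with hq
  obtain ⟨P, hP⟩ := exists_moveZ_inverse g (∑ i, r i + 1)
  rw [← hF] at hP
  have hπF : (∏ i : Fin m, X (Sum.inl i)) ∣ F - X (Sum.inr 0) := by simp [hF]
  have hqπ := prod_dvd_prod_pow_pow r (fun i => (X (Sum.inl i) : MvPolynomial (Fin m ⊕ Fin 2) R))
  have hcomp : (∏ i : Fin m, X (Sum.inl i)) ^ (∑ i, r i + 1) ∣ moveZ m P F - X (Sum.inr 0) := by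
    apply dvd_of_dvd_moveZ hπF
    rw [map_sub]
    have h1 : moveZ m F (X (Sum.inr 0)) = F := by simp [moveZ]
    have h2 := algHom_congr_dvd ((moveZ m F).comp (moveZ m P)) (AlgHom.id R _) _ (fun i => by
      rcases i with i | i
      · simp [moveZ]
      · fin_cases i
        · simpa [moveZ] using hP
        · simp [moveZ]) F
    simp only [AlgHom.comp_apply, AlgHom.id_apply] at h2
    rw [h1]; exact h2
  have hP' : (∏ i : Fin m, X (Sum.inl i) ^ r i) ∣ moveZ m F P - X (Sum.inr 0) :=
    (hqπ.trans (pow_dvd_pow _ (by omega))).trans hP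
  have hcomp' : (∏ i : Fin m, X (Sum.inl i) ^ r i) ∣ moveZ m P F - X (Sum.inr 0) :=
    (hqπ.trans (pow_dvd_pow _ (by omega))).trans hcomp
  let lam : MvPolynomial (Fin m ⊕ Fin 2) R →ₐ[R] BigP R m :=
    aeval (Sum.elim (fun i => X (Sum.inl i)) ![-G, X (Sum.inr 2)])
  have hGF : G = q * X (Sum.inr 0) - incl R m F := rfl
  have hlam : ∀ a, q ∣ lam a - incl R m (moveZ m F a) := fun a => by
    refine algHom_congr_dvd lam ((incl R m).comp (moveZ m F)) q (fun i => ?_) a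
    rcases i with i | i
    · simp [moveZ, lam, incl]
    · fin_cases i
      · refine ⟨-X (Sum.inr 0), ?_⟩
        simp only [lam, moveZ, AlgHom.comp_apply, aeval_X, Fin.zero_eta, Sum.elim_inr,
          Matrix.cons_val_zero, hGF]
        ring
      · simp [lam, moveZ, incl]
  have hlq : lam (∏ i, X (Sum.inl i) ^ r i) = q := by simp [lam, hq]
  have hincl0 : incl R m (X (Sum.inr 0)) = X (Sum.inr 1) := by simp [incl]
  have hincl1 : incl R m (X (Sum.inr 1)) = X (Sum.inr 2) := by simp [incl]
  obtain ⟨y, hy⟩ : q ∣ X (Sum.inr 1) - lam P := by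
    obtain ⟨c, hc⟩ := hlam P
    obtain ⟨d, hd⟩ := hP'
    have := congrArg (incl R m) hd
    rw [map_sub, hincl0, map_mul, incl_prod] at this
    refine ⟨-c - incl R m d, ?_⟩
    linear_combination -hc - this
  refine ⟨y, X (Sum.inr 2), ?_⟩
  set B := Algebra.adjoin R (Set.range (fun i : Fin m => (X (Sum.inl i) : BigP R m)) ∪
      {G} ∪ {y, X (Sum.inr 2)}) with hB
  have hXB : ∀ i : Fin m, (X (Sum.inl i) : BigP R m) ∈ B := fun i =>
    Algebra.subset_adjoin (Or.inl (Or.inl ⟨i, rfl⟩))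
  have hGB : G ∈ B := Algebra.subset_adjoin (by simp)
  have hyB : y ∈ B := Algebra.subset_adjoin (by simp)
  have hTB : X (Sum.inr 2) ∈ B := Algebra.subset_adjoin (by simp)
  have hqB : q ∈ B := prod_mem fun i _ => pow_mem (hXB i) _
  have hlamB : ∀ a, lam a ∈ B := by
    intro a
    have : lam.range ≤ B := by
      rw [← Algebra.adjoin_range_eq_range_aeval, Algebra.adjoin_le_iff]
      rintro _ ⟨i | i, rfl⟩
      · exact hXB i
      · fin_cases i
        · exact neg_mem hGB
        · exact hTB
    exact this ⟨a, rfl⟩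
  have hZ : (X (Sum.inr 1) : BigP R m) = lam P + q * y := by rw [← hy]; ring
  have hZB : (X (Sum.inr 1) : BigP R m) ∈ B := by
    rw [hZ]; exact add_mem (hlamB _) (mul_mem hqB hyB)
  have key : ∀ a, ∃ b ∈ B, incl R m a - lam (moveZ m P a) = q * b := by
    intro a
    induction a using MvPolynomial.induction_on with
    | C c => exact ⟨0, zero_mem _, by simp [incl, lam, moveZ]⟩
    | add a b ha hb =>
      obtain ⟨b1, h1, e1⟩ := ha
      obtain ⟨b2, h2, e2⟩ := hb
      refine ⟨b1 + b2, add_mem h1 h2, ?_⟩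
      rw [map_add, map_add, map_add]
      linear_combination e1 + e2
    | mul_X a i ha =>
      obtain ⟨b1, h1, e1⟩ := ha
      have : ∃ b ∈ B, incl R m (X i) - lam (moveZ m P (X i)) = q * b := by
        rcases i with i | i
        · exact ⟨0, zero_mem _, by simp [incl, lam, moveZ]⟩
        · fin_cases i
          · refine ⟨y, hyB, ?_⟩
            rw [← hy]
            simp [incl, moveZ]
          · exact ⟨0, zero_mem _, by simp [incl, lam, moveZ]⟩
      obtain ⟨b2, h2, e2⟩ := this
      have hXi : incl R m (X i) ∈ B := by
        rcases i with i | i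
        · simpa [incl] using hXB i
        · fin_cases i
          · simpa [incl] using hZB
          · simpa [incl] using hTB
      refine ⟨b1 * incl R m (X i) + lam (moveZ m P a) * b2,
        add_mem (mul_mem h1 hXi) (mul_mem (hlamB _) h2), ?_⟩
      rw [map_mul, map_mul, map_mul]
      linear_combination incl R m (X i) * e1 + lam (moveZ m P a) * e2
  have hYB : (X (Sum.inr 0) : BigP R m) ∈ B := by
    obtain ⟨b, hb, e⟩ := key F
    obtain ⟨d, hd⟩ := hcomp'
    have hd' := congrArg lam hd
    rw [map_sub, map_mul, hlq] at hd'
    have h3 : lam (X (Sum.inr 0)) = -G := by simp [lam]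
    rw [h3] at hd'
    have hqne : q ≠ 0 := Finset.prod_ne_zero_iff.2 fun i _ => pow_ne_zero _ (X_ne_zero _)
    have : (X (Sum.inr 0) : BigP R m) = b + lam d := by
      apply mul_left_cancel₀ hqne
      linear_combination -hGF + e + hd'
    rw [this]
    exact add_mem hb (hlamB _)
  rw [eq_top_iff, ← MvPolynomial.adjoin_range_X, Algebra.adjoin_le_iff]
  rintro _ ⟨i | i, rfl⟩
  · exact hXB i
  · fin_cases i
    · exact hYB
    · exact hZB
    · exact hTB

end Easy

end

section

section Easy
variable {R : Type} [CommRing R] {m : ℕ}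

lemma generators_of_isVar [IsDomain R] (r : Fin m → ℕ) {f : MvPolynomial (Fin 2) R}
    (hf : IsVar f) (g : MvPolynomial (Fin m ⊕ Fin 2) R) :
    ∃ y t : BigP R m, Algebra.adjoin R (Set.range (fun i : Fin m => (X (Sum.inl i) : BigP R m)) ∪
      {relG R m r (rename Sum.inr f + (∏ i, X (Sum.inl i)) * g)} ∪ {y, t}) = ⊤ := by
  obtain ⟨h, hh⟩ := hf
  let ψ : MvPolynomial (Fin m ⊕ Fin 2) R →ₐ[R] MvPolynomial (Fin m ⊕ Fin 2) R :=
    aeval (Sum.elim (fun i => X (Sum.inl i)) ![rename Sum.inr f, rename Sum.inr h])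
  let Ψ : BigP R m →ₐ[R] BigP R m :=
    aeval (Sum.elim (fun i => X (Sum.inl i))
      ![X (Sum.inr 0), incl R m (rename Sum.inr f), incl R m (rename Sum.inr h)])
  have hcomp : ∀ a, Ψ (incl R m a) = incl R m (ψ a) := by
    intro a
    have : Ψ.comp (incl R m) = (incl R m).comp ψ := by
      ext i
      rcases i with i | i
      · simp [Ψ, ψ, incl]
      · fin_cases i <;> simp [Ψ, ψ, incl]
    exact congrArg (fun u => u a) this
  have hin : ∀ a ∈ Algebra.adjoin R {f, h}, rename Sum.inr a ∈ ψ.range := by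
    intro a ha
    have : Algebra.adjoin R {f, h} ≤ ψ.range.comap (rename Sum.inr) := by
      rw [Algebra.adjoin_le_iff]
      rintro x (rfl | rfl)
      · exact ⟨X (Sum.inr 0), by simp [ψ]⟩
      · exact ⟨X (Sum.inr 1), by simp [ψ]⟩
    exact this ha
  have hψ : Function.Surjective ψ := by
    rw [← AlgHom.range_eq_top, eq_top_iff, ← MvPolynomial.adjoin_range_X, Algebra.adjoin_le_iff]
    rintro _ ⟨i | i, rfl⟩
    · exact ⟨X (Sum.inl i), by simp [ψ]⟩
    · have := hin (X i) (by rw [hh]; trivial)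
      rwa [rename_X] at this
  have hΨ : Function.Surjective Ψ := by
    rw [← AlgHom.range_eq_top, eq_top_iff, ← MvPolynomial.adjoin_range_X, Algebra.adjoin_le_iff]
    have : ∀ a, incl R m a ∈ Ψ.range := fun a => by
      obtain ⟨b, rfl⟩ := hψ a
      exact ⟨incl R m b, hcomp b⟩
    rintro _ ⟨i | i, rfl⟩
    · exact ⟨X (Sum.inl i), by simp [Ψ]⟩
    · fin_cases i
      · exact ⟨X (Sum.inr 0), by simp [Ψ]⟩
      · simpa [incl] using this (X (Sum.inr 0))
      · simpa [incl] using this (X (Sum.inr 1))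
  obtain ⟨g', rfl⟩ := hψ g
  obtain ⟨y, t, hyt⟩ := generators_of_coordinate r g'
  refine ⟨Ψ y, Ψ t, ?_⟩
  have h1 : Ψ (relG R m r (X (Sum.inr 0) + (∏ i, X (Sum.inl i)) * g')) =
      relG R m r (rename Sum.inr f + (∏ i, X (Sum.inl i)) * ψ g') := by
    rw [relG, relG, map_sub, hcomp, map_add ψ, map_mul ψ]
    simp [Ψ, ψ]
  have h2 : (Algebra.adjoin R (Set.range (fun i : Fin m => (X (Sum.inl i) : BigP R m)) ∪
      {relG R m r (X (Sum.inr 0) + (∏ i, X (Sum.inl i)) * g')} ∪ {y, t})).map Ψ = ⊤ := by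
    rw [hyt, Algebra.map_top, AlgHom.range_eq_top]; exact hΨ
  rw [AlgHom.map_adjoin] at h2
  rw [← h2]
  congr 1
  rw [Set.image_union, Set.image_union, Set.image_pair, Set.image_singleton, h1, ← Set.range_comp]
  congr 3
  ext i
  simp [Ψ]

/-- Killing the variable `Y`. -/
def killY (R : Type) [CommRing R] (m : ℕ) : BigP R m →ₐ[R] MvPolynomial (Fin m ⊕ Fin 2) R :=
  aeval (Sum.elim (fun i => X (Sum.inl i)) ![0, X (Sum.inr 0), X (Sum.inr 1)])

lemma killY_incl (a : MvPolynomial (Fin m ⊕ Fin 2) R) : killY R m (incl R m a) = a := by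
  have : (killY R m).comp (incl R m) = AlgHom.id R _ := by
    ext i
    rcases i with i | i
    · simp [killY, incl]
    · fin_cases i <;> simp [killY, incl]
  exact congrArg (fun u => u a) this

/-- The map out of the quotient by a coordinate. -/
def quotientHom (σ : BigP R m ≃ₐ[R] BigP R m) (r : Fin m → ℕ)
    (F : MvPolynomial (Fin m ⊕ Fin 2) R) (h : σ (X (Sum.inr 0)) = relG R m r F) :
    RingA R m r F →ₐ[R] MvPolynomial (Fin m ⊕ Fin 2) R :=
  Ideal.Quotient.liftₐ _ ((killY R m).comp σ.symm.toAlgHom) (by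
      intro a ha
      obtain ⟨b, rfl⟩ := Ideal.mem_span_singleton.1 ha
      rw [map_mul, ← h]
      simp [killY])

lemma quotientHom_mk (σ : BigP R m ≃ₐ[R] BigP R m) (r : Fin m → ℕ)
    (F : MvPolynomial (Fin m ⊕ Fin 2) R) (h : σ (X (Sum.inr 0)) = relG R m r F) (p : BigP R m) :
    quotientHom σ r F h (Ideal.Quotient.mk _ p) = killY R m (σ.symm p) := rfl

/-- The quotient of a polynomial ring by a coordinate is a polynomial ring. -/
def quotientEquiv (σ : BigP R m ≃ₐ[R] BigP R m) (r : Fin m → ℕ)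
    (F : MvPolynomial (Fin m ⊕ Fin 2) R) (h : σ (X (Sum.inr 0)) = relG R m r F) :
    RingA R m r F ≃ₐ[R] MvPolynomial (Fin m ⊕ Fin 2) R :=
  AlgEquiv.ofAlgHom
    (quotientHom σ r F h)
    ((Ideal.Quotient.mkₐ R _).comp (σ.toAlgHom.comp (incl R m)))
    (by
      apply MvPolynomial.algHom_ext
      intro i
      have : killY R m (incl R m (X i)) = X i := killY_incl _
      simpa [quotientHom_mk] using this)
    (by
      apply Ideal.Quotient.algHom_ext
      have : ∀ p, Ideal.Quotient.mk (Ideal.span {relG R m r F}) (σ (incl R m (killY R m p))) =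
          Ideal.Quotient.mk _ (σ p) := by
        intro p
        have : ((Ideal.Quotient.mkₐ R (Ideal.span {relG R m r F})).comp
            (σ.toAlgHom.comp ((incl R m).comp (killY R m)))) =
            (Ideal.Quotient.mkₐ R (Ideal.span {relG R m r F})).comp σ.toAlgHom := by
          apply MvPolynomial.algHom_ext
          intro i
          rcases i with i | i
          · simp [killY, incl]
          · fin_cases i
            · have : Ideal.Quotient.mk (Ideal.span {relG R m r F}) (relG R m r F) = 0 :=
                Ideal.Quotient.eq_zero_iff_mem.2 (Ideal.mem_span_singleton_self _)
              simp [killY, h, this]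
            · simp [killY, incl]
            · simp [killY, incl]
        exact congrArg (fun u => u p) this
      apply MvPolynomial.algHom_ext
      intro i
      simpa [quotientHom_mk] using this (σ.symm (X i)))

lemma quotientEquiv_mk (σ : BigP R m ≃ₐ[R] BigP R m) (r : Fin m → ℕ)
    (F : MvPolynomial (Fin m ⊕ Fin 2) R) (h : σ (X (Sum.inr 0)) = relG R m r F) (p : BigP R m) :
    quotientEquiv σ r F h (Ideal.Quotient.mk _ (σ p)) = killY R m p := by
  rw [quotientEquiv, AlgEquiv.ofAlgHom_apply]
  rw [quotientHom_mk, AlgEquiv.symm_apply_apply]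

/-- A generating family of a polynomial ring of the right size gives an automorphism. -/
lemma exists_algEquiv_of_adjoin_eq_top [IsNoetherianRing R] {σ : Type} [Finite σ]
    {v : σ → MvPolynomial σ R} (h : Algebra.adjoin R (Set.range v) = ⊤) :
    ∃ e : MvPolynomial σ R ≃ₐ[R] MvPolynomial σ R, ∀ i, e (X i) = v i := by
  have h1 := algebraicIndependent_of_adjoin_eq_top (Equiv.refl σ) h
  refine ⟨AlgEquiv.ofBijective (aeval v) ⟨h1, ?_⟩, fun i => ?_⟩
  · rw [← AlgHom.range_eq_top, ← Algebra.adjoin_range_eq_range_aeval, h]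
  · simp

section
variable [IsNoetherianRing R] (r : Fin m → ℕ) (F : MvPolynomial (Fin m ⊕ Fin 2) R)

/-- Standard names for the two sets of generators of the base in the theorem. -/
abbrev xgSet : Set (BigP R m) :=
  Set.range (fun i : Fin m => (X (Sum.inl i) : BigP R m)) ∪ {relG R m r F}

omit [IsNoetherianRing R] in
lemma xgSet_generators {y : Fin 2 → BigP R m}
    (h : Algebra.adjoin R (xgSet r F ∪ Set.range y) = ⊤) :
    Algebra.adjoin R (Set.range (Sum.elim (fun i : Fin m => (X (Sum.inl i) : BigP R m))
      ![relG R m r F, y 0, y 1])) = ⊤ := by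
  rw [← h]
  congr 1
  ext z
  simp only [Set.Sum.elim_range, Set.mem_union, Set.mem_range, Set.mem_singleton_iff]
  constructor
  · rintro (h | ⟨i, rfl⟩)
    · exact Or.inl (Or.inl h)
    · fin_cases i
      · exact Or.inl (Or.inr rfl)
      · exact Or.inr ⟨0, rfl⟩
      · exact Or.inr ⟨1, rfl⟩
  · rintro ((h | rfl) | ⟨i, rfl⟩)
    · exact Or.inl h
    · exact Or.inr ⟨0, rfl⟩
    · fin_cases i
      · exact Or.inr ⟨1, rfl⟩
      · exact Or.inr ⟨2, rfl⟩

lemma stmt_i_of_generators {y : Fin 2 → BigP R m}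
    (h : Algebra.adjoin R (xgSet r F ∪ Set.range y) = ⊤) :
    Nonempty (MvPolynomial (Fin 2) ↥(Algebra.adjoin R (xgSet r F))
      ≃ₐ[↥(Algebra.adjoin R (xgSet r F))] BigP R m) := by
  refine nonempty_algEquiv_of_algebraicIndependent (y := y)
    (x := Sum.elim (fun i : Fin m => (X (Sum.inl i) : BigP R m)) (fun _ : Fin 1 => relG R m r F))
    ?_ ?_ h
  · have e : Fin 2 ⊕ (Fin m ⊕ Fin 1) ≃ Fin m ⊕ Fin 3 :=
      Fintype.equivOfCardEq (by simp; omega)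
    apply algebraicIndependent_of_adjoin_eq_top e
    rw [← h]
    congr 1
    simp only [Set.Sum.elim_range, Set.range_const]
    rw [Set.union_comm]
  · simp [Set.Sum.elim_range]

lemma stmt_ii_of_generators {y : Fin 2 → BigP R m}
    (h : Algebra.adjoin R (xgSet r F ∪ Set.range y) = ⊤) :
    Nonempty (MvPolynomial (Fin (m + 2)) ↥(Algebra.adjoin R {relG R m r F})
          ≃ₐ[↥(Algebra.adjoin R {relG R m r F})] BigP R m) := by
  let e0 : Fin (m + 2) ≃ Fin m ⊕ Fin 2 := finSumFinEquiv.symm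
  have hr : Set.range ((Sum.elim (fun i : Fin m => (X (Sum.inl i) : BigP R m)) y) ∘ e0) =
      Set.range (fun i : Fin m => (X (Sum.inl i) : BigP R m)) ∪ Set.range y := by
    rw [e0.surjective.range_comp, Set.Sum.elim_range]
  have hs : Algebra.adjoin R ({relG R m r F} ∪ Set.range
      ((Sum.elim (fun i : Fin m => (X (Sum.inl i) : BigP R m)) y) ∘ e0)) = ⊤ := by
    rw [← h, hr]
    congr 1
    rw [xgSet, ← Set.union_assoc, Set.union_comm {relG R m r F}]
  refine nonempty_algEquiv_of_algebraicIndependent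
    (y := (Sum.elim (fun i : Fin m => (X (Sum.inl i) : BigP R m)) y) ∘ e0)
    (x := fun _ : Fin 1 => relG R m r F) ?_ ?_ hs
  · have e : Fin (m + 2) ⊕ Fin 1 ≃ Fin m ⊕ Fin 3 :=
      Fintype.equivOfCardEq (by simp)
    apply algebraicIndependent_of_adjoin_eq_top e
    rw [← hs]
    congr 1
    rw [Set.Sum.elim_range, Set.range_const, Set.union_comm]
  · simp

lemma stmt_iii_of_generators {y : Fin 2 → BigP R m}
    (h : Algebra.adjoin R (xgSet r F ∪ Set.range y) = ⊤) :
    Nonempty (MvPolynomial (Fin 2) ↥(EA R m r F) ≃ₐ[↥(EA R m r F)] RingA R m r F) := by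
  obtain ⟨σ, hσ⟩ := exists_algEquiv_of_adjoin_eq_top (xgSet_generators r F h)
  have h0 : σ (X (Sum.inr 0)) = relG R m r F := by rw [hσ]; rfl
  let e := quotientEquiv σ r F h0
  have hx : ∀ i, e (xA R m r F i) = X (Sum.inl i) := by
    intro i
    have : xA R m r F i = Ideal.Quotient.mk _ (σ (X (Sum.inl i))) := by rw [hσ]; rfl
    rw [this, quotientEquiv_mk]
    simp [killY]
  have hv : ∀ i : Fin m ⊕ Fin 2, e.symm (X i) =
      Sum.elim (xA R m r F) (fun j => e.symm (X (Sum.inr j))) i := by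
    rintro (i | i)
    · rw [AlgEquiv.symm_apply_eq]; exact (hx i).symm
    · rfl
  have hind : AlgebraicIndependent R
      (Sum.elim (xA R m r F) (fun j => e.symm (X (Sum.inr j)))) := by
    have : aeval (Sum.elim (xA R m r F) (fun j => e.symm (X (Sum.inr j)))) = e.symm.toAlgHom := by
      apply MvPolynomial.algHom_ext
      intro i
      rw [aeval_X, ← hv]; rfl
    rw [AlgebraicIndependent, this]
    exact e.symm.injective
  refine nonempty_algEquiv_of_algebraicIndependent (x := xA R m r F)
    (y := fun j => e.symm (X (Sum.inr j))) ?_ rfl ?_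
  · have := hind.comp (Equiv.sumComm (Fin 2) (Fin m)) (Equiv.injective _)
    convert! this using 1
    ext (i | i) <;> rfl
  · have : Algebra.adjoin R (Set.range (X : Fin m ⊕ Fin 2 → MvPolynomial _ R)) = ⊤ :=
      MvPolynomial.adjoin_range_X
    have h3 := congrArg (Subalgebra.map e.symm.toAlgHom) this
    have h4 : e.symm.toAlgHom.range = ⊤ := (AlgHom.range_eq_top _).2 e.symm.surjective
    rw [AlgHom.map_adjoin, Algebra.map_top, h4] at h3
    rw [← h3, ← Set.range_comp, ← Set.Sum.elim_range]
    congr 2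
    ext i
    exact (hv i).symm

lemma stmt_iv_of_ii
    (h : Nonempty (MvPolynomial (Fin (m + 2)) ↥(Algebra.adjoin R {relG R m r F})
          ≃ₐ[↥(Algebra.adjoin R {relG R m r F})] BigP R m)) :
    Nonempty (RingA R m r F ≃ₐ[R] MvPolynomial (Fin (m + 2)) R) := by
  obtain ⟨e⟩ := h
  obtain ⟨y, hy⟩ := exists_generators_of_algEquiv e
  let e0 : Fin m ⊕ Fin 2 ≃ Fin (m + 2) := finSumFinEquiv
  have hgen : Algebra.adjoin R (Set.range (Sum.elim (fun i : Fin m => y (e0 (Sum.inl i)))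
      ![relG R m r F, y (e0 (Sum.inr 0)), y (e0 (Sum.inr 1))])) = ⊤ := by
    rw [eq_top_iff, ← hy]
    apply Algebra.adjoin_mono
    rintro z (rfl | ⟨i, rfl⟩)
    · exact ⟨Sum.inr 0, rfl⟩
    · obtain ⟨j, rfl⟩ := e0.surjective i
      rcases j with j | j
      · exact ⟨Sum.inl j, rfl⟩
      · fin_cases j
        · exact ⟨Sum.inr 1, rfl⟩
        · exact ⟨Sum.inr 2, rfl⟩
  obtain ⟨σ, hσ⟩ := exists_algEquiv_of_adjoin_eq_top hgen
  have h0 : σ (X (Sum.inr 0)) = relG R m r F := by rw [hσ]; rfl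
  exact ⟨(quotientEquiv σ r F h0).trans (renameEquiv R e0)⟩

omit [IsNoetherianRing R] in
lemma algebraicIndependent_xA [IsDomain R] : AlgebraicIndependent R (xA R m r F) := by
  rw [AlgebraicIndependent, injective_iff_map_eq_zero]
  intro p hp
  have h1 : aeval (xA R m r F) p = Ideal.Quotient.mk (Ideal.span {relG R m r F})
      (rename Sum.inl p) := by
    have : (aeval (xA R m r F) : MvPolynomial (Fin m) R →ₐ[R] _) =
        (Ideal.Quotient.mkₐ R (Ideal.span {relG R m r F})).comp (rename Sum.inl) := by
      apply MvPolynomial.algHom_ext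
      intro i
      simp [xA]
    rw [this]; rfl
  rw [h1, Ideal.Quotient.eq_zero_iff_mem, Ideal.mem_span_singleton] at hp
  obtain ⟨c, hc⟩ := hp
  by_contra hne
  have hpne : rename (Sum.inl : Fin m → Fin m ⊕ Fin 3) p ≠ 0 := by
    rw [Ne, map_eq_zero_iff _ (rename_injective _ Sum.inl_injective)]; exact hne
  have hc0 : c ≠ 0 := by rintro rfl; rw [mul_zero] at hc; exact hpne hc
  have hG0 : relG R m r F ≠ 0 := by intro h; rw [h, zero_mul] at hc; exact hpne hc
  have hd := congrArg (degreeOf (Sum.inr 0)) hc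
  rw [degreeOf_mul_eq hG0 hc0] at hd
  have hz : ∀ {τ : Type} (ρ : τ → Fin m ⊕ Fin 3) (a : MvPolynomial τ R)
      (_ : ∀ i, ρ i ≠ Sum.inr 0), degreeOf (Sum.inr 0) (rename ρ a) = 0 := by
    intro τ ρ a hρ
    classical
    by_contra hne
    have : Sum.inr 0 ∈ (rename ρ a).vars := by
      rw [mem_vars_iff_degreeOf_ne_zero]; exact hne
    obtain ⟨i, _, hi⟩ := Finset.mem_image.1 (vars_rename ρ a this)
    exact hρ i hi
  rw [hz _ _ (by simp)] at hd
  have hG1 : degreeOf (Sum.inr 0) (relG R m r F) = 1 := by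
    have hq : (∏ i, X (Sum.inl i) ^ r i : BigP R m) ≠ 0 :=
      Finset.prod_ne_zero_iff.2 fun i _ => pow_ne_zero _ (X_ne_zero _)
    have hq2 : degreeOf (Sum.inr 0) (∏ i, X (Sum.inl i) ^ r i : BigP R m) = 0 := by
      have : (∏ i, X (Sum.inl i) ^ r i : BigP R m) =
          rename Sum.inl (∏ i, X i ^ r i : MvPolynomial (Fin m) R) := by simp
      rw [this]; exact hz _ _ (by simp)
    have h1 : degreeOf (Sum.inr 0) ((∏ i, X (Sum.inl i) ^ r i : BigP R m) * X (Sum.inr 0)) = 1 := by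
      rw [degreeOf_mul_eq hq (X_ne_zero _), hq2, degreeOf_X_self]
    have h2 : degreeOf (Sum.inr 0) (incl R m F) = 0 := by
      apply hz
      rintro (i | i) h
      · simp at h
      · simp at h
    apply le_antisymm
    · refine (degreeOf_sub_le _ _ _).trans ?_
      rw [h1, h2]; simp
    · by_contra hlt
      have h3 : degreeOf (Sum.inr 0) (relG R m r F) = 0 := by omega
      have : ((∏ i, X (Sum.inl i) ^ r i : BigP R m) * X (Sum.inr 0)) =
        relG R m r F + incl R m F := by rw [relG]; ring
      have h4 := degreeOf_add_le (Sum.inr 0) (relG R m r F) (incl R m F)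
      rw [← this, h1, h2, h3] at h4
      simp at h4
  omega

omit [IsNoetherianRing R] in
lemma stmt_iv_of_iii [IsDomain R]
    (h : Nonempty (MvPolynomial (Fin 2) ↥(EA R m r F) ≃ₐ[↥(EA R m r F)] RingA R m r F)) :
    Nonempty (RingA R m r F ≃ₐ[R] MvPolynomial (Fin (m + 2)) R) := by
  obtain ⟨e⟩ := h
  let e1 : MvPolynomial (Fin m) R ≃ₐ[R] EA R m r F := (algebraicIndependent_xA r F).aevalEquiv
  let e2 := mapAlgEquiv (Fin 2) e1.symm
  exact ⟨((e.symm.restrictScalars R).trans e2).trans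
    (((sumAlgEquiv R (Fin 2) (Fin m)).symm.trans (renameEquiv R (Equiv.sumComm _ _))).trans
      (renameEquiv R finSumFinEquiv))⟩

end

lemma stmt_v_of_isVar [IsNoetherianRing R] {f : MvPolynomial (Fin 2) R} (hf : IsVar f) :
    Nonempty (Polynomial ↥(Algebra.adjoin R {f}) ≃ₐ[↥(Algebra.adjoin R {f})]
      MvPolynomial (Fin 2) R) := by
  obtain ⟨h, hh⟩ := hf
  have h1 : Algebra.adjoin R ({f} ∪ Set.range (fun _ : PUnit.{1} => h)) = ⊤ := by
    rw [← hh]; congr 1; rw [Set.range_const]; rfl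
  obtain ⟨e⟩ := nonempty_algEquiv_of_algebraicIndependent (R := R) (x := fun _ : Fin 1 => f)
    (y := fun _ : PUnit.{1} => h) (s := {f}) (by
      have e : PUnit.{1} ⊕ Fin 1 ≃ Fin 2 := Fintype.equivOfCardEq (by simp)
      apply algebraicIndependent_of_adjoin_eq_top e
      rw [← h1, Set.Sum.elim_range, Set.range_const, Set.range_const, Set.union_comm])
    (by simp) h1
  exact ⟨(uniqueAlgEquiv _ PUnit.{1}).symm.trans e⟩

lemma isVar_of_stmt_v {f : MvPolynomial (Fin 2) R}
    (h : Nonempty (Polynomial ↥(Algebra.adjoin R {f}) ≃ₐ[↥(Algebra.adjoin R {f})]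
      MvPolynomial (Fin 2) R)) : IsVar f := by
  obtain ⟨e⟩ := h
  obtain ⟨y, hy⟩ := exists_generators_of_algEquiv ((uniqueAlgEquiv _ PUnit.{1}).trans e)
  refine ⟨y PUnit.unit, ?_⟩
  rw [Gen, ← hy]
  congr 1
  ext z
  have : (∃ u, y u = z) ↔ y PUnit.unit = z := ⟨fun ⟨u, hu⟩ => hu, fun h => ⟨_, h⟩⟩
  simp only [Set.mem_insert_iff, Set.mem_singleton_iff, Set.mem_union, Set.mem_range, this]
  rw [eq_comm (a := z) (b := y _)]

end Easy

end

section

section General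
variable {R : Type} [CommRing R]

lemma derivation_ev (f s : MvPolynomial (Fin 2) R) (p : Polynomial (Polynomial R)) :
    jac f (ev f s p) = ev f s (Polynomial.derivative p) * jac f s := by
  induction p using Polynomial.induction_on' with
  | add p q hp hq => simp only [map_add, hp, hq]; ring
  | monomial n p =>
    rw [Polynomial.derivative_monomial]
    rw [← Polynomial.C_mul_X_pow_eq_monomial, ← Polynomial.C_mul_X_pow_eq_monomial]
    simp only [map_mul, map_pow, ev_C, ev_X, Derivation.leibniz, jac_aeval_left,
      Derivation.leibniz_pow, smul_eq_mul, nsmul_eq_mul, map_natCast]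
    ring

lemma Gen.add_aeval {f s : MvPolynomial (Fin 2) R} (H : Gen f s) (p : Polynomial R) :
    Gen f (s + Polynomial.aeval f p) := by
  rw [Gen, eq_top_iff, ← H, Algebra.adjoin_le_iff]
  have hf : f ∈ Algebra.adjoin R {f, s + Polynomial.aeval f p} :=
    Algebra.subset_adjoin (by simp)
  have hp : Polynomial.aeval f p ∈ Algebra.adjoin R {f, s + Polynomial.aeval f p} :=
    Algebra.adjoin_mono (by simp) (Polynomial.aeval_mem_adjoin_singleton R f)
  rintro x (rfl | rfl)
  · exact hf
  · have := sub_mem (Algebra.subset_adjoin (by simp) :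
      x + Polynomial.aeval f p ∈ Algebra.adjoin R {f, x + Polynomial.aeval f p}) hp
    rwa [add_sub_cancel_right] at this

lemma exists_smul_mem_adjoin [IsDomain R] {K : Type} [Field K] [Algebra R K] [IsFractionRing R K]
    {σ : Type} {f s : MvPolynomial σ R} {x : MvPolynomial σ K}
    (hx : x ∈ Algebra.adjoin K {map (algebraMap R K) f, map (algebraMap R K) s}) :
    ∃ c : R, c ≠ 0 ∧ ∃ p : Polynomial (Polynomial R),
      C (algebraMap R K c) * x = map (algebraMap R K) (ev f s p) := by
  induction hx using Algebra.adjoin_induction with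
  | mem x hx =>
    rcases hx with rfl | rfl
    · exact ⟨1, one_ne_zero, Polynomial.C Polynomial.X, by simp⟩
    · exact ⟨1, one_ne_zero, Polynomial.X, by simp⟩
  | algebraMap r =>
    obtain ⟨a, b, hb, rfl⟩ := IsFractionRing.div_surjective (A := R) r
    have hb0 := nonZeroDivisors.ne_zero hb
    refine ⟨b, hb0, Polynomial.C (Polynomial.C a), ?_⟩
    rw [MvPolynomial.algebraMap_eq, ← map_mul, mul_div_cancel₀]
    · simp [MvPolynomial.algebraMap_eq]
    · simpa using hb0
  | add x y _ _ hx hy =>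
    obtain ⟨c, hc, p, hp⟩ := hx
    obtain ⟨d, hd, q, hq⟩ := hy
    refine ⟨c * d, mul_ne_zero hc hd, Polynomial.C (Polynomial.C d) * p +
      Polynomial.C (Polynomial.C c) * q, ?_⟩
    simp only [map_mul, map_add, ev_C, ← hp, ← hq, Polynomial.aeval_C,
      MvPolynomial.algebraMap_eq, map_C]
    ring
  | mul x y _ _ hx hy =>
    obtain ⟨c, hc, p, hp⟩ := hx
    obtain ⟨d, hd, q, hq⟩ := hy
    refine ⟨c * d, mul_ne_zero hc hd, p * q, ?_⟩
    simp only [map_mul, ← hp, ← hq]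
    ring

lemma exists_C_mul_eq_map [IsDomain R] {K : Type} [Field K] [Algebra R K] [IsFractionRing R K]
    {σ : Type} (x : MvPolynomial σ K) :
    ∃ c : R, c ≠ 0 ∧ ∃ y : MvPolynomial σ R,
      C (algebraMap R K c) * x = map (algebraMap R K) y := by
  induction x using MvPolynomial.induction_on with
  | C r =>
    obtain ⟨a, b, hb, rfl⟩ := IsFractionRing.div_surjective (A := R) r
    have hb0 := nonZeroDivisors.ne_zero hb
    refine ⟨b, hb0, C a, ?_⟩
    rw [← map_mul, mul_div_cancel₀]
    · simp
    · simpa using hb0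
  | add x y hx hy =>
    obtain ⟨c, hc, p, hp⟩ := hx
    obtain ⟨d, hd, q, hq⟩ := hy
    refine ⟨c * d, mul_ne_zero hc hd, C d * p + C c * q, ?_⟩
    simp only [map_mul, map_add, ← hp, ← hq, map_C]
    ring
  | mul_X x i hx =>
    obtain ⟨c, hc, p, hp⟩ := hx
    refine ⟨c, hc, p * X i, ?_⟩
    rw [map_mul, ← hp, map_X]; ring

lemma C_C_dvd_of_map_eq_zero (c : R) (p : Polynomial (Polynomial R))
    (h : p.map (Polynomial.mapRingHom (Ideal.Quotient.mk (Ideal.span {c}))) = 0) :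
    Polynomial.C (Polynomial.C c) ∣ p := by
  rw [Polynomial.C_dvd_iff_dvd_coeff]
  intro i
  rw [Polynomial.C_dvd_iff_dvd_coeff]
  intro j
  have := congrArg (fun q => (q.coeff i).coeff j) h
  simp only [Polynomial.coeff_map, Polynomial.coe_mapRingHom, Polynomial.coeff_zero] at this
  rwa [Ideal.Quotient.eq_zero_iff_mem, Ideal.mem_span_singleton] at this

lemma C_dvd_of_map_eq_zero {σ : Type} {c : R} {x : MvPolynomial σ R}
    (h : map (Ideal.Quotient.mk (Ideal.span {c})) x = 0) : C c ∣ x := by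
  rwa [C_dvd_iff_map_hom_eq_zero (Ideal.Quotient.mk (Ideal.span {c})) c]
  intro r
  rw [Ideal.Quotient.eq_zero_iff_mem, Ideal.mem_span_singleton]

end General

section CharZero
variable {R : Type} [CommRing R]

/-- A generator with a slice for the Jacobian derivation. -/
def HasSlice (f : MvPolynomial (Fin 2) R) : Prop := ∃ s, jac f s = 1 ∧ Gen f s

lemma HasSlice.eq_aeval [IsNoetherianRing R] [Algebra ℚ R] {f b : MvPolynomial (Fin 2) R}
    (H : HasSlice f) (hb : jac f b = 0) : ∃ p : Polynomial R, b = Polynomial.aeval f p := by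
  obtain ⟨s, hs, hg⟩ := H
  obtain ⟨P, rfl⟩ := gen_iff_surjective.1 hg b
  rw [derivation_ev, hs, mul_one] at hb
  have h0 : Polynomial.derivative P = 0 := hg.injective_ev (by rw [hb, map_zero])
  refine ⟨P.coeff 0, ?_⟩
  rw [← ev_C f s]
  congr 1
  ext n : 1
  rcases n with _ | n
  · simp
  · have h1 := congrArg (fun q => q.coeff n) h0
    simp only [Polynomial.coeff_derivative, Polynomial.coeff_zero] at h1
    rw [Polynomial.coeff_C, if_neg (by omega)]
    have hu : IsUnit ((n : Polynomial R) + 1) := by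
      have : ((n : Polynomial R) + 1) = algebraMap ℚ (Polynomial R) ((n : ℚ) + 1) := by simp
      rw [this]
      exact (IsUnit.mk0 _ (by positivity)).map _
    exact (hu.mul_left_eq_zero).1 h1

lemma HasSlice.surjective [Algebra ℚ R] {f : MvPolynomial (Fin 2) R}
    (H : HasSlice f) (n : MvPolynomial (Fin 2) R) : ∃ u, jac f u = n := by
  obtain ⟨s, hs, hg⟩ := H
  obtain ⟨P, rfl⟩ := gen_iff_surjective.1 hg n
  induction P using Polynomial.induction_on' with
  | add p q hp hq =>
    obtain ⟨u, hu⟩ := hp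
    obtain ⟨v, hv⟩ := hq
    exact ⟨u + v, by rw [map_add, hu, hv, map_add]⟩
  | monomial n p =>
    refine ⟨ev f s (Polynomial.monomial (n + 1)
      (p * algebraMap ℚ (Polynomial R) ((n : ℚ) + 1)⁻¹)), ?_⟩
    rw [derivation_ev, hs, mul_one, Polynomial.derivative_monomial]
    congr 2
    have : ((n + 1 : ℕ) : Polynomial R) = algebraMap ℚ (Polynomial R) ((n : ℚ) + 1) := by simp
    rw [this, mul_assoc, ← map_mul, inv_mul_cancel₀ (by positivity)]
    simp

lemma HasSlice.gen [IsNoetherianRing R] [Algebra ℚ R] {f s : MvPolynomial (Fin 2) R}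
    (H : HasSlice f) (hs : jac f s = 1) : Gen f s := by
  obtain ⟨s', hs', hg⟩ := id H
  obtain ⟨p, hp⟩ := H.eq_aeval (b := s - s') (by rw [map_sub, hs, hs', sub_self])
  have := hg.add_aeval p
  rwa [← hp, add_sub_cancel] at this

lemma hasSlice_of_mul_eq_zero [IsNoetherianRing R] [Algebra ℚ R] {f : MvPolynomial (Fin 2) R}
    {a b : R} (hab : a * b = 0)
    (ha : HasSlice (map (Ideal.Quotient.mk (Ideal.span {a})) f))
    (hb : HasSlice (map (Ideal.Quotient.mk (Ideal.span {b})) f)) : HasSlice f := by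
  have surj : ∀ c : R, Function.Surjective
      (map (Ideal.Quotient.mk (Ideal.span {c})) : MvPolynomial (Fin 2) R →+* _) :=
    fun c => map_surjective _ Ideal.Quotient.mk_surjective
  have key : ∀ c : R, HasSlice (map (Ideal.Quotient.mk (Ideal.span {c})) f) →
      ∀ n, ∃ u v, n = jac f u + C c * v := by
    intro c hc n
    obtain ⟨u, hu⟩ := hc.surjective (map _ n)
    obtain ⟨u, rfl⟩ := surj c u
    rw [← map_jac, eq_comm, ← sub_eq_zero, ← map_sub] at hu
    obtain ⟨v, hv⟩ := C_dvd_of_map_eq_zero hu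
    exact ⟨u, v, by rw [← hv]; ring⟩
  have hab' : (C a * C b : MvPolynomial (Fin 2) R) = 0 := by rw [← map_mul, hab, map_zero]
  obtain ⟨s, hs⟩ : ∃ s, jac f s = 1 := by
    obtain ⟨u, v, h1⟩ := key a ha 1
    obtain ⟨u', v', h2⟩ := key b hb v
    refine ⟨u + C a * u', ?_⟩
    rw [map_add, ← smul_eq_C_mul, Derivation.map_smul, smul_eq_C_mul]
    linear_combination -h1 - C a * h2 - v' * hab'
  refine ⟨s, hs, ?_⟩
  have key2 : ∀ c : R, HasSlice (map (Ideal.Quotient.mk (Ideal.span {c})) f) →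
      ∀ n, ∃ u ∈ Algebra.adjoin R {f, s}, ∃ v, n = u + C c * v := by
    intro c hc n
    have hg := hc.gen (s := map _ s) (by rw [← map_jac, hs, map_one])
    obtain ⟨P, hP⟩ := gen_iff_surjective.1 hg (map _ n)
    obtain ⟨P, rfl⟩ := Polynomial.map_surjective
      (Polynomial.mapRingHom (Ideal.Quotient.mk (Ideal.span {c})))
      (Polynomial.map_surjective _ Ideal.Quotient.mk_surjective) P
    rw [← map_ev] at hP
    rw [eq_comm, ← sub_eq_zero, ← map_sub] at hP
    obtain ⟨v, hv⟩ := C_dvd_of_map_eq_zero hP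
    exact ⟨_, (mem_adjoin_pair f s).2 ⟨P, rfl⟩, v, by rw [← hv]; ring⟩
  rw [Gen, eq_top_iff]
  intro n _
  obtain ⟨u, hu, v, h1⟩ := key2 a ha n
  obtain ⟨u', hu', v', h2⟩ := key2 b hb v
  have : n = u + C a * u' := by linear_combination h1 + C a * h2 + v' * hab'
  rw [this]
  exact add_mem hu (mul_mem (Subalgebra.algebraMap_mem _ a) hu')

lemma hasSlice_of_isDomain [IsNoetherianRing R] [IsDomain R] [Algebra ℚ R]
    {f : MvPolynomial (Fin 2) R}
    (hK : IsVar (map (algebraMap R (FractionRing R)) f))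
    (hq : ∀ c : R, c ≠ 0 → HasSlice (map (Ideal.Quotient.mk (Ideal.span {c})) f)) :
    HasSlice f := by
  set K := FractionRing R
  have hinj : Function.Injective (map (algebraMap R K) : MvPolynomial (Fin 2) R →+* _) :=
    map_injective _ (IsFractionRing.injective R K)
  obtain ⟨h, hg, hj⟩ := hK.exists_jac_eq_one
  obtain ⟨c, hc, b, hb⟩ := exists_C_mul_eq_map (R := R) h
  have hjb : jac f b = C c := by
    apply hinj
    rw [map_jac, ← hb, ← smul_eq_C_mul, Derivation.map_smul, hj, smul_eq_C_mul, map_C, mul_one]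
  obtain ⟨P, hP⟩ := (hq c hc).eq_aeval (b := map _ b) (by
    rw [← map_jac, hjb, map_C, Ideal.Quotient.eq_zero_iff_mem.2 (Ideal.mem_span_singleton_self c),
      map_zero])
  obtain ⟨P, rfl⟩ := Polynomial.map_surjective _
    (Ideal.Quotient.mk_surjective (I := Ideal.span {c})) P
  have h3 := map_ev (Ideal.Quotient.mk (Ideal.span {c})) f f (Polynomial.C P)
  rw [Polynomial.map_C, Polynomial.coe_mapRingHom, ev_C, ev_C] at h3
  rw [← h3, ← sub_eq_zero, ← map_sub] at hP
  obtain ⟨s, hs⟩ := C_dvd_of_map_eq_zero hP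
  have hC : (C c : MvPolynomial (Fin 2) R) ≠ 0 := by rwa [Ne, C_eq_zero]
  have hjs : jac f s = 1 := by
    apply mul_left_cancel₀ hC
    rw [mul_one, ← smul_eq_C_mul, ← Derivation.map_smul, smul_eq_C_mul, ← hs, map_sub, hjb,
      jac_aeval_left, sub_zero]
  refine ⟨s, hjs, ?_⟩
  have hgs : Gen (map (algebraMap R K) f) (map (algebraMap R K) s) := by
    have h4 := hg.add_aeval (-Polynomial.C (algebraMap R K c)⁻¹ * (P.map (algebraMap R K)))
    have hc' : algebraMap R K c ≠ 0 := by simpa using hc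
    have h5 : map (algebraMap R K) s = h + Polynomial.aeval (map (algebraMap R K) f)
        (-Polynomial.C (algebraMap R K c)⁻¹ * (P.map (algebraMap R K))) := by
      have h6 := congrArg (map (algebraMap R K)) hs
      have h7 := map_ev (algebraMap R K) f f (Polynomial.C P)
      rw [Polynomial.map_C, Polynomial.coe_mapRingHom, ev_C, ev_C] at h7
      rw [map_sub, map_mul, h7, ← hb, map_C] at h6
      have hC' : (C (algebraMap R K c) : MvPolynomial (Fin 2) K) ≠ 0 := by rwa [Ne, C_eq_zero]
      apply mul_left_cancel₀ hC'
      have h8 : (C (algebraMap R K c) : MvPolynomial (Fin 2) K) * C (algebraMap R K c)⁻¹ = 1 := by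
        rw [← map_mul, mul_inv_cancel₀ hc', map_one]
      rw [← h6, map_mul, map_neg, Polynomial.aeval_C, MvPolynomial.algebraMap_eq]
      linear_combination Polynomial.aeval (map (algebraMap R K) f)
        (P.map (algebraMap R K)) * h8
    rwa [h5]
  rw [Gen, eq_top_iff]
  intro n _
  obtain ⟨c', hc', P, hP⟩ := exists_smul_mem_adjoin (R := R) (K := K) (f := f) (s := s)
    (x := map (algebraMap R K) n) (by rw [hgs]; trivial)
  rw [← map_C, ← map_mul] at hP
  have hP := hinj hP
  have hg' := (hq c' hc').gen (s := map _ s) (by rw [← map_jac, hjs, map_one])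
  have h8 : ev (map (Ideal.Quotient.mk (Ideal.span {c'})) f)
      (map (Ideal.Quotient.mk (Ideal.span {c'})) s)
      (P.map (Polynomial.mapRingHom (Ideal.Quotient.mk (Ideal.span {c'})))) = 0 := by
    rw [← map_ev, ← hP, map_mul, map_C,
      Ideal.Quotient.eq_zero_iff_mem.2 (Ideal.mem_span_singleton_self c'), map_zero, zero_mul]
  obtain ⟨Q, rfl⟩ := C_C_dvd_of_map_eq_zero c' P (hg'.injective_ev (by rw [h8, map_zero]))
  rw [map_mul, ev_C, Polynomial.aeval_C, MvPolynomial.algebraMap_eq] at hP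
  have hC' : (C c' : MvPolynomial (Fin 2) R) ≠ 0 := by rwa [Ne, C_eq_zero]
  rw [mul_left_cancel₀ hC' hP, mem_adjoin_pair]
  exact ⟨Q, rfl⟩

theorem isVar_of_fields_of_rat [IsNoetherianRing R] [Algebra ℚ R] (f : MvPolynomial (Fin 2) R)
    (hf : ∀ (k : Type) [Field k] (φ : R →+* k), IsVar (map φ f)) : IsVar f := by
  have main : ∀ I : Ideal R, ∀ (S : Type) [CommRing S] [Algebra ℚ S] (π : R →+* S),
      Function.Surjective π → RingHom.ker π = I → HasSlice (map π f) := by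
    intro I
    induction I using WellFoundedGT.induction with
    | ind I ih =>
      intro S _ _ π hπ hI
      have : IsNoetherianRing S := isNoetherianRing_of_surjective R S π hπ
      have hq : ∀ c : S, c ≠ 0 →
          HasSlice (map (Ideal.Quotient.mk (Ideal.span {c})) (map π f)) := by
        intro c hc
        rw [map_map]
        refine ih _ ?_ _ _ (Ideal.Quotient.mk_surjective.comp hπ) rfl
        subst hI
        rw [lt_iff_le_and_ne]
        constructor
        · intro x hx
          rw [RingHom.mem_ker] at hx ⊢
          simp [hx]
        · intro h
          obtain ⟨x, rfl⟩ := hπ c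
          apply hc
          rw [← RingHom.mem_ker, h, RingHom.mem_ker, RingHom.comp_apply,
            Ideal.Quotient.eq_zero_iff_mem]
          exact Ideal.mem_span_singleton_self _
      rcases subsingleton_or_nontrivial S with hS | hS
      · have : Subsingleton (MvPolynomial (Fin 2) S) := inferInstance
        exact ⟨0, Subsingleton.elim _ _, Subsingleton.elim _ _⟩
      by_cases hd : ∃ a b : S, a ≠ 0 ∧ b ≠ 0 ∧ a * b = 0
      · obtain ⟨a, b, ha, hb, hab⟩ := hd
        exact hasSlice_of_mul_eq_zero hab (hq a ha) (hq b hb)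
      · push Not at hd
        have : NoZeroDivisors S := ⟨fun {a b} h => by
          by_contra! hne
          exact hd a b hne.1 hne.2 h⟩
        have : IsDomain S := NoZeroDivisors.to_isDomain S
        refine hasSlice_of_isDomain ?_ hq
        rw [map_map]
        exact hf _ _
  obtain ⟨s, _, hs⟩ := main ⊥ R (RingHom.id R) Function.surjective_id (by
    rw [RingHom.ker_eq_bot_iff_eq_zero]; simp)
  rw [map_id] at hs
  exact ⟨s, hs⟩

end CharZero

end

section

section Injectivity
variable {R : Type} [CommRing R]

lemma ev_comp {f v : MvPolynomial (Fin 2) R} (W P : Polynomial (Polynomial R)) :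
    ev f (ev f v W) P = ev f v (P.comp W) := by
  induction P using Polynomial.induction_on' with
  | add p q hp hq => simp only [map_add, Polynomial.add_comp, hp, hq]
  | monomial n p =>
    rw [← Polynomial.C_mul_X_pow_eq_monomial]
    simp

lemma coeff_eq_zero_of_comp_eq_X [IsReduced R] {P Q : Polynomial R} (h : P.comp Q = Polynomial.X)
    {n : ℕ} (hn : 2 ≤ n) : Q.coeff n = 0 := by
  have : Q.coeff n ∈ nilradical R := by
    rw [nilradical_eq_sInf, Submodule.mem_sInf]
    intro (I : Ideal R) hI
    have hI : Ideal.IsPrime I := hI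
    have h1 := congrArg (Polynomial.map (Ideal.Quotient.mk I)) h
    rw [Polynomial.map_comp, Polynomial.map_X] at h1
    have h2 := congrArg Polynomial.natDegree h1
    rw [Polynomial.natDegree_comp, Polynomial.natDegree_X] at h2
    have h3 := Nat.eq_one_of_mul_eq_one_left h2
    have h4 := Polynomial.coeff_eq_zero_of_natDegree_lt (h3.trans_lt (show 1 < n by omega))
    rwa [Polynomial.coeff_map, Ideal.Quotient.eq_zero_iff_mem] at h4
  exact (mem_nilradical.1 this).eq_zero

instance isReduced_polynomial [IsReduced R] : IsReduced (Polynomial R) :=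
  ⟨fun _ hp => Polynomial.ext fun i => (Polynomial.isNilpotent_iff.1 hp i).eq_zero⟩

lemma Gen.exists_eq_add_aeval [IsReduced R] [IsNoetherianRing R] {f v w : MvPolynomial (Fin 2) R}
    (hv : Gen f v) (hw : Gen f w) (hjv : jac f v = 1) (hjw : jac f w = 1) :
    ∃ p : Polynomial R, w = v + Polynomial.aeval f p := by
  obtain ⟨W, hW⟩ := gen_iff_surjective.1 hv w
  obtain ⟨V, hV⟩ := gen_iff_surjective.1 hw v
  have h1 : V.comp W = Polynomial.X := hv.injective_ev (by rw [← ev_comp, hW, hV, ev_X])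
  have h2 : W = Polynomial.C (W.coeff 0) + Polynomial.C (W.coeff 1) * Polynomial.X := by
    ext1 n
    rcases n with _ | _ | n
    · simp
    · simp
    · rw [coeff_eq_zero_of_comp_eq_X h1 (n := n + 1 + 1) (by omega)]
      simp
  have h3 : Polynomial.derivative W = 1 := by
    apply hv.injective_ev
    rw [map_one, ← hjw, ← hW, derivation_ev, hjv, mul_one]
  have h4 : W.coeff 1 = 1 := by
    have := congrArg (fun p => Polynomial.coeff p 0) h3
    simpa [Polynomial.coeff_derivative] using this
  refine ⟨W.coeff 0, ?_⟩
  rw [← hW]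
  nth_rw 1 [h2]
  rw [h4]
  simp [add_comm]

lemma Gen.injective_or [IsDomain R] [IsNoetherianRing R] {f v : MvPolynomial (Fin 2) R}
    (hv : Gen f v) (b : MvPolynomial (Fin 2) R) :
    (∃ p : Polynomial R, b = Polynomial.aeval f p) ∨
      Function.Injective (ev (R := R) f b) := by
  obtain ⟨W, rfl⟩ := gen_iff_surjective.1 hv b
  by_cases h : W.natDegree = 0
  · left
    rw [Polynomial.natDegree_eq_zero] at h
    obtain ⟨p, rfl⟩ := h
    exact ⟨p, ev_C _ _ _⟩
  · right
    rw [injective_iff_map_eq_zero]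
    intro P hP
    rw [ev_comp] at hP
    have := hv.injective_ev (hP.trans (map_zero _).symm)
    rw [Polynomial.comp_eq_zero_iff] at this
    rcases this with h1 | ⟨_, h1⟩
    · exact h1
    · exact absurd (by rw [h1, Polynomial.natDegree_C]) h

lemma injective_ev_of_jac_eq_one [IsNoetherianRing R] (f w : MvPolynomial (Fin 2) R)
    (hj : jac f w = 1)
    (hf : ∀ (k : Type) [Field k] (φ : R →+* k), IsVar (map φ f)) :
    Function.Injective (ev (R := R) f w) := by
  have main : ∀ I : Ideal R, ∀ (S : Type) [CommRing S] (π : R →+* S),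
      Function.Surjective π → RingHom.ker π = I →
      Function.Injective (ev (R := S) (map π f) (map π w)) := by
    intro I
    induction I using WellFoundedGT.induction with
    | ind I ih =>
      intro S _ π hπ hI
      have hlt : ∀ J : Ideal S, J ≠ ⊥ →
          Function.Injective (ev (R := S ⧸ J) (map (Ideal.Quotient.mk J) (map π f))
            (map (Ideal.Quotient.mk J) (map π w))) := by
        intro J hJ
        rw [map_map, map_map]
        refine ih _ ?_ _ _ (Ideal.Quotient.mk_surjective.comp hπ) rfl
        subst hI
        rw [lt_iff_le_and_ne]
        constructor
        · intro x hx
          rw [RingHom.mem_ker] at hx ⊢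
          simp [hx]
        · intro h
          apply hJ
          rw [eq_bot_iff]
          intro c hc
          obtain ⟨x, rfl⟩ := hπ c
          rw [Ideal.mem_bot, ← RingHom.mem_ker, h, RingHom.mem_ker, RingHom.comp_apply,
            Ideal.Quotient.eq_zero_iff_mem]
          exact hc
      rcases subsingleton_or_nontrivial S with hS | hS
      · intro x y _
        exact Subsingleton.elim x y
      rw [injective_iff_map_eq_zero]
      intro P hP
      have hred : ∀ (J : Ideal S), J ≠ ⊥ → ∀ Q : Polynomial (Polynomial S),
          map (Ideal.Quotient.mk J) (ev (map π f) (map π w) Q) = 0 →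
          Q.map (Polynomial.mapRingHom (Ideal.Quotient.mk J)) = 0 := by
        intro J hJ Q hQ
        rw [map_ev] at hQ
        exact hlt J hJ (hQ.trans (map_zero _).symm)
      by_cases hd : ∃ a b : S, a ≠ 0 ∧ b ≠ 0 ∧ a * b = 0
      · obtain ⟨a, b, ha, hb, hab⟩ := hd
        obtain ⟨Q, rfl⟩ := C_C_dvd_of_map_eq_zero a P
          (hred _ (by rwa [Ne, Ideal.span_singleton_eq_bot]) P (by rw [hP, map_zero]))
        have hJ : (Submodule.annihilator (Ideal.span {a})) ≠ ⊥ := by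
          intro h
          apply hb
          rw [← Ideal.mem_bot, ← h, Submodule.mem_annihilator_span_singleton, smul_eq_mul,
            mul_comm, hab]
        have h2 := hred _ hJ Q (by
          rw [map_mul, ev_C, Polynomial.aeval_C, MvPolynomial.algebraMap_eq] at hP
          ext d
          rw [coeff_map, coeff_zero, Ideal.Quotient.eq_zero_iff_mem,
            Submodule.mem_annihilator_span_singleton, smul_eq_mul, mul_comm, ← coeff_C_mul, hP,
            coeff_zero])
        ext i j
        have h3 := congrArg (fun p => (p.coeff i).coeff j) h2
        simp only [Polynomial.coeff_map, Polynomial.coe_mapRingHom, Polynomial.coeff_zero,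
          Ideal.Quotient.eq_zero_iff_mem, Submodule.mem_annihilator_span_singleton] at h3
        rw [Polynomial.coeff_C_mul, Polynomial.coeff_C_mul, mul_comm]
        simpa using h3
      · push Not at hd
        have : NoZeroDivisors S := ⟨fun {a b} h => by
          by_contra! hne
          exact hd a b hne.1 hne.2 h⟩
        have : IsDomain S := NoZeroDivisors.to_isDomain S
        set ι := algebraMap S (FractionRing S)
        obtain ⟨v, hv⟩ := hf (FractionRing S) (ι.comp π)
        have hinj : Function.Injective (ev (R := FractionRing S) (map (ι.comp π) f) (map (ι.comp π) w)) := by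
          rcases hv.injective_or (map (ι.comp π) w) with ⟨p, hp⟩ | h
          · have h1 := map_jac (ι.comp π) f w
            rw [hj, map_one, hp, jac_aeval_left] at h1
            exact absurd h1 one_ne_zero
          · exact h
        have h1 := map_ev ι (map π f) (map π w) P
        rw [hP, map_zero, map_map, map_map] at h1
        have h2 := hinj (h1.symm.trans (map_zero _).symm)
        have hi : Function.Injective ι := IsFractionRing.injective S (FractionRing S)
        refine Polynomial.map_injective (Polynomial.mapRingHom ι) (Polynomial.map_injective ι hi) ?_
        · rw [Polynomial.map_zero]; exact h2
  have := main _ R (RingHom.id R) Function.surjective_id rfl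
  simpa only [map_id] using this

end Injectivity

end

section

section Models
variable {R K : Type} [CommRing R] [Field K] [Algebra R K]

/-- The polynomials over `K` with coefficients in `S`. -/
def polyIn (S : Subalgebra R K) : Subring (MvPolynomial (Fin 2) K) :=
  (map (algebraMap S K)).range

lemma mem_polyIn {S : Subalgebra R K} {x : MvPolynomial (Fin 2) K} :
    x ∈ polyIn S ↔ ∀ d, coeff d x ∈ S := by
  change x ∈ Set.range (map (algebraMap S K)) ↔ _
  rw [mem_range_map_iff_coeffs_subset]
  constructor
  · intro h d
    by_cases hd : coeff d x = 0
    · rw [hd]; exact zero_mem _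
    · have := h (coeff_mem_coeffs d hd)
      simpa using this
  · intro h c hc
    rw [Finset.mem_coe, mem_coeffs_iff] at hc
    obtain ⟨d, -, rfl⟩ := hc
    exact ⟨⟨_, h d⟩, rfl⟩

lemma polyIn_mono {S S' : Subalgebra R K} (h : S ≤ S') : polyIn S ≤ polyIn S' :=
  fun _ hx => mem_polyIn.2 fun d => h (mem_polyIn.1 hx d)

lemma map_mem_polyIn (S : Subalgebra R K) (x : MvPolynomial (Fin 2) S) :
    map (algebraMap S K) x ∈ polyIn S := ⟨x, rfl⟩

lemma map_algebraMap_mem_polyIn (S : Subalgebra R K) (x : MvPolynomial (Fin 2) R) :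
    map (algebraMap R K) x ∈ polyIn S :=
  mem_polyIn.2 fun d => by rw [coeff_map]; exact S.algebraMap_mem _

lemma C_mem_polyIn {S : Subalgebra R K} {c : K} (hc : c ∈ S) : C c ∈ polyIn S :=
  ⟨C ⟨c, hc⟩, by rw [map_C]; rfl⟩

/-- Polynomials which have coefficients in `S` modulo `K[f]`. -/
def polyMod (S : Subalgebra R K) (f : MvPolynomial (Fin 2) R) :
    Submodule S (MvPolynomial (Fin 2) K) where
  carrier := {x | ∃ p : Polynomial K, x + Polynomial.aeval (map (algebraMap R K) f) p ∈ polyIn S}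
  zero_mem' := ⟨0, by simp⟩
  add_mem' := by
    rintro x y ⟨p, hp⟩ ⟨q, hq⟩
    refine ⟨p + q, ?_⟩
    have := add_mem hp hq
    rw [map_add]
    convert this using 1
    ring
  smul_mem' := by
    rintro c x ⟨p, hp⟩
    refine ⟨Polynomial.C (c : K) * p, ?_⟩
    have := mul_mem (C_mem_polyIn c.2) hp
    rw [map_mul, Polynomial.aeval_C, MvPolynomial.algebraMap_eq, Algebra.smul_def]
    convert this using 1
    rw [mul_add]
    rfl

lemma mem_polyMod {S : Subalgebra R K} {f : MvPolynomial (Fin 2) R} {x : MvPolynomial (Fin 2) K} :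
    x ∈ polyMod S f ↔
      ∃ p : Polynomial K, x + Polynomial.aeval (map (algebraMap R K) f) p ∈ polyIn S := Iff.rfl

/-- The ideal of denominators of `w` modulo `K[f]`. -/
def denomIdeal (S : Subalgebra R K) (f : MvPolynomial (Fin 2) R) (w : MvPolynomial (Fin 2) K) :
    Ideal S := (polyMod S f).comap (LinearMap.toSpanSingleton S _ w)

lemma mem_denomIdeal {S : Subalgebra R K} {f : MvPolynomial (Fin 2) R}
    {w : MvPolynomial (Fin 2) K} {c : S} :
    c ∈ denomIdeal S f w ↔ c • w ∈ polyMod S f := Iff.rfl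

lemma smul_eq_C_coe_mul {S : Subalgebra R K} (c : S) (w : MvPolynomial (Fin 2) K) :
    c • w = C (c : K) * w := by
  rw [Algebra.smul_def]; rfl

lemma denomIdeal_ne_bot [IsDomain R] [IsFractionRing R K] (S : Subalgebra R K)
    (f : MvPolynomial (Fin 2) R) (w : MvPolynomial (Fin 2) K) : denomIdeal S f w ≠ ⊥ := by
  obtain ⟨c, hc, b, hb⟩ := exists_C_mul_eq_map (R := R) w
  intro h
  have : algebraMap R S c ∈ denomIdeal S f w := by
    rw [mem_denomIdeal, smul_eq_C_coe_mul, mem_polyMod]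
    refine ⟨0, ?_⟩
    rw [map_zero, add_zero]
    change C (algebraMap R K c) * w ∈ _
    rw [hb]
    exact map_algebraMap_mem_polyIn S b
  rw [h, Ideal.mem_bot] at this
  have h2 := congrArg (algebraMap S K) this
  rw [map_zero, ← IsScalarTower.algebraMap_apply] at h2
  exact hc (by simpa using h2)

lemma map_map_subalgebra (S : Subalgebra R K) (f : MvPolynomial (Fin 2) R) :
    map (algebraMap S K) (map (algebraMap R S) f) = map (algebraMap R K) f := by
  rw [map_map, ← IsScalarTower.algebraMap_eq]

/-- The hypotheses on a residual variable `f` with generic complement `w`. -/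
structure ResVar (f : MvPolynomial (Fin 2) R) (w : MvPolynomial (Fin 2) K) : Prop where
  gen : Gen (map (algebraMap R K) f) w
  jac_eq : jac (map (algebraMap R K) f) w = 1
  fields : ∀ (k : Type) [Field k] (φ : R →+* k), IsVar (map φ f)

lemma ResVar.fields' {f : MvPolynomial (Fin 2) R} {w : MvPolynomial (Fin 2) K} (H : ResVar f w)
    (S : Subalgebra R K) (k : Type) [Field k] (φ : S →+* k) :
    IsVar (map φ (map (algebraMap R S) f)) := by
  rw [map_map]; exact H.fields _ _

lemma injective_map_subalgebra (S : Subalgebra R K) :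
    Function.Injective (map (algebraMap S K) : MvPolynomial (Fin 2) S →+* _) :=
  map_injective _ Subtype.val_injective

lemma ResVar.exists_gen [IsDomain R] [IsFractionRing R K]
    {f : MvPolynomial (Fin 2) R} {w : MvPolynomial (Fin 2) K} (H : ResVar f w)
    (S : Subalgebra R K) [IsNoetherianRing S] (p : Polynomial K)
    (hw : w + Polynomial.aeval (map (algebraMap R K) f) p ∈ polyIn S) :
    ∃ s, map (algebraMap S K) s = w + Polynomial.aeval (map (algebraMap R K) f) p ∧
      Gen (map (algebraMap R S) f) s ∧ jac (map (algebraMap R S) f) s = 1 := by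
  obtain ⟨s, hs⟩ := hw
  have hinj := injective_map_subalgebra S
  have hj : jac (map (algebraMap R S) f) s = 1 := by
    apply hinj
    rw [map_jac, map_map_subalgebra]
    erw [hs]
    rw [map_add, H.jac_eq, jac_aeval_left, add_zero, map_one]
  refine ⟨s, hs, ?_, hj⟩
  have hg := H.gen.add_aeval p
  rw [← hs, ← map_map_subalgebra S] at hg
  rw [Gen, eq_top_iff]
  intro n _
  obtain ⟨c, hc, P, hP⟩ := exists_smul_mem_adjoin (R := S) (K := K) (f := map (algebraMap R S) f)
    (s := s) (x := map (algebraMap S K) n) (by rw [hg]; trivial)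
  rw [← map_C, ← map_mul] at hP
  have hP := hinj hP
  have hi := injective_ev_of_jac_eq_one (map (Ideal.Quotient.mk (Ideal.span {c}))
    (map (algebraMap R S) f)) (map _ s) (by rw [← map_jac, hj, map_one])
    (fun k _ φ => by rw [map_map]; exact H.fields' S _ _)
  have h8 : ev (map (Ideal.Quotient.mk (Ideal.span {c})) (map (algebraMap R S) f))
      (map (Ideal.Quotient.mk (Ideal.span {c})) s)
      (P.map (Polynomial.mapRingHom (Ideal.Quotient.mk (Ideal.span {c})))) = 0 := by
    rw [← map_ev, ← hP, map_mul, map_C,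
      Ideal.Quotient.eq_zero_iff_mem.2 (Ideal.mem_span_singleton_self c), map_zero, zero_mul]
  obtain ⟨Q, rfl⟩ := C_C_dvd_of_map_eq_zero c P (hi (by rw [h8, map_zero]))
  rw [map_mul, ev_C, Polynomial.aeval_C, MvPolynomial.algebraMap_eq] at hP
  have hC' : (C c : MvPolynomial (Fin 2) S) ≠ 0 := by rwa [Ne, C_eq_zero]
  rw [mul_left_cancel₀ hC' hP, mem_adjoin_pair]
  exact ⟨Q, rfl⟩

end Models

end

section

section Retraction

lemma exists_dual_powers {S : Type} [CommRing S] [IsLocalRing S] {f : MvPolynomial (Fin 2) S}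
    (hf : IsVar (map (IsLocalRing.residue S) f)) (d : ℕ) :
    ∃ G : MvPolynomial (Fin 2) S →ₗ[S] (Fin (d + 1) → S), ∀ i : Fin (d + 1),
      G (f ^ (i : ℕ)) = Pi.single i 1 := by
  obtain ⟨v, hv⟩ := hf
  set κ := IsLocalRing.ResidueField S
  set fκ := map (IsLocalRing.residue S) f
  let L : (Fin (d + 1) → κ) →ₗ[κ] MvPolynomial (Fin 2) κ :=
    Fintype.linearCombination κ (fun i : Fin (d + 1) => fκ ^ (i : ℕ))
  have hL : LinearMap.ker L = ⊥ := by
    rw [LinearMap.ker_eq_bot, ← linearIndependent_iff_injective_fintypeLinearCombination]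
    have h1 : Function.Injective (Polynomial.aeval fκ : Polynomial κ →ₐ[κ] _) := by
      intro p q hpq
      apply Polynomial.C_injective
      apply hv.injective_ev
      rwa [ev_C, ev_C]
    have h2 : LinearIndependent κ (fun i : Fin (d + 1) => (Polynomial.X : Polynomial κ) ^ (i : ℕ)) := by
      have := (Polynomial.basisMonomials κ).linearIndependent.comp
        (fun i : Fin (d + 1) => (i : ℕ)) Fin.val_injective
      convert this using 1
      ext1 i
      simp [Polynomial.X_pow_eq_monomial]
    have h3 := h2.map' (Polynomial.aeval fκ).toLinearMap (LinearMap.ker_eq_bot.2 h1)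
    simpa [Function.comp_def] using h3
  obtain ⟨g, hg⟩ := L.exists_leftInverse_of_injective hL
  choose c hc using fun (α : Fin 2 →₀ ℕ) (j : Fin (d + 1)) =>
    IsLocalRing.residue_surjective (g (monomial α 1) j)
  let G : MvPolynomial (Fin 2) S →ₗ[S] (Fin (d + 1) → S) := (basisMonomials (Fin 2) S).constr S c
  have hG : ∀ p j, IsLocalRing.residue S (G p j) = g (map (IsLocalRing.residue S) p) j := by
    intro p
    induction p using MvPolynomial.induction_on' with
    | monomial α a =>
      intro j
      have h1 : monomial α a = a • basisMonomials (Fin 2) S α := by simp [smul_monomial]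
      have h2 : monomial α (IsLocalRing.residue S a) =
        IsLocalRing.residue S a • (monomial α (1 : κ)) := by simp [smul_monomial]
      rw [h1, map_smul, Module.Basis.constr_basis, Pi.smul_apply, smul_eq_mul, map_mul, hc, ← h1,
        map_monomial, h2, map_smul, Pi.smul_apply, smul_eq_mul]
    | add p q hp hq =>
      intro j
      rw [map_add, map_add, map_add, Pi.add_apply, Pi.add_apply, map_add, hp, hq]
  let A : Matrix (Fin (d + 1)) (Fin (d + 1)) S := Matrix.of fun i j => G (f ^ (i : ℕ)) j
  have hA : A.map (IsLocalRing.residue S) = 1 := by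
    ext i j
    rw [Matrix.map_apply, show A i j = G (f ^ (i : ℕ)) j from rfl, hG, map_pow]
    have := congrArg (fun φ => φ (Pi.single i 1) j) hg
    simp only [LinearMap.comp_apply, LinearMap.id_apply] at this
    rw [Fintype.linearCombination_apply_single, one_smul] at this
    rw [this, Matrix.one_apply, Pi.single_apply]
    simp [eq_comm]
  have hdet : IsUnit A.det := by
    apply IsUnit.of_map (IsLocalRing.residue S)
    rw [RingHom.map_det, RingHom.mapMatrix_apply, hA, Matrix.det_one]
    exact isUnit_one
  refine ⟨(Matrix.vecMulLinear A⁻¹).comp G, fun i => ?_⟩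
  rw [LinearMap.comp_apply, Matrix.vecMulLinear_apply]
  have : G (f ^ (i : ℕ)) = Matrix.vecMul (Pi.single i 1) A := by
    rw [Matrix.single_one_vecMul]; rfl
  rw [this, Matrix.vecMul_vecMul, Matrix.mul_nonsing_inv _ hdet, Matrix.vecMul_one]

variable {R K : Type} [CommRing R] [Field K] [Algebra R K]

lemma ResVar.exists_retraction {f : MvPolynomial (Fin 2) R} {w : MvPolynomial (Fin 2) K}
    (H : ResVar f w) (S : Subalgebra R K) [IsLocalRing S] (d : ℕ) :
    ∃ ρ : MvPolynomial (Fin 2) K →ₗ[K] MvPolynomial (Fin 2) K,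
      (∀ x ∈ polyIn S, ρ x ∈ polyIn S) ∧
      (∀ p : Polynomial K, p.natDegree ≤ d →
        ρ (Polynomial.aeval (map (algebraMap R K) f) p) = 0) ∧
      ∀ x, ∃ p : Polynomial K, ρ x = x + Polynomial.aeval (map (algebraMap R K) f) p := by
  obtain ⟨G, hG⟩ := exists_dual_powers (H.fields' S _ (IsLocalRing.residue S)) d
  set fK := map (algebraMap R K) f
  let χ : MvPolynomial (Fin 2) K →ₗ[K] (Fin (d + 1) → K) :=
    (basisMonomials (Fin 2) K).constr K (fun α j => (G (monomial α 1) j : K))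
  have hχ : ∀ p j, χ (map (algebraMap S K) p) j = (G p j : K) := by
    intro p
    induction p using MvPolynomial.induction_on' with
    | monomial α a =>
      intro j
      have h1 : monomial α a = a • (monomial α (1 : S)) := by simp [smul_monomial]
      have h2 : monomial α (algebraMap S K a) = (a : K) • basisMonomials (Fin 2) K α := by
        simp [smul_monomial]
      rw [map_monomial, h2, map_smul, Module.Basis.constr_basis, h1, map_smul, Pi.smul_apply,
        Pi.smul_apply, smul_eq_mul, smul_eq_mul]
      rfl
    | add p q hp hq =>
      intro j
      rw [map_add, map_add, map_add, Pi.add_apply, Pi.add_apply, hp, hq]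
      rfl
  have hχf : ∀ i : Fin (d + 1), χ (fK ^ (i : ℕ)) = Pi.single i 1 := by
    intro i
    ext j
    have := hχ (map (algebraMap R S) f ^ (i : ℕ)) j
    rw [map_pow, map_map_subalgebra] at this
    rw [this, hG, Pi.single_apply, Pi.single_apply]
    split_ifs <;> rfl
  refine ⟨LinearMap.id - (Fintype.linearCombination K fun i : Fin (d + 1) => fK ^ (i : ℕ)).comp χ,
    ?_, ?_, ?_⟩
  · rintro x ⟨x, rfl⟩
    rw [LinearMap.sub_apply, LinearMap.id_apply, LinearMap.comp_apply,
      Fintype.linearCombination_apply]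
    refine sub_mem ⟨x, rfl⟩ (sum_mem fun i _ => ?_)
    rw [smul_eq_C_mul]
    refine mul_mem (C_mem_polyIn ?_) (pow_mem (map_algebraMap_mem_polyIn S f) _)
    erw [hχ]
    exact SetLike.coe_mem _
  · intro p hp
    rw [LinearMap.sub_apply, LinearMap.id_apply, LinearMap.comp_apply, sub_eq_zero]
    rw [Polynomial.aeval_eq_sum_range' (Nat.lt_succ_of_le hp), ← Fin.sum_univ_eq_sum_range
      (fun i => p.coeff i • fK ^ i), map_sum, map_sum]
    refine Finset.sum_congr rfl fun i _ => ?_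
    rw [map_smul, hχf, map_smul, Fintype.linearCombination_apply_single, one_smul]
  · intro x
    refine ⟨-∑ i : Fin (d + 1), Polynomial.C (χ x i) * Polynomial.X ^ (i : ℕ), ?_⟩
    rw [LinearMap.sub_apply, LinearMap.id_apply, LinearMap.comp_apply,
      Fintype.linearCombination_apply, sub_eq_add_neg]
    simp only [map_neg, map_sum, map_mul, Polynomial.aeval_C, map_pow, Polynomial.aeval_X,
      MvPolynomial.algebraMap_eq, smul_eq_C_mul]

end Retraction

end

section

section Principal

lemma C_C_dvd_of_map_eq_zero' {R S : Type} [CommRing R] [CommRing S] (φ : R →+* S) {c : R}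
    (hφ : ∀ x, φ x = 0 → c ∣ x) (p : Polynomial (Polynomial R))
    (hp : p.map (Polynomial.mapRingHom φ) = 0) : Polynomial.C (Polynomial.C c) ∣ p := by
  rw [Polynomial.C_dvd_iff_dvd_coeff]
  intro i
  rw [Polynomial.C_dvd_iff_dvd_coeff]
  intro j
  apply hφ
  have := congrArg (fun p => (p.coeff i).coeff j) hp
  simpa using this

lemma C_dvd_of_map_eq_zero' {R S σ : Type} [CommRing R] [CommRing S] (φ : R →+* S) {c : R}
    (hφ : ∀ x, φ x = 0 → c ∣ x) (p : MvPolynomial σ R) (hp : map φ p = 0) : C c ∣ p := by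
  rw [C_dvd_iff_dvd_coeff]
  intro i
  apply hφ
  rw [← coeff_map, hp, coeff_zero]

variable {R K : Type} [CommRing R] [IsDomain R] [Field K] [Algebra R K] [IsFractionRing R K]

omit [IsDomain R] in
lemma ResVar.pow_mem_denomIdeal {f : MvPolynomial (Fin 2) R} {w : MvPolynomial (Fin 2) K}
    (H : ResVar f w) (S : Subalgebra R K) [IsLocalRing S] [IsNoetherianRing S] (π : S)
    (hπ : IsLocalRing.maximalIdeal S = Ideal.span {π}) (hπ0 : π ≠ 0) (n : ℕ)
    (hn : π ^ (n + 1) ∈ denomIdeal S f w) : π ^ n ∈ denomIdeal S f w := by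
  rw [mem_denomIdeal, mem_polyMod, smul_eq_C_coe_mul] at hn ⊢
  obtain ⟨p, b, hb⟩ := hn
  have hπK : (π : K) ≠ 0 := by simpa using hπ0
  have hinj := injective_map_subalgebra S
  have hres : ∀ x : S, IsLocalRing.residue S x = 0 → π ∣ x := by
    intro x hx
    rwa [IsLocalRing.residue_eq_zero_iff, hπ, Ideal.mem_span_singleton] at hx
  have hCπ : (C π : MvPolynomial (Fin 2) S) ≠ 0 := by rwa [Ne, C_eq_zero]
  have hresπ : IsLocalRing.residue S π = 0 := by
    rw [IsLocalRing.residue_eq_zero_iff, hπ]; exact Ideal.mem_span_singleton_self _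
  obtain ⟨v, hv⟩ := H.fields' S _ (IsLocalRing.residue S)
  set fS := map (algebraMap R S) f with hfS
  have hfSK : map (algebraMap S K) fS = map (algebraMap R K) f := map_map_subalgebra S f
  rcases hv.injective_or (map (IsLocalRing.residue S) b) with ⟨q, hq⟩ | hi
  · obtain ⟨q, rfl⟩ := Polynomial.map_surjective _ IsLocalRing.residue_surjective q
    have h1 := map_ev (IsLocalRing.residue S) fS fS (Polynomial.C q)
    rw [Polynomial.map_C, Polynomial.coe_mapRingHom, ev_C, ev_C] at h1
    rw [← h1, ← sub_eq_zero, ← map_sub] at hq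
    obtain ⟨e, he⟩ := C_dvd_of_map_eq_zero' _ hres _ hq
    refine ⟨Polynomial.C (π : K)⁻¹ * (p - q.map (algebraMap S K)), e, ?_⟩
    have h2 := congrArg (map (algebraMap S K)) he
    have h3 := map_ev (algebraMap S K) fS fS (Polynomial.C q)
    rw [Polynomial.map_C, Polynomial.coe_mapRingHom, ev_C, ev_C] at h3
    change map (algebraMap S K) b = _ at hb
    change map (algebraMap S K) e = _
    rw [map_sub, map_mul, h3, hb, hfSK, map_C] at h2
    have hC' : (C (π : K) : MvPolynomial (Fin 2) K) ≠ 0 := by rwa [Ne, C_eq_zero]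
    have h8 : (C (π : K) : MvPolynomial (Fin 2) K) * C (π : K)⁻¹ = 1 := by
      rw [← map_mul, mul_inv_cancel₀ hπK, map_one]
    apply mul_left_cancel₀ hC'
    change _ = C (π : K) * _ at h2
    rw [← h2, map_mul, Polynomial.aeval_C, map_sub, MvPolynomial.algebraMap_eq]
    simp only [SubmonoidClass.coe_pow, map_pow]
    linear_combination (-1 : MvPolynomial (Fin 2) K) *
      (Polynomial.aeval (map (algebraMap R K) f) p -
      Polynomial.aeval (map (algebraMap R K) f) (q.map (algebraMap S K))) * h8
  · exfalso
    have hb : map (algebraMap S K) b = C (((π ^ (n + 1) : S)) : K) * w +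
      Polynomial.aeval (map (algebraMap R K) f) p := hb
    let D : Ideal S :=
      (Subalgebra.toSubmodule (Algebra.adjoin S {fS, b})).comap
        (LinearMap.toSpanSingleton S _ (X 0)) ⊓
      (Subalgebra.toSubmodule (Algebra.adjoin S {fS, b})).comap
        (LinearMap.toSpanSingleton S _ (X 1))
    have hD : ∀ c, c ∈ D ↔ ∀ i : Fin 2, C c * X i ∈ Algebra.adjoin S {fS, b} := by
      intro c
      rw [Submodule.mem_inf, Fin.forall_fin_two]
      simp only [← smul_eq_C_mul]
      rfl
    have hgK : Gen (map (algebraMap S K) fS) (map (algebraMap S K) b) := by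
      rw [hb, hfSK]
      exact (H.gen.C_mul (Units.mk0 (((π ^ (n + 1) : S)) : K) (by simpa using hπ0))).add_aeval p
    have hD0 : D ≠ ⊥ := by
      have h1 : ∀ i : Fin 2, ∃ c : S, c ≠ 0 ∧ C c * X i ∈ Algebra.adjoin S {fS, b} := by
        intro i
        obtain ⟨c, hc, P, hP⟩ := exists_smul_mem_adjoin (R := S) (K := K) (f := fS) (s := b)
          (x := X i) (by rw [hgK]; trivial)
        refine ⟨c, hc, (mem_adjoin_pair _ _).2 ⟨P, hinj ?_⟩⟩
        rw [← hP, map_mul, map_C, map_X]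
      obtain ⟨c, hc, h1c⟩ := h1 0
      obtain ⟨d, hd, h1d⟩ := h1 1
      intro h
      have : c * d ∈ D := by
        rw [hD, Fin.forall_fin_two]
        constructor
        · have := mul_mem (Subalgebra.algebraMap_mem (Algebra.adjoin S {fS, b}) d) h1c
          rw [MvPolynomial.algebraMap_eq] at this
          convert this using 1
          rw [map_mul]; ring
        · have := mul_mem (Subalgebra.algebraMap_mem (Algebra.adjoin S {fS, b}) c) h1d
          rw [MvPolynomial.algebraMap_eq] at this
          convert this using 1
          rw [map_mul]; ring
      rw [h, Ideal.mem_bot] at this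
      exact mul_ne_zero hc hd this
    by_cases hDt : D = ⊤
    · have hg : Gen fS b := by
        rw [gen_iff_X]
        have h1 : (1 : S) ∈ D := by rw [hDt]; trivial
        rw [hD] at h1
        simp only [map_one, one_mul] at h1
        exact ⟨h1 0, h1 1⟩
      have hj : jac fS b = C (π ^ (n + 1)) := by
        apply hinj
        rw [map_jac, hb, hfSK, map_add, jac_aeval_left, add_zero, ← smul_eq_C_mul,
          Derivation.map_smul, H.jac_eq, smul_eq_C_mul, mul_one, map_C]
        rfl
      have hu := (hg.isUnit_jac).map (map (IsLocalRing.residue S))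
      rw [hj, map_C, map_pow, hresπ, zero_pow (Nat.succ_ne_zero _), map_zero] at hu
      exact not_isUnit_zero hu
    · apply hD0
      have hDm := IsLocalRing.le_maximalIdeal hDt
      apply Submodule.eq_bot_of_le_smul_of_le_jacobson_bot (IsLocalRing.maximalIdeal S) D
        (IsNoetherian.noetherian D) _ (IsLocalRing.maximalIdeal_le_jacobson _)
      intro c hc
      have h1 := hDm hc
      rw [hπ, Ideal.mem_span_singleton] at h1
      obtain ⟨c, rfl⟩ := h1
      rw [hπ, smul_eq_mul]
      refine Ideal.mul_mem_mul (Ideal.mem_span_singleton_self _) ?_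
      rw [hD] at hc ⊢
      intro i
      obtain ⟨P, hP⟩ := (mem_adjoin_pair _ _).1 (hc i)
      have h2 := map_ev (IsLocalRing.residue S) fS b P
      rw [hP, map_mul, map_C, map_mul, hresπ, zero_mul, map_zero, zero_mul] at h2
      obtain ⟨Q, rfl⟩ := C_C_dvd_of_map_eq_zero' _ hres P (hi (by rw [← h2, map_zero]))
      rw [map_mul, ev_C, Polynomial.aeval_C, MvPolynomial.algebraMap_eq, map_mul, mul_assoc] at hP
      exact (mem_adjoin_pair _ _).2 ⟨Q, mul_left_cancel₀ hCπ hP⟩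

omit [IsDomain R] in
lemma ResVar.denomIdeal_eq_top_of_principal {f : MvPolynomial (Fin 2) R}
    {w : MvPolynomial (Fin 2) K}
    (H : ResVar f w) (S : Subalgebra R K) [IsLocalRing S] [IsNoetherianRing S] (π : S)
    (hπ : IsLocalRing.maximalIdeal S = Ideal.span {π}) (hπ0 : π ≠ 0) (n : ℕ)
    (hn : π ^ n ∈ denomIdeal S f w) : denomIdeal S f w = ⊤ := by
  induction n with
  | zero => rwa [pow_zero, ← Ideal.eq_top_iff_one] at hn
  | succ n ih => exact ih (H.pow_mem_denomIdeal S π hπ hπ0 n hn)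

end Principal

end

section

section Localize
variable {R K : Type} [CommRing R] [Field K] [Algebra R K]

/-- Seminormality of a subalgebra of a field, relative to that field. -/
def IsSeminormalIn (S : Subalgebra R K) : Prop := ∀ a : K, a ^ 2 ∈ S → a ^ 3 ∈ S → a ∈ S

lemma IsSeminormalIn.mem_of_pow_mem {S : Subalgebra R K} (hS : IsSeminormalIn S) {y : K} (N : ℕ)
    (h : ∀ n, N ≤ n → y ^ n ∈ S) : y ∈ S := by
  induction N with
  | zero => simpa using h 1 (by omega)
  | succ N ih =>
    rcases Nat.eq_zero_or_pos N with rfl | hN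
    · simpa using h 1 le_rfl
    · refine ih fun n hn => ?_
      rcases hn.eq_or_lt with rfl | hn
      · apply hS
        · rw [← pow_mul]; exact h _ (by omega)
        · rw [← pow_mul]; exact h _ (by omega)
      · exact h n hn

lemma polyMod_mono {S S' : Subalgebra R K} (h : S ≤ S') {f : MvPolynomial (Fin 2) R}
    {x : MvPolynomial (Fin 2) K} (hx : x ∈ polyMod S f) : x ∈ polyMod S' f := by
  obtain ⟨p, hp⟩ := hx
  exact ⟨p, polyIn_mono h hp⟩

variable [IsFractionRing R K]

/-- The localization of a subalgebra of a field at a prime, inside that field. -/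
def locAt (S : Subalgebra R K) (p : Ideal S) [p.IsPrime] : Subalgebra R K :=
  (Localization.subalgebra.ofField K p.primeCompl p.primeCompl_le_nonZeroDivisors).restrictScalars R

variable (S : Subalgebra R K) (p : Ideal S) [p.IsPrime]

lemma mem_locAt {x : K} : x ∈ locAt S p ↔ ∃ t : S, t ∉ p ∧ (t : K) * x ∈ S := by
  change (∃ (a s : S) (_ : s ∈ p.primeCompl), x = algebraMap S K a * (algebraMap S K s)⁻¹) ↔ _
  constructor
  · rintro ⟨a, s, hs, rfl⟩
    refine ⟨s, hs, ?_⟩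
    have : (s : K) ≠ 0 := by
      intro h
      apply hs
      rw [show s = 0 from Subtype.ext h]
      exact zero_mem p
    convert a.2 using 1
    change (s : K) * ((a : K) * (s : K)⁻¹) = a
    field_simp
  · rintro ⟨t, ht, h⟩
    have : (t : K) ≠ 0 := by
      intro h
      apply ht
      rw [show t = 0 from Subtype.ext h]
      exact zero_mem p
    refine ⟨⟨_, h⟩, t, ht, ?_⟩
    change x = ((t : K) * x) * (t : K)⁻¹
    field_simp

lemma le_locAt : S ≤ locAt S p := fun x hx =>
  (mem_locAt S p).2 ⟨1, p.one_notMem, by simpa using hx⟩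

instance algebraLocAt : Algebra S (locAt S p) :=
  inferInstanceAs (Algebra S (Localization.subalgebra.ofField K p.primeCompl
    p.primeCompl_le_nonZeroDivisors))

instance isLocalizationLocAt : IsLocalization.AtPrime (locAt S p) p :=
  inferInstanceAs (IsLocalization p.primeCompl (Localization.subalgebra.ofField K p.primeCompl
    p.primeCompl_le_nonZeroDivisors))

instance isLocalRingLocAt : IsLocalRing (locAt S p) := IsLocalization.AtPrime.isLocalRing _ p

lemma isNoetherianRing_locAt [h : IsNoetherianRing S] : IsNoetherianRing (locAt S p) :=
  IsLocalization.isNoetherianRing p.primeCompl _ h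

lemma maximalIdeal_locAt : IsLocalRing.maximalIdeal (locAt S p) =
    p.map (algebraMap S (locAt S p)) :=
  (IsLocalization.AtPrime.map_eq_maximalIdeal p _).symm

variable {S}

lemma IsSeminormalIn.locAt (hS : IsSeminormalIn S) : IsSeminormalIn (locAt S p) := by
  intro a h2 h3
  obtain ⟨s, hs, h2⟩ := (mem_locAt S p).1 h2
  obtain ⟨t, ht, h3⟩ := (mem_locAt S p).1 h3
  refine (mem_locAt S p).2 ⟨s * t, p.primeCompl.mul_mem hs ht, hS _ ?_ ?_⟩
  · have : ((s * t : S) * a : K) ^ 2 = (s * t ^ 2 : S) * (s * a ^ 2) := by push_cast; ring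
    rw [this]; exact mul_mem (SetLike.coe_mem _) h2
  · have : ((s * t : S) * a : K) ^ 3 = (s ^ 3 * t ^ 2 : S) * (t * a ^ 3) := by push_cast; ring
    rw [this]; exact mul_mem (SetLike.coe_mem _) h3

lemma exists_mul_mem_polyIn {x : MvPolynomial (Fin 2) K} (hx : x ∈ polyIn (locAt S p)) :
    ∃ t : S, t ∉ p ∧ C (t : K) * x ∈ polyIn S := by
  rw [mem_polyIn] at hx
  choose t ht h using fun d => (mem_locAt S p).1 (hx d)
  refine ⟨∏ d ∈ x.support, t d, p.primeCompl.prod_mem fun d _ => ht d, ?_⟩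
  rw [mem_polyIn]
  intro d
  rw [coeff_C_mul]
  by_cases hd : d ∈ x.support
  · rw [← Finset.prod_erase_mul _ _ hd]
    push_cast
    rw [mul_assoc]
    exact mul_mem (prod_mem fun i _ => SetLike.coe_mem _) (h d)
  · rw [notMem_support_iff.1 hd, mul_zero]; exact zero_mem _

lemma exists_mem_denomIdeal_of_locAt {f : MvPolynomial (Fin 2) R} {w : MvPolynomial (Fin 2) K}
    (h : denomIdeal (locAt S p) f w = ⊤) : ∃ t ∈ denomIdeal S f w, t ∉ p := by
  have h1 : (1 : locAt S p) ∈ denomIdeal (locAt S p) f w := by rw [h]; trivial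
  rw [mem_denomIdeal, one_smul, mem_polyMod] at h1
  obtain ⟨q, hq⟩ := h1
  obtain ⟨t, ht, h2⟩ := exists_mul_mem_polyIn p hq
  refine ⟨t, ?_, ht⟩
  rw [mem_denomIdeal, mem_polyMod, smul_eq_C_coe_mul]
  refine ⟨Polynomial.C (t : K) * q, ?_⟩
  rw [map_mul, Polynomial.aeval_C, MvPolynomial.algebraMap_eq, ← mul_add]
  exact h2

omit [IsFractionRing R K] in
lemma map_denomIdeal_le {S' : Subalgebra R K} [Algebra S S'] (hSS : S ≤ S')
    (hcoe : ∀ x : S, (algebraMap S S' x : K) = x) {f : MvPolynomial (Fin 2) R}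
    {w : MvPolynomial (Fin 2) K} :
    (denomIdeal S f w).map (algebraMap S S') ≤ denomIdeal S' f w := by
  rw [Ideal.map_le_iff_le_comap]
  intro x hx
  rw [Ideal.mem_comap, mem_denomIdeal, smul_eq_C_coe_mul, hcoe, ← smul_eq_C_coe_mul]
  exact polyMod_mono hSS hx

/-- Reduction of the local-global step to local rings. -/
lemma denomIdeal_eq_top_of_local {f : MvPolynomial (Fin 2) R} {w : MvPolynomial (Fin 2) K}
    (S : Subalgebra R K) [IsNoetherianRing S] (hS : IsSeminormalIn S)
    (hloc : ∀ (S' : Subalgebra R K) [IsLocalRing S'] [IsNoetherianRing S'] (N : ℕ),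
      IsSeminormalIn S' → IsLocalRing.maximalIdeal S' ^ N ≤ denomIdeal S' f w →
        denomIdeal S' f w = ⊤) : denomIdeal S f w = ⊤ := by
  by_contra hne
  obtain ⟨M, hM, hle⟩ := Ideal.exists_le_maximal _ hne
  obtain ⟨p, hp, -⟩ := Ideal.exists_minimalPrimes_le (I := denomIdeal S f w) hle
  have hpp : p.IsPrime := hp.1.1
  have h1 := IsLocalization.AtPrime.radical_map_of_mem_minimalPrimes (locAt S p) p (denomIdeal S f w) hp
  have := isNoetherianRing_locAt S p
  obtain ⟨N, hN⟩ := Ideal.exists_radical_pow_le_of_fg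
    ((denomIdeal S f w).map (algebraMap S (locAt S p))) (IsNoetherian.noetherian _)
  rw [h1, ← maximalIdeal_locAt] at hN
  obtain ⟨t, ht, htp⟩ := exists_mem_denomIdeal_of_locAt p
    (hloc (locAt S p) N (hS.locAt p) (hN.trans (map_denomIdeal_le (le_locAt S p) fun _ => rfl)))
  exact htp (hp.1.2 ht)

end Localize

end

section

section Stab
variable {R K : Type} [CommRing R] [Field K] [Algebra R K]

/-- The multipliers of the maximal ideal of a local subalgebra of a field. -/
def stab (S : Subalgebra R K) [IsLocalRing S] : Subalgebra R K where
  carrier := {y | ∀ a ∈ IsLocalRing.maximalIdeal S, ∃ b ∈ IsLocalRing.maximalIdeal S, (b : K) = y * a}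
  mul_mem' := by
    intro x y hx hy a ha
    obtain ⟨b, hb, h⟩ := hy a ha
    obtain ⟨c, hc, h'⟩ := hx b hb
    exact ⟨c, hc, by rw [h', h, mul_assoc]⟩
  add_mem' := by
    intro x y hx hy a ha
    obtain ⟨b, hb, h⟩ := hx a ha
    obtain ⟨c, hc, h'⟩ := hy a ha
    exact ⟨b + c, add_mem hb hc, by rw [add_mul, ← h, ← h']; rfl⟩
  algebraMap_mem' := fun r a ha => ⟨algebraMap R S r * a, Ideal.mul_mem_left _ _ ha, rfl⟩

variable {S : Subalgebra R K} [IsLocalRing S]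

lemma mem_stab {y : K} : y ∈ stab S ↔ ∀ a ∈ IsLocalRing.maximalIdeal S,
    ∃ b ∈ IsLocalRing.maximalIdeal S, (b : K) = y * a := Iff.rfl

lemma le_stab : S ≤ stab S := fun y hy a ha =>
  ⟨⟨y, hy⟩ * a, Ideal.mul_mem_left _ _ ha, rfl⟩

instance algebraStab : Algebra S (stab S) := (Subalgebra.inclusion (le_stab (S := S))).toAlgebra

lemma coe_algebraMap_stab (x : S) : ((algebraMap S (stab S) x : stab S) : K) = x := rfl

variable (S) in
/-- The maximal ideal of `S`, as an ideal of its ring of multipliers. -/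
def stabIdeal : Ideal (stab S) where
  carrier := {y | ∃ b ∈ IsLocalRing.maximalIdeal S, (b : K) = y}
  zero_mem' := ⟨0, zero_mem _, rfl⟩
  add_mem' := by
    rintro x y ⟨a, ha, h⟩ ⟨b, hb, h'⟩
    exact ⟨a + b, add_mem ha hb, by push_cast; rw [h, h']⟩
  smul_mem' := by
    rintro c x ⟨a, ha, h⟩
    obtain ⟨b, hb, h'⟩ := c.2 a ha
    exact ⟨b, hb, by rw [h', h]; rfl⟩

lemma algebraMap_mem_stabIdeal {b : S} (hb : b ∈ IsLocalRing.maximalIdeal S) :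
    algebraMap S (stab S) b ∈ stabIdeal S := ⟨b, hb, rfl⟩

lemma IsSeminormalIn.stab (hS : IsSeminormalIn S) : IsSeminormalIn (stab S) := by
  have key : ∀ y : K, (∀ a ∈ IsLocalRing.maximalIdeal S, y * a ∈ S) →
      y ^ 2 ∈ _root_.stab S → y ∈ _root_.stab S := by
    intro y hy h2 a ha
    refine ⟨⟨_, hy a ha⟩, ?_, rfl⟩
    obtain ⟨b, hb, h⟩ := h2 a ha
    have : (⟨_, hy a ha⟩ : S) ^ 2 ∈ IsLocalRing.maximalIdeal S := by
      have : (⟨_, hy a ha⟩ : S) ^ 2 = a * b := by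
        apply Subtype.ext
        push_cast
        rw [h]; ring
      rw [this]; exact Ideal.mul_mem_left _ _ hb
    exact Ideal.IsPrime.mem_of_pow_mem inferInstance 2 this
  intro y h2 h3
  refine key y (fun a ha => ?_) h2
  obtain ⟨b, hb, h⟩ := h2 a ha
  obtain ⟨c, hc, h'⟩ := h3 a ha
  apply hS
  · have : (y * a) ^ 2 = ((b * a : S) : K) := by push_cast; rw [h]; ring
    rw [this]; exact SetLike.coe_mem _
  · have : (y * a) ^ 3 = ((c * a ^ 2 : S) : K) := by push_cast; rw [h']; ring
    rw [this]; exact SetLike.coe_mem _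

lemma IsSeminormalIn.isRadical_stabIdeal (hS : IsSeminormalIn S) : (stabIdeal S).IsRadical := by
  rintro x ⟨n, hn⟩
  have h1 : ∀ i, n ≤ i → x ^ i ∈ stabIdeal S := fun i hi => by
    rw [← Nat.sub_add_cancel hi, pow_add]; exact Ideal.mul_mem_left _ _ hn
  have hx : (x : K) ∈ S := hS.mem_of_pow_mem n fun i hi => by
    obtain ⟨b, -, h⟩ := h1 i hi
    have : (x : K) ^ i = b := by rw [h]; rfl
    rw [this]; exact b.2
  refine ⟨⟨x, hx⟩, ?_, rfl⟩
  obtain ⟨b, hb, h⟩ := hn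
  apply Ideal.IsPrime.mem_of_pow_mem (inferInstance : (IsLocalRing.maximalIdeal S).IsPrime) n
  convert hb using 1
  exact Subtype.ext (by rw [h]; rfl)

lemma isNoetherian_stab [IsNoetherianRing S] (hm : IsLocalRing.maximalIdeal S ≠ ⊥) :
    IsNoetherian S (stab S) := by
  obtain ⟨a, ha, ha0⟩ := Submodule.exists_mem_ne_zero_of_ne_bot hm
  choose g hg hg' using fun y : stab S => y.2 a ha
  have haK : (a : K) ≠ 0 := fun h => ha0 (Subtype.ext h)
  let L : stab S →ₗ[S] S :=
    { toFun := g
      map_add' := fun x y => Subtype.ext (by push_cast; rw [hg', hg', hg']; push_cast; ring)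
      map_smul' := fun c x => Subtype.ext (by
        rw [hg', RingHom.id_apply, smul_eq_mul]
        push_cast
        rw [hg', Algebra.smul_def]
        push_cast
        rw [coe_algebraMap_stab, mul_assoc]) }
  refine isNoetherian_of_injective L fun x y hxy => Subtype.ext ?_
  have := congrArg (Subtype.val) hxy
  change (g x : K) = g y at this
  rw [hg', hg'] at this
  exact mul_right_cancel₀ haK this

lemma exists_pow_mul_mem_stabIdeal (x : stab S) (n : ℕ) : ∀ (k : ℕ) (P : Polynomial S),
    P.natDegree ≤ n → (∃ i, P.coeff i ∉ IsLocalRing.maximalIdeal S) →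
    x ^ k * Polynomial.aeval x P ∈ stabIdeal S → ∃ (k : ℕ) (u : stab S),
      x ^ k * (1 + x * u) ∈ stabIdeal S := by
  induction n with
  | zero =>
    intro k P hP hi h
    by_cases h0 : P.coeff 0 ∈ IsLocalRing.maximalIdeal S
    · obtain ⟨i, hi⟩ := hi
      rcases Nat.eq_zero_or_pos i with rfl | hi'
      · exact absurd h0 hi
      · rw [Polynomial.coeff_eq_zero_of_natDegree_lt (by omega)] at hi
        exact absurd (zero_mem _) hi
    · obtain ⟨u, hu⟩ := not_not.1 (fun h => h0 ((IsLocalRing.mem_maximalIdeal _).2 h))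
      refine ⟨k, 0, ?_⟩
      rw [Polynomial.eq_C_of_natDegree_le_zero hP, Polynomial.aeval_C, ← hu] at h
      have := Ideal.mul_mem_left _ (algebraMap S (stab S) ↑u⁻¹) h
      rwa [mul_left_comm, ← map_mul, Units.inv_mul, map_one, mul_one,
        ← mul_one (x ^ k), ← add_zero (1 : stab S), ← mul_zero x] at this
  | succ n ih =>
    intro k P hP hi h
    have hdec : Polynomial.aeval x P = x * Polynomial.aeval x P.divX +
        algebraMap S (stab S) (P.coeff 0) := by
      conv_lhs => rw [← Polynomial.divX_mul_X_add P]
      rw [map_add, map_mul, Polynomial.aeval_X, Polynomial.aeval_C, mul_comm]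
    by_cases h0 : P.coeff 0 ∈ IsLocalRing.maximalIdeal S
    · refine ih (k + 1) P.divX ?_ ?_ ?_
      · rw [Polynomial.natDegree_divX_eq_natDegree_tsub_one]; omega
      · obtain ⟨i, hi⟩ := hi
        rcases Nat.eq_zero_or_pos i with rfl | hi'
        · exact absurd h0 hi
        · exact ⟨i - 1, by rwa [Polynomial.coeff_divX, Nat.sub_add_cancel hi']⟩
      · rw [hdec, mul_add] at h
        have := sub_mem h (Ideal.mul_mem_left _ (x ^ k) (algebraMap_mem_stabIdeal h0))
        rwa [add_sub_cancel_right, ← mul_assoc, ← pow_succ] at this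
    · obtain ⟨u, hu⟩ := not_not.1 (fun h => h0 ((IsLocalRing.mem_maximalIdeal _).2 h))
      refine ⟨k, algebraMap S (stab S) ↑u⁻¹ * Polynomial.aeval x P.divX, ?_⟩
      have := Ideal.mul_mem_left _ (algebraMap S (stab S) ↑u⁻¹) h
      convert this using 1
      rw [hdec, ← hu]
      have h1 : algebraMap S (stab S) ↑u⁻¹ * algebraMap S (stab S) ↑u = 1 := by
        rw [← map_mul, Units.inv_mul, map_one]
      linear_combination (-x ^ k) * h1

lemma IsSeminormalIn.exists_mul_mem_stabIdeal (hS : IsSeminormalIn S) [IsNoetherianRing S]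
    (hm : IsLocalRing.maximalIdeal S ≠ ⊥) (x : _root_.stab S) :
    ∃ u, x * (1 + x * u) ∈ stabIdeal S := by
  have := isNoetherian_stab hm
  obtain ⟨P, hP, h⟩ := IsIntegral.of_finite S x
  obtain ⟨k, u, hu⟩ := exists_pow_mul_mem_stabIdeal x P.natDegree 0 P le_rfl
    ⟨P.natDegree, by
      rw [Polynomial.coeff_natDegree, hP.leadingCoeff, ← Ideal.ne_top_iff_one]
      exact Ideal.IsPrime.ne_top'⟩
    (by rw [pow_zero, one_mul, Polynomial.aeval_def, h]; exact zero_mem _)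
  refine ⟨u, hS.isRadical_stabIdeal ⟨k + 1, ?_⟩⟩
  have : (x * (1 + x * u)) ^ (k + 1) = (x * (1 + x * u) ^ k) * (x ^ k * (1 + x * u)) := by
    rw [pow_succ, mul_pow]; ring
  rw [this]
  exact Ideal.mul_mem_left _ _ hu

variable [IsDomain R] [IsFractionRing R K]

omit [IsDomain R] in
lemma maximalIdeal_locAt_le_map (hS : IsSeminormalIn S) [IsNoetherianRing S]
    (hm : IsLocalRing.maximalIdeal S ≠ ⊥) (n : Ideal (stab S)) [n.IsPrime] :
    IsLocalRing.maximalIdeal (locAt (stab S) n) ≤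
      ((IsLocalRing.maximalIdeal S).map (algebraMap S (stab S))).map
        (algebraMap (stab S) (locAt (stab S) n)) := by
  rw [maximalIdeal_locAt, Ideal.map_le_iff_le_comap]
  intro x hx
  obtain ⟨u, b, hb, h⟩ := hS.exists_mul_mem_stabIdeal hm x
  have h1 : IsUnit (algebraMap (stab S) (locAt (stab S) n) (1 + x * u)) := by
    rw [IsLocalization.AtPrime.isUnit_to_map_iff _ n]
    intro h
    exact n.one_notMem ((Submodule.add_mem_iff_left _ (n.mul_mem_right _ hx)).1 h)
  obtain ⟨v, hv⟩ := h1
  rw [Ideal.mem_comap]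
  have h2 : algebraMap S (stab S) b = x * (1 + x * u) := Subtype.ext h
  have h3 := Ideal.mem_map_of_mem (algebraMap (stab S) (locAt (stab S) n))
    (Ideal.mem_map_of_mem (algebraMap S (stab S)) hb)
  rw [h2, map_mul, ← hv] at h3
  have := Ideal.mul_mem_right (↑v⁻¹) _ h3
  rwa [mul_assoc, Units.mul_inv, mul_one] at this

omit [IsDomain R] [IsFractionRing R K] in
lemma exists_principal_of_notMem {y : K} (hy : ∀ a ∈ IsLocalRing.maximalIdeal S, y * (a : K) ∈ S)
    {a : S} (ha : a ∈ IsLocalRing.maximalIdeal S)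
    (hay : (⟨_, hy a ha⟩ : S) ∉ IsLocalRing.maximalIdeal S) :
    IsLocalRing.maximalIdeal S = Ideal.span {a} := by
  obtain ⟨u, hu⟩ := not_not.1 (fun h => hay ((IsLocalRing.mem_maximalIdeal _).2 h))
  refine le_antisymm (fun b hb => ?_) ((Ideal.span_singleton_le_iff_mem _).2 ha)
  rw [Ideal.mem_span_singleton]
  refine ⟨↑u⁻¹ * ⟨_, hy b hb⟩, ?_⟩
  have h1 : (u : S) * b = a * ⟨_, hy b hb⟩ := by
    rw [hu]; apply Subtype.ext; push_cast; ring
  rw [mul_left_comm, ← h1, ← mul_assoc, Units.inv_mul, one_mul]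

omit [IsDomain R] [IsFractionRing R K] in
lemma ResVar.map_pow_le_denomIdeal_stab {f : MvPolynomial (Fin 2) R} {w : MvPolynomial (Fin 2) K}
    (H : ResVar f w) [IsNoetherianRing S]
    (hB : ∀ y : K, (∀ a ∈ IsLocalRing.maximalIdeal S, y * (a : K) ∈ S) → y ∈ stab S) (n : ℕ)
    (hn : IsLocalRing.maximalIdeal S ^ (n + 1) ≤ denomIdeal S f w) :
    (IsLocalRing.maximalIdeal S ^ n).map (algebraMap S (stab S)) ≤ denomIdeal (stab S) f w := by
  rw [Ideal.map_le_iff_le_comap]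
  intro y hy
  have h1 : ∀ a : S, ∃ p : Polynomial K, a ∈ IsLocalRing.maximalIdeal S →
      C ((a * y : S) : K) * w + Polynomial.aeval (map (algebraMap R K) f) p ∈ polyIn S := by
    intro a
    by_cases ha : a ∈ IsLocalRing.maximalIdeal S
    · have := hn (show a * y ∈ IsLocalRing.maximalIdeal S ^ (n + 1) by
        rw [pow_succ']; exact Ideal.mul_mem_mul ha hy)
      rw [mem_denomIdeal, mem_polyMod, smul_eq_C_coe_mul] at this
      obtain ⟨p, hp⟩ := this
      exact ⟨p, fun _ => hp⟩
    · exact ⟨0, fun h => absurd h ha⟩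
  choose p hp using h1
  obtain ⟨s, hs⟩ := IsNoetherian.noetherian (IsLocalRing.maximalIdeal S)
  obtain ⟨ρ, hρ1, hρ2, hρ3⟩ := H.exists_retraction S (s.sup fun a => (p a).natDegree)
  obtain ⟨q, hq⟩ := hρ3 (C (y : K) * w)
  rw [Ideal.mem_comap, mem_denomIdeal, mem_polyMod, smul_eq_C_coe_mul, coe_algebraMap_stab]
  refine ⟨q, ?_⟩
  rw [← hq, mem_polyIn]
  intro d
  apply hB
  intro a ha
  rw [← hs] at ha
  induction ha using Submodule.span_induction with
  | zero => simp
  | add a b _ _ ha hb => push_cast; rw [mul_add]; exact add_mem ha hb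
  | smul c a _ ha => rw [smul_eq_mul]; push_cast; rw [mul_left_comm]; exact mul_mem c.2 ha
  | mem a ha =>
    have ham : a ∈ IsLocalRing.maximalIdeal S := by rw [← hs]; exact Submodule.subset_span ha
    have h2 := hρ1 _ (hp a ham)
    rw [map_add, hρ2 _ (Finset.le_sup (f := fun a => (p a).natDegree) ha), add_zero] at h2
    have h3 : C ((a * y : S) : K) * w = (a : K) • (C (y : K) * w) := by
      rw [smul_eq_C_mul, ← mul_assoc, ← map_mul]; rfl
    rw [h3, map_smul, mem_polyIn] at h2
    simpa [mul_comm] using h2 d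

lemma ResVar.denomIdeal_eq_top_of_stab {f : MvPolynomial (Fin 2) R} {w : MvPolynomial (Fin 2) K}
    (H : ResVar f w) [IsNoetherianRing S] (hS : IsSeminormalIn S)
    [IsNoetherianRing (_root_.stab S)]
    (h : denomIdeal (_root_.stab S) f w = ⊤) : denomIdeal S f w = ⊤ := by
  rw [Ideal.eq_top_iff_one, mem_denomIdeal, one_smul, mem_polyMod] at h
  obtain ⟨p, hp⟩ := h
  obtain ⟨s, hs, hsg, hsj⟩ := H.exists_gen _ p hp
  obtain ⟨v, hvg, hvj⟩ := (H.fields' S _ (IsLocalRing.residue S)).exists_jac_eq_one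
  obtain ⟨v, rfl⟩ := map_surjective _ IsLocalRing.residue_surjective v
  set mk := Ideal.Quotient.mk (stabIdeal S)
  have : IsReduced (_root_.stab S ⧸ stabIdeal S) :=
    (Ideal.isRadical_iff_quotient_reduced _).1 hS.isRadical_stabIdeal
  let ψ : IsLocalRing.ResidueField S →+* _root_.stab S ⧸ stabIdeal S :=
    Ideal.Quotient.lift (IsLocalRing.maximalIdeal S) (mk.comp (algebraMap S (_root_.stab S)))
      fun a ha => Ideal.Quotient.eq_zero_iff_mem.2 (algebraMap_mem_stabIdeal ha)
  have hψ : ψ.comp (IsLocalRing.residue S) = mk.comp (algebraMap S (_root_.stab S)) := rfl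
  have hSR : (algebraMap S (_root_.stab S)).comp (algebraMap R S) =
    algebraMap R (_root_.stab S) := rfl
  have hF : map ψ (map (IsLocalRing.residue S) (map (algebraMap R S) f)) =
      map mk (map (algebraMap R (_root_.stab S)) f) := by
    rw [map_map, hψ, ← map_map, map_map (algebraMap R S), hSR]
  have hV : map ψ (map (IsLocalRing.residue S) v) =
      map mk (map (algebraMap S (_root_.stab S)) v) := by
    rw [map_map, hψ, ← map_map]
  have hg1 := hvg.map ψ
  have hj1 := congrArg (map ψ) hvj
  rw [map_jac, map_one] at hj1
  have hg2 := hsg.map mk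
  have hj2 := congrArg (map mk) hsj
  rw [map_jac, map_one] at hj2
  rw [hF, hV] at hg1 hj1
  obtain ⟨β, hβ⟩ := hg1.exists_eq_add_aeval hg2 hj1 hj2
  obtain ⟨β, rfl⟩ := Polynomial.map_surjective mk Ideal.Quotient.mk_surjective β
  have haev : ∀ {A B : Type} [CommRing A] [CommRing B] (φ : A →+* B) (F : MvPolynomial (Fin 2) A)
      (b : Polynomial A), map φ (Polynomial.aeval F b) = Polynomial.aeval (map φ F) (b.map φ) := by
    intro A B _ _ φ F b
    simpa using map_ev φ F F (Polynomial.C b)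
  rw [← haev, ← map_add, ← sub_eq_zero, ← map_sub] at hβ
  rw [Ideal.eq_top_iff_one, mem_denomIdeal, one_smul, mem_polyMod]
  refine ⟨p - β.map (algebraMap (_root_.stab S) K), ?_⟩
  have h1 : map (algebraMap (_root_.stab S) K) (s - (map (algebraMap S (_root_.stab S)) v +
      Polynomial.aeval (map (algebraMap R (_root_.stab S)) f) β)) ∈ polyIn S := by
    rw [mem_polyIn]
    intro d
    have h2 := congrArg (coeff d) hβ
    rw [coeff_map, coeff_zero, Ideal.Quotient.eq_zero_iff_mem] at h2
    obtain ⟨b, -, hb⟩ := h2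
    rw [coeff_map]
    have h3 := b.2
    rw [hb] at h3
    exact h3
  have h2 := add_mem h1 (map_mem_polyIn S v)
  convert h2 using 1
  have h3 : map (algebraMap (_root_.stab S) K) (map (algebraMap S (_root_.stab S)) v) =
    map (algebraMap S K) v := by rw [map_map]; rfl
  rw [map_sub, map_sub, map_add, hs, haev, map_map_subalgebra, h3]
  ring

theorem ResVar.denomIdeal_eq_top {f : MvPolynomial (Fin 2) R} {w : MvPolynomial (Fin 2) K}
    (H : ResVar f w) (N : ℕ) : ∀ (S : Subalgebra R K) [IsLocalRing S] [IsNoetherianRing S],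
      IsSeminormalIn S → IsLocalRing.maximalIdeal S ^ N ≤ denomIdeal S f w →
        denomIdeal S f w = ⊤ := by
  induction N with
  | zero => intro S _ _ _ h; rwa [pow_zero, Ideal.one_eq_top, top_le_iff] at h
  | succ N ih =>
    intro S _ _ hS h
    by_cases hm : IsLocalRing.maximalIdeal S = ⊥
    · by_contra hne
      refine denomIdeal_ne_bot S f w (le_bot_iff.1 ?_)
      rw [← hm]
      exact IsLocalRing.le_maximalIdeal hne
    by_cases hB : ∀ y : K, (∀ a ∈ IsLocalRing.maximalIdeal S, y * (a : K) ∈ S) → y ∈ stab S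
    · have := isNoetherian_stab hm
      have hN : IsNoetherianRing (stab S) := isNoetherian_of_tower S this
      refine H.denomIdeal_eq_top_of_stab hS ?_
      by_contra hne
      obtain ⟨n, hn, hle⟩ := Ideal.exists_le_maximal _ hne
      have hnp := hn.isPrime
      have := isNoetherianRing_locAt (stab S) n
      obtain ⟨t, ht, htp⟩ := exists_mem_denomIdeal_of_locAt n
        (ih (locAt (stab S) n) (hS.stab.locAt n) (by
          refine (Ideal.pow_right_mono (maximalIdeal_locAt_le_map hS hm n) N).trans ?_
          rw [← Ideal.map_pow, ← Ideal.map_pow]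
          exact (Ideal.map_mono (H.map_pow_le_denomIdeal_stab hB N h)).trans
            (map_denomIdeal_le (le_locAt _ n) fun _ => rfl)))
      exact htp (hle ht)
    · push Not at hB
      obtain ⟨y, hy, hy'⟩ := hB
      rw [mem_stab] at hy'
      push Not at hy'
      obtain ⟨a, ha, hay⟩ := hy'
      have h1 := exists_principal_of_notMem (y := y) hy ha
        (fun hmem => hay _ hmem rfl)
      refine H.denomIdeal_eq_top_of_principal S a h1 ?_ (N + 1) (h (Ideal.pow_mem_pow ha _))
      rintro rfl
      exact hm (by rw [h1]; simp)

end Stab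

/-- The residual variable theorem over a seminormal Noetherian domain. -/
theorem isVar_of_fields_of_seminormal {R : Type} [CommRing R] [IsDomain R] [IsNoetherianRing R]
    (hR : IsSeminormalDomain R) (f : MvPolynomial (Fin 2) R)
    (hf : ∀ (k : Type) [Field k] (φ : R →+* k), IsVar (map φ f)) : IsVar f := by
  let K := FractionRing R
  obtain ⟨w, hg, hj⟩ := (hf K (algebraMap R K)).exists_jac_eq_one
  have H : ResVar f w := ⟨hg, hj, hf⟩
  have hinj : Function.Injective (algebraMap R K) := IsFractionRing.injective R K
  let e : (⊥ : Subalgebra R K) ≃ₐ[R] R := Algebra.botEquivOfInjective hinj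
  have hN : IsNoetherianRing (⊥ : Subalgebra R K) :=
    isNoetherianRing_of_ringEquiv R e.symm.toRingEquiv
  have hS : IsSeminormalIn (⊥ : Subalgebra R K) := fun a h2 h3 => by
    rw [Algebra.mem_bot] at h2 h3 ⊢
    exact hR a h2 h3
  have h1 := denomIdeal_eq_top_of_local (f := f) (w := w) _ hS fun S' _ _ N => H.denomIdeal_eq_top N S'
  rw [Ideal.eq_top_iff_one, mem_denomIdeal, one_smul, mem_polyMod] at h1
  obtain ⟨p, hp⟩ := h1
  obtain ⟨s, -, hsg, -⟩ := H.exists_gen _ p hp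
  have := hsg.map e.toRingEquiv.toRingHom
  rw [map_map] at this
  have h2 : e.toRingEquiv.toRingHom.comp (algebraMap R (⊥ : Subalgebra R K)) = RingHom.id R :=
    RingHom.ext fun x => e.commutes x
  rw [h2, map_id] at this
  exact ⟨_, this⟩

end

section

/-- A graded exponential structure, recorded on homogeneous elements: `M n` is the homogeneous
part of degree `n`, viewed inside `N`, and `E n c` is the image of the element of degree `n`
given by `c`, the coefficient of `U ^ i` being homogeneous of degree `n + i • δ`. -/
structure GExp (N Γ : Type) [CommRing N] [AddCommGroup Γ] where
  δ : Γ
  M : Γ → AddSubgroup N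
  E : Γ → N → Polynomial N
  mem_zero : ∀ c, c ∈ M 0
  E_one : E 0 1 = 1
  E_add : ∀ {n c c'}, c ∈ M n → c' ∈ M n → E n (c + c') = E n c + E n c'
  mul_mem : ∀ {n n' c c'}, c ∈ M n → c' ∈ M n' → c * c' ∈ M (n + n')
  E_mul : ∀ {n n' c c'}, c ∈ M n → c' ∈ M n' → E (n + n') (c * c') = E n c * E n' c'
  coeff_zero : ∀ {n c}, c ∈ M n → (E n c).coeff 0 = c
  coeff_mem : ∀ {n c}, c ∈ M n → ∀ i : ℕ, (E n c).coeff i ∈ M (n + i • δ)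
  coeff_coeff : ∀ {n c}, c ∈ M n → ∀ i j : ℕ,
    (E (n + i • δ) ((E n c).coeff i)).coeff j = ((i + j).choose i : N) * (E n c).coeff (i + j)

namespace GExp
variable {N Γ : Type} [CommRing N] [AddCommGroup Γ] (D : GExp N Γ)

lemma E_zero (n : Γ) : D.E n 0 = 0 := by
  have := D.E_add (zero_mem (D.M n)) (zero_mem (D.M n))
  rwa [add_zero, left_eq_add] at this

lemma E_sum {ι : Type} (s : Finset ι) (g : ι → N) (n : Γ) (h : ∀ i ∈ s, g i ∈ D.M n) :
    D.E n (∑ i ∈ s, g i) = ∑ i ∈ s, D.E n (g i) := by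
  classical
  induction s using Finset.induction_on with
  | empty => simp [E_zero]
  | insert a s ha ih =>
    rw [Finset.sum_insert ha, Finset.sum_insert ha, D.E_add (h _ (Finset.mem_insert_self _ _))
      (sum_mem fun i hi => h i (Finset.mem_insert_of_mem hi)),
      ih fun i hi => h i (Finset.mem_insert_of_mem hi)]

/-- Invariant homogeneous elements. -/
def Inv (n : Γ) (c : N) : Prop := c ∈ D.M n ∧ D.E n c = Polynomial.C c

variable {D}

lemma inv_of_natDegree_eq_zero {n : Γ} {c : N} (hc : c ∈ D.M n) (h : (D.E n c).natDegree = 0) :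
    D.Inv n c :=
  ⟨hc, by conv_lhs => rw [Polynomial.eq_C_of_natDegree_eq_zero h, D.coeff_zero hc]⟩

lemma Inv.natDegree {n : Γ} {c : N} (h : D.Inv n c) : (D.E n c).natDegree = 0 := by
  rw [h.2, Polynomial.natDegree_C]

lemma inv_zero (n : Γ) : D.Inv n 0 := ⟨zero_mem _, by rw [D.E_zero, map_zero]⟩

lemma inv_one : D.Inv 0 1 := ⟨D.mem_zero 1, by rw [D.E_one, map_one]⟩

lemma Inv.add {n : Γ} {c c' : N} (h : D.Inv n c) (h' : D.Inv n c') : D.Inv n (c + c') :=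
  ⟨add_mem h.1 h'.1, by rw [D.E_add h.1 h'.1, h.2, h'.2, map_add]⟩

lemma Inv.mul {n n' : Γ} {c c' : N} (h : D.Inv n c) (h' : D.Inv n' c') :
    D.Inv (n + n') (c * c') :=
  ⟨D.mul_mem h.1 h'.1, by rw [D.E_mul h.1 h'.1, h.2, h'.2, map_mul]⟩

lemma Inv.pow {n : Γ} {c : N} (h : D.Inv n c) (t : ℕ) : D.Inv (t • n) (c ^ t) := by
  induction t with
  | zero => rw [zero_smul, pow_zero]; exact inv_one
  | succ t ih => rw [pow_succ, succ_nsmul]; exact ih.mul h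

lemma E_ne_zero {n : Γ} {c : N} (hc : c ∈ D.M n) (h : c ≠ 0) : D.E n c ≠ 0 := by
  intro h0
  have := D.coeff_zero hc
  rw [h0, Polynomial.coeff_zero] at this
  exact h this.symm

lemma natDegree_mul [IsDomain N] {n n' : Γ} {c c' : N} (hc : c ∈ D.M n) (hc' : c' ∈ D.M n')
    (h : c ≠ 0) (h' : c' ≠ 0) :
    (D.E (n + n') (c * c')).natDegree = (D.E n c).natDegree + (D.E n' c').natDegree := by
  rw [D.E_mul hc hc', Polynomial.natDegree_mul (E_ne_zero hc h) (E_ne_zero hc' h')]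

lemma pow_mem {n : Γ} {c : N} (hc : c ∈ D.M n) (t : ℕ) : c ^ t ∈ D.M (t • n) := by
  induction t with
  | zero => rw [zero_smul]; exact D.mem_zero _
  | succ t ih => rw [pow_succ, succ_nsmul]; exact D.mul_mem ih hc

lemma Inv.of_mul [IsDomain N] {n n' : Γ} {c c' : N} (hc : c ∈ D.M n) (hc' : c' ∈ D.M n')
    (h : c ≠ 0) (h' : c' ≠ 0) (H : D.Inv (n + n') (c * c')) : D.Inv n c ∧ D.Inv n' c' := by
  have := natDegree_mul hc hc' h h'
  rw [H.natDegree] at this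
  exact ⟨inv_of_natDegree_eq_zero hc (by omega), inv_of_natDegree_eq_zero hc' (by omega)⟩

lemma inv_leadingCoeff {n : Γ} {c : N} (hc : c ∈ D.M n) :
    D.Inv (n + (D.E n c).natDegree • D.δ) (D.E n c).leadingCoeff := by
  refine inv_of_natDegree_eq_zero (D.coeff_mem hc _) ?_
  rw [← Nat.le_zero, Polynomial.natDegree_le_iff_coeff_eq_zero]
  intro j hj
  rw [← Polynomial.coeff_natDegree, D.coeff_coeff hc,
    Polynomial.coeff_eq_zero_of_natDegree_lt (n := _ + j) (by omega), mul_zero]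

variable (D)

/-- Homogeneous polynomials of degree `n`. -/
def gradedPoly (n : Γ) : AddSubgroup (Polynomial N) where
  carrier := {p | ∀ i, p.coeff i ∈ D.M (n + i • D.δ)}
  zero_mem' := fun i => by rw [Polynomial.coeff_zero]; exact zero_mem _
  add_mem' := fun hp hq i => by rw [Polynomial.coeff_add]; exact add_mem (hp i) (hq i)
  neg_mem' := fun hp i => by rw [Polynomial.coeff_neg]; exact neg_mem (hp i)

variable {D}

lemma E_mem_gradedPoly {n : Γ} {c : N} (hc : c ∈ D.M n) : D.E n c ∈ D.gradedPoly n :=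
  D.coeff_mem hc

lemma monomial_mem_gradedPoly {n : Γ} {c : N} (i : ℕ) (hc : c ∈ D.M (n + i • D.δ)) :
    Polynomial.monomial i c ∈ D.gradedPoly n := by
  intro j
  rw [Polynomial.coeff_monomial]
  split_ifs with h
  · rwa [← h]
  · exact zero_mem _

lemma mul_coeff_mem {n n' : Γ} {p q : Polynomial N} (hp : p ∈ D.gradedPoly n)
    (hq : q ∈ D.gradedPoly n') {i : ℕ} {x : ℕ × ℕ} (hx : x ∈ Finset.HasAntidiagonal.antidiagonal i) :
    p.coeff x.1 * q.coeff x.2 ∈ D.M (n + n' + i • D.δ) := by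
  have := D.mul_mem (hp x.1) (hq x.2)
  rw [← Finset.HasAntidiagonal.mem_antidiagonal.1 hx, add_smul]
  convert this using 2
  abel

lemma mul_mem_gradedPoly {n n' : Γ} {p q : Polynomial N} (hp : p ∈ D.gradedPoly n)
    (hq : q ∈ D.gradedPoly n') : p * q ∈ D.gradedPoly (n + n') := by
  intro i
  rw [Polynomial.coeff_mul]
  exact sum_mem fun x hx => mul_coeff_mem hp hq hx

variable (D) in
/-- Application of the exponential structure to the coefficients of a homogeneous polynomial. -/
def coeffE (n : Γ) (p : Polynomial N) : Polynomial (Polynomial N) :=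
  p.sum fun i c => Polynomial.monomial i (D.E (n + i • D.δ) c)

lemma coeff_coeffE (n : Γ) (p : Polynomial N) (i : ℕ) :
    (D.coeffE n p).coeff i = D.E (n + i • D.δ) (p.coeff i) := by
  rw [coeffE, Polynomial.sum, Polynomial.finsetSum_coeff]
  simp only [Polynomial.coeff_monomial, Finset.sum_ite_eq', Polynomial.mem_support_iff]
  split_ifs with h
  · rfl
  · rw [Polynomial.notMem_support_iff.1 h, E_zero]

lemma coeffE_add {n : Γ} {p q : Polynomial N} (hp : p ∈ D.gradedPoly n) (hq : q ∈ D.gradedPoly n) :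
    D.coeffE n (p + q) = D.coeffE n p + D.coeffE n q := by
  ext1 i
  rw [Polynomial.coeff_add, coeff_coeffE, coeff_coeffE, coeff_coeffE, Polynomial.coeff_add,
    D.E_add (hp i) (hq i)]

lemma coeffE_mul {n n' : Γ} {p q : Polynomial N} (hp : p ∈ D.gradedPoly n)
    (hq : q ∈ D.gradedPoly n') : D.coeffE (n + n') (p * q) = D.coeffE n p * D.coeffE n' q := by
  ext1 i
  rw [coeff_coeffE, Polynomial.coeff_mul, Polynomial.coeff_mul,
    D.E_sum _ _ _ (fun x hx => mul_coeff_mem hp hq hx)]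
  refine Finset.sum_congr rfl fun x hx => ?_
  rw [coeff_coeffE, coeff_coeffE, ← D.E_mul (hp _) (hq _), ← Finset.HasAntidiagonal.mem_antidiagonal.1 hx, add_smul]
  congr 1
  abel

/-- Substitution of a sum of two variables. -/
def addSubst : Polynomial N →+* Polynomial (Polynomial N) :=
  (Polynomial.taylorEquiv (Polynomial.X : Polynomial N)).toRingHom.comp
    (Polynomial.mapRingHom Polynomial.C)

lemma addSubst_apply (p : Polynomial N) : addSubst p =
    Polynomial.taylor Polynomial.X (p.map Polynomial.C) := rfl

lemma coeff_addSubst (p : Polynomial N) (i : ℕ) :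
    (addSubst p).coeff i = Polynomial.hasseDeriv i p := by
  rw [addSubst_apply, Polynomial.taylor_coeff]
  have : Polynomial.hasseDeriv i (p.map (Polynomial.C : N →+* _)) =
      (Polynomial.hasseDeriv i p).map Polynomial.C := by
    ext1 j
    simp [Polynomial.hasseDeriv_coeff]
  rw [this, Polynomial.eval_map, Polynomial.eval₂_C_X]

lemma coeffE_E {n : Γ} {c : N} (hc : c ∈ D.M n) : D.coeffE n (D.E n c) = addSubst (D.E n c) := by
  ext1 i
  rw [coeff_coeffE, coeff_addSubst]
  ext1 j
  rw [D.coeff_coeff hc, Polynomial.hasseDeriv_coeff, add_comm j i]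

lemma natDegree_addSubst (p : Polynomial N) : (addSubst p).natDegree = p.natDegree := by
  rw [addSubst_apply, Polynomial.natDegree_taylor,
    Polynomial.natDegree_map_eq_of_injective Polynomial.C_injective]

lemma addSubst_injective : Function.Injective (addSubst : Polynomial N →+* _) := by
  intro p q h
  rw [addSubst_apply, addSubst_apply] at h
  exact Polynomial.map_injective _ Polynomial.C_injective (Polynomial.taylor_injective _ h)

lemma natDegree_coeffE_le (n : Γ) (p : Polynomial N) : (D.coeffE n p).natDegree ≤ p.natDegree := by
  rw [Polynomial.natDegree_le_iff_coeff_eq_zero]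
  intro i hi
  rw [coeff_coeffE, Polynomial.coeff_eq_zero_of_natDegree_lt hi, E_zero]

lemma coeffE_C {n : Γ} {c : N} (h : D.Inv n c) :
    D.coeffE n (Polynomial.C c) = Polynomial.C (Polynomial.C c) := by
  ext1 i
  rw [coeff_coeffE, Polynomial.coeff_C, Polynomial.coeff_C]
  split_ifs with hi
  · rw [hi, zero_smul, add_zero, h.2]
  · rw [E_zero]

section Division
variable {σ : Γ} {s : N} (hs : s ∈ D.M σ)
include hs

lemma exists_pseudo_division (hd : 0 < (D.E σ s).natDegree) (e : ℕ) :
    ∀ (p : Polynomial N) (n : Γ), p ∈ D.gradedPoly n → p.natDegree ≤ e →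
      ∃ (t : ℕ) (q r : Polynomial N),
        Polynomial.C ((D.E σ s).leadingCoeff ^ t) * p = q * D.E σ s + r ∧
        r.natDegree < (D.E σ s).natDegree ∧
        q ∈ D.gradedPoly (n + t • (σ + (D.E σ s).natDegree • D.δ) - σ) ∧
        r ∈ D.gradedPoly (n + t • (σ + (D.E σ s).natDegree • D.δ)) := by
  set S := D.E σ s
  set n0 := S.natDegree
  have base : ∀ (p : Polynomial N) (n : Γ), p ∈ D.gradedPoly n → p.natDegree < n0 →
      ∃ (t : ℕ) (q r : Polynomial N), Polynomial.C (S.leadingCoeff ^ t) * p = q * S + r ∧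
        r.natDegree < n0 ∧ q ∈ D.gradedPoly (n + t • (σ + n0 • D.δ) - σ) ∧
        r ∈ D.gradedPoly (n + t • (σ + n0 • D.δ)) := fun p n hp hpn =>
    ⟨0, 0, p, by simp, hpn, zero_mem _, by simpa using hp⟩
  induction e with
  | zero => exact fun p n hp hpe => base p n hp (by omega)
  | succ e ih =>
    intro p n hp hpe
    by_cases hlt : p.natDegree < n0
    · exact base p n hp hlt
    push Not at hlt
    set d := p.natDegree
    set a := S.leadingCoeff
    have ha : a ∈ D.M (σ + n0 • D.δ) := D.coeff_mem hs n0
    set p' := Polynomial.C a * p - Polynomial.monomial (d - n0) p.leadingCoeff * S with hp'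
    have hmon : Polynomial.monomial (d - n0) p.leadingCoeff ∈ D.gradedPoly (n + n0 • D.δ) := by
      apply monomial_mem_gradedPoly
      rw [add_assoc, ← add_smul, Nat.add_sub_cancel' hlt]
      exact hp d
    have hCa : Polynomial.C a ∈ D.gradedPoly (σ + n0 • D.δ) := by
      rw [← Polynomial.monomial_zero_left]
      exact monomial_mem_gradedPoly 0 (by simpa using ha)
    have hp'm : p' ∈ D.gradedPoly (n + (σ + n0 • D.δ)) := by
      refine sub_mem ?_ ?_
      · rw [add_comm]; exact mul_mem_gradedPoly hCa hp
      · have := mul_mem_gradedPoly hmon (E_mem_gradedPoly hs)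
        convert this using 2
        abel
    have hp'd : p'.natDegree ≤ e := by
      rw [Polynomial.natDegree_le_iff_coeff_eq_zero]
      intro i hi
      have h1 : d ≤ i := by omega
      rw [hp', Polynomial.coeff_sub, Polynomial.coeff_C_mul, ← Polynomial.C_mul_X_pow_eq_monomial,
        mul_assoc, Polynomial.coeff_C_mul, Polynomial.coeff_X_pow_mul', if_pos (by omega)]
      rcases h1.eq_or_lt with rfl | h1
      · rw [Nat.sub_sub_self hlt]
        change a * p.leadingCoeff - p.leadingCoeff * a = 0
        ring
      · rw [Polynomial.coeff_eq_zero_of_natDegree_lt h1,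
          Polynomial.coeff_eq_zero_of_natDegree_lt (p := S) (by omega)]
        ring
    obtain ⟨t, q, r, h1, h2, h3, h4⟩ := ih p' _ hp'm hp'd
    refine ⟨t + 1, q + Polynomial.C (a ^ t) * Polynomial.monomial (d - n0) p.leadingCoeff, r, ?_, h2,
      ?_, ?_⟩
    · rw [hp'] at h1
      rw [pow_succ, map_mul]
      linear_combination h1
    · refine add_mem ?_ ?_
      · convert h3 using 2
        rw [succ_nsmul]; abel
      · have hCat : Polynomial.C (a ^ t) ∈ D.gradedPoly (t • (σ + n0 • D.δ)) := by
          rw [← Polynomial.monomial_zero_left]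
          refine monomial_mem_gradedPoly 0 ?_
          rw [zero_smul, add_zero]
          exact pow_mem ha t
        have := mul_mem_gradedPoly hCat hmon
        convert this using 2
        rw [succ_nsmul]; abel
    · convert h4 using 2
      rw [succ_nsmul]; abel

lemma exists_mul_eq_eval [IsDomain N] (hd : 0 < (D.E σ s).natDegree)
    (hmin : ∀ n c, c ∈ D.M n → (D.E n c).natDegree < (D.E σ s).natDegree → D.Inv n c) (e : ℕ) :
    ∀ (n : Γ) (d : N), d ∈ D.M n → (D.E n d).natDegree ≤ e → ∃ (n' : Γ) (a : N), a ≠ 0 ∧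
      D.Inv n' a ∧ ∃ P : Polynomial N, (∀ l, D.Inv (n' + n - l • σ) (P.coeff l)) ∧
        a * d = P.eval s := by
  set S := D.E σ s
  set n0 := S.natDegree
  have base : ∀ (n : Γ) (d : N), D.Inv n d → ∃ (n' : Γ) (a : N), a ≠ 0 ∧
      D.Inv n' a ∧ ∃ P : Polynomial N, (∀ l, D.Inv (n' + n - l • σ) (P.coeff l)) ∧
        a * d = P.eval s := by
    intro n d hd
    refine ⟨0, 1, one_ne_zero, inv_one, Polynomial.C d, fun l => ?_, by simp⟩
    rw [Polynomial.coeff_C]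
    split_ifs with hl
    · simpa [hl] using hd
    · exact inv_zero _
  induction e with
  | zero => exact fun n d hdm hde => base n d (inv_of_natDegree_eq_zero hdm (by omega))
  | succ e ih =>
    intro n d hdm hde
    by_cases hlt : (D.E n d).natDegree < n0
    · exact base n d (hmin n d hdm hlt)
    push Not at hlt
    set α := σ + n0 • D.δ
    set a := S.leadingCoeff
    have ha : D.Inv α a := inv_leadingCoeff hs
    obtain ⟨t, q, r, h1, h2, h3, h4⟩ : ∃ (t : ℕ) (q r : Polynomial N),
        Polynomial.C (a ^ t) * D.E n d = q * S + r ∧ r.natDegree < n0 ∧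
        q ∈ D.gradedPoly (n + t • α - σ) ∧ r ∈ D.gradedPoly (n + t • α) :=
      exists_pseudo_division hs hd _ _ n (E_mem_gradedPoly hdm) le_rfl
    have hn0 : S.natDegree = n0 := rfl
    have hS0 : S ≠ 0 := fun h => by rw [show n0 = S.natDegree from rfl, h] at hd; simp at hd
    have ha0 : a ≠ 0 := Polynomial.leadingCoeff_ne_zero.2 hS0
    have hat : D.Inv (t • α) (a ^ t) := ha.pow t
    have hCat : Polynomial.C (a ^ t) ∈ D.gradedPoly (t • α) := by
      rw [← Polynomial.monomial_zero_left]
      refine monomial_mem_gradedPoly 0 ?_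
      rw [zero_smul, add_zero]
      exact hat.1
    have hn : n + t • α = (n + t • α - σ) + σ := by abel
    have e1 : D.coeffE (t • α + n) (Polynomial.C (a ^ t) * D.E n d) =
        D.coeffE (n + t • α) (q * S + r) := by rw [h1, add_comm]
    rw [coeffE_mul hCat (E_mem_gradedPoly hdm), coeffE_C hat, coeffE_E hdm, coeffE_add
      (by rw [hn]; exact mul_mem_gradedPoly h3 (E_mem_gradedPoly hs)) h4, hn,
      coeffE_mul h3 (E_mem_gradedPoly hs), ← hn, coeffE_E hs] at e1
    have e2 := congrArg addSubst h1
    rw [map_mul, map_add, map_mul] at e2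
    have e3 : addSubst (Polynomial.C (a ^ t) : Polynomial N) = Polynomial.C (Polynomial.C (a ^ t)) := by
      rw [addSubst_apply, Polynomial.map_C, Polynomial.taylor_C]
    rw [e3] at e2
    have e4 : (addSubst q - D.coeffE (n + t • α - σ) q) * addSubst S =
        D.coeffE (n + t • α) r - addSubst r := by linear_combination e1 - e2
    have e5 : addSubst q = D.coeffE (n + t • α - σ) q := by
      by_contra hne
      have hdeg := congrArg Polynomial.natDegree e4
      rw [Polynomial.natDegree_mul (sub_ne_zero.2 hne)
        ((map_ne_zero_iff _ addSubst_injective).2 hS0), natDegree_addSubst, hn0] at hdeg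
      have h5 := Polynomial.natDegree_sub_le (D.coeffE (n + t • α) r) (addSubst r)
      rw [natDegree_addSubst] at h5
      have h6 := natDegree_coeffE_le (D := D) (n + t • α) r
      rw [max_eq_right h6] at h5
      omega
    have e6 : addSubst r = D.coeffE (n + t • α) r := by
      rw [e5, sub_self, zero_mul] at e4
      exact (sub_eq_zero.1 e4.symm).symm
    have hq0 : D.E (n + t • α - σ) (q.coeff 0) = q := by
      have := congrArg (fun p => p.coeff 0) e5
      rw [coeff_addSubst, coeff_coeffE, Polynomial.hasseDeriv_zero', zero_smul, add_zero] at this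
      exact this.symm
    have hr0 : D.E (n + t • α) (r.coeff 0) = r := by
      have := congrArg (fun p => p.coeff 0) e6
      rw [coeff_addSubst, coeff_coeffE, Polynomial.hasseDeriv_zero', zero_smul, add_zero] at this
      exact this.symm
    have hq0m : q.coeff 0 ∈ D.M (n + t • α - σ) := by simpa only [zero_smul, add_zero] using h3 0
    have hr0m : r.coeff 0 ∈ D.M (n + t • α) := by simpa only [zero_smul, add_zero] using h4 0
    have hrinv : D.Inv (n + t • α) (r.coeff 0) := hmin _ _ hr0m (by rw [hr0]; exact h2)
    have hc0 : a ^ t * d = q.coeff 0 * s + r.coeff 0 := by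
      have := congrArg (fun p => p.coeff 0) h1
      simp only [Polynomial.mul_coeff_zero, Polynomial.coeff_add, Polynomial.coeff_C_zero] at this
      rwa [D.coeff_zero hdm, D.coeff_zero hs] at this
    have hqd : q.natDegree ≤ e := by
      rcases eq_or_ne q 0 with rfl | hq
      · simp
      have h5 : (q * S).natDegree ≤ (D.E n d).natDegree := by
        rw [eq_sub_of_add_eq h1.symm]
        refine (Polynomial.natDegree_sub_le _ _).trans (max_le ?_ (by omega))
        exact Polynomial.natDegree_C_mul_le _ _
      rw [Polynomial.natDegree_mul hq hS0, hn0] at h5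
      omega
    obtain ⟨n', b, hb0, hb, P, hP, hPe⟩ := ih _ _ hq0m (by rw [hq0]; exact hqd)
    refine ⟨n' + t • α, b * a ^ t, mul_ne_zero hb0 (pow_ne_zero _ ha0), hb.mul hat,
      P * Polynomial.X + Polynomial.C (b * r.coeff 0), fun l => ?_, ?_⟩
    · rw [Polynomial.coeff_add]
      refine Inv.add ?_ ?_
      · rcases l with _ | l
        · simpa using inv_zero _
        · rw [Polynomial.coeff_mul_X]
          convert hP l using 1
          rw [succ_nsmul]; abel
      · rw [Polynomial.coeff_C]
        split_ifs with hl
        · rw [hl, zero_smul, sub_zero]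
          convert hb.mul hrinv using 1
          abel
        · exact inv_zero _
    · rw [Polynomial.eval_add, Polynomial.eval_mul, Polynomial.eval_X, Polynomial.eval_C, ← hPe,
        mul_assoc, hc0]
      ring

end Division

end GExp

end

section

/-- A factorially closed subalgebra `C` over which the ambient ring is generated, up to
denominators, by a single transcendental element `s`. -/
structure SliceData (k : Type) {N : Type} [CommRing k] [CommRing N] [Algebra k N] (f : N) where
  C : Subalgebra k N
  s : N
  mem_of_mul : ∀ a b, a * b ∈ C → a * b ≠ 0 → a ∈ C
  exists_eval : ∀ b, ∃ c ∈ C, c ≠ 0 ∧ ∃ P : Polynomial N, (∀ l, P.coeff l ∈ C) ∧ c * b = P.eval s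
  eq_zero_of_eval : ∀ P : Polynomial N, (∀ l, P.coeff l ∈ C) → P.eval s = 0 → P = 0
  mem_or_eq : f ∈ C ∨ s = f

namespace GExp
variable {k N Γ : Type} [Field k] [CommRing N] [Algebra k N] [AddCommGroup Γ] {D : GExp N Γ}

variable (D) in
/-- The invariants of degree zero. -/
def invSubalgebra (hk : ∀ a : k, D.Inv 0 (algebraMap k N a)) : Subalgebra k N where
  carrier := {c | D.Inv 0 c}
  mul_mem' := fun ha hb => by simpa using Inv.mul ha hb
  add_mem' := fun ha hb => Inv.add ha hb
  algebraMap_mem' := hk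

lemma natDegree_pow [IsDomain N] {n : Γ} {c : N} (hc : c ∈ D.M n) (h : c ≠ 0) (t : ℕ) :
    (D.E (t • n) (c ^ t)).natDegree = t * (D.E n c).natDegree := by
  induction t with
  | zero => rw [zero_smul, pow_zero, D.E_one]; simp
  | succ t ih =>
    rw [pow_succ, succ_nsmul, natDegree_mul (pow_mem hc t) hc (pow_ne_zero _ h) h, ih]; ring

lemma E_pow {c : N} (t : ℕ) : D.E 0 (c ^ t) = D.E 0 c ^ t := by
  induction t with
  | zero => rw [pow_zero, D.E_one, pow_zero]
  | succ t ih =>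
    rw [pow_succ, pow_succ, ← ih, ← D.E_mul (D.mem_zero _) (D.mem_zero _), add_zero]

lemma eq_zero_of_eval_eq_zero [IsDomain N] {s : N} (hs : 0 < (D.E 0 s).natDegree) (P : Polynomial N)
    (hP : ∀ l, D.Inv 0 (P.coeff l)) (h : P.eval s = 0) : P = 0 := by
  have h1 : D.E 0 (P.eval s) = (P.map Polynomial.C).eval (D.E 0 s) := by
    rw [Polynomial.eval_map, Polynomial.eval₂_eq_sum_range, Polynomial.eval_eq_sum_range,
      D.E_sum _ _ _ fun i _ => D.mem_zero _]
    refine Finset.sum_congr rfl fun i _ => ?_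
    have := D.E_mul (D.mem_zero (P.coeff i)) (D.mem_zero (s ^ i))
    rw [add_zero] at this
    rw [this, (hP i).2, E_pow]
  rw [h, D.E_zero] at h1
  by_contra hP0
  have htr : P.comp (D.E 0 s) = 0 := by
    rw [Polynomial.comp, Polynomial.eval₂_eq_eval_map, ← h1]
  rcases Polynomial.comp_eq_zero_iff.1 htr with h3 | ⟨_, h3⟩
  · exact hP0 h3
  · rw [h3, Polynomial.natDegree_C] at hs
    exact lt_irrefl _ hs

variable {m : ℕ} {r : Fin m → ℕ} {e : Fin m → Γ} {x : Fin m → Γ →+ ℚ} {f : N}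

lemma exists_sliceData [IsDomain N] (hk : ∀ a : k, D.Inv 0 (algebraMap k N a))
    (hr : ∀ i, 1 < r i) (hx : ∀ i j, x i (e j) = if i = j then 1 else 0)
    (he : ∀ i, 1 ∈ D.M (e i)) (hf0 : f ≠ 0) (hf : D.Inv (-∑ i, r i • e i) f)
    (fact : ∀ n c, c ∈ D.M n → c ≠ 0 → ∃ (b : Fin m → ℕ) (j : ℕ) (c' : N),
      n = ∑ i, b i • e i - j • ∑ i, r i • e i ∧ c = f ^ j * c')
    (hD : ∃ n c, c ∈ D.M n ∧ 0 < (D.E n c).natDegree) : Nonempty (SliceData k f) := by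
  classical
  set ρ := ∑ i, r i • e i with hρ
  have hprodM : ∀ (b : Fin m → ℕ) (t : Finset (Fin m)), (1 : N) ∈ D.M (∑ i ∈ t, b i • e i) := by
    intro b t
    induction t using Finset.induction_on with
    | empty => exact D.mem_zero _
    | insert i t hi ih =>
      rw [Finset.sum_insert hi, ← one_mul (1 : N)]
      refine D.mul_mem ?_ ih
      simpa using pow_mem (he i) (b i)
  have hprod : ∀ (b : Fin m → ℕ) (t : Finset (Fin m)),
      (D.E (∑ i ∈ t, b i • e i) 1).natDegree = ∑ i ∈ t, b i * (D.E (e i) 1).natDegree := by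
    intro b t
    induction t using Finset.induction_on with
    | empty => rw [Finset.sum_empty, D.E_one]; simp
    | insert i t hi ih =>
      rw [Finset.sum_insert hi, Finset.sum_insert hi, ← ih]
      have h1 : (1 : N) ∈ D.M (b i • e i) := by simpa using pow_mem (he i) (b i)
      have := natDegree_mul h1 (hprodM b t) one_ne_zero one_ne_zero
      rw [one_mul] at this
      rw [this]
      congr 1
      simpa using natDegree_pow (he i) one_ne_zero (b i)
  have hfact : ∀ n c, c ∈ D.M n → c ≠ 0 → ∃ (b : Fin m → ℕ) (j : ℕ) (c' : N), c' ≠ 0 ∧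
      n = ∑ i, b i • e i - j • ρ ∧ c = f ^ j * c' ∧
      (D.E n c).natDegree = ∑ i, b i * (D.E (e i) 1).natDegree + (D.E 0 c').natDegree := by
    intro n c hc hc0
    obtain ⟨b, j, c', h1, h2⟩ := fact n c hc hc0
    have hc' : c' ≠ 0 := by rintro rfl; exact hc0 (by rw [h2, mul_zero])
    refine ⟨b, j, c', hc', h1, h2, ?_⟩
    have e1 := natDegree_mul (hprodM b Finset.univ) (pow_mem hf.1 j) one_ne_zero
      (pow_ne_zero _ hf0)
    have e2 := natDegree_mul (D.mul_mem (hprodM b Finset.univ) (pow_mem hf.1 j)) (D.mem_zero c')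
      (mul_ne_zero one_ne_zero (pow_ne_zero _ hf0)) hc'
    rw [e1, hprod, natDegree_pow hf.1 hf0, hf.natDegree, mul_zero, add_zero, one_mul, add_zero,
      ← h2, smul_neg, ← sub_eq_add_neg, ← h1] at e2
    exact e2
  have hcoord : ∀ (b : Fin m → ℕ) (j : ℕ) (i : Fin m),
      x i (∑ i, b i • e i - j • ρ) = b i - j * r i := by
    intro b j i
    rw [map_sub, map_sum, map_nsmul, hρ, map_sum]
    simp [hx]
  have hfdeg : (D.E 0 f).natDegree = ∑ i, r i * (D.E (e i) 1).natDegree := by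
    have := natDegree_mul (hprodM r Finset.univ) hf.1 one_ne_zero hf0
    rw [one_mul, hprod, hf.natDegree, add_zero, ← hρ, add_neg_cancel] at this
    exact this
  -- coordinates of invariants at a noninvariant variable
  have hinvcoord : ∀ i, (D.E (e i) 1).natDegree ≠ 0 → ∀ n c, D.Inv n c → c ≠ 0 →
      ∃ (j : ℕ) (c' : N), D.Inv 0 c' ∧ c = f ^ j * c' ∧ x i n = -(j * r i : ℚ) := by
    intro i hi n c hc hc0
    obtain ⟨b, j, c', -, h1, h2, h3⟩ := hfact n c hc.1 hc0
    rw [hc.natDegree] at h3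
    have h4 : (D.E 0 c').natDegree = 0 := by omega
    have h5 : ∑ i, b i * (D.E (e i) 1).natDegree = 0 := by omega
    have h6 := (Finset.sum_eq_zero_iff.1 h5) i (Finset.mem_univ _)
    have h7 : b i = 0 := (Nat.mul_eq_zero.1 h6).resolve_right hi
    refine ⟨j, c', inv_of_natDegree_eq_zero (D.mem_zero _) h4, h2, ?_⟩
    rw [h1, hcoord, h7]
    simp
  let p : ℕ → Prop := fun d => 0 < d ∧ ∃ n c, c ∈ D.M n ∧ (D.E n c).natDegree = d
  have hp : ∃ d, p d := by
    obtain ⟨n, c, h1, h2⟩ := hD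
    exact ⟨_, h2, n, c, h1, rfl⟩
  set d0 := Nat.find hp
  obtain ⟨hd0, n0, c0, hc0, hdeg0⟩ : p d0 := Nat.find_spec hp
  have hmin : ∀ n c, c ∈ D.M n → (D.E n c).natDegree < d0 → D.Inv n c := by
    intro n c hc hlt
    apply inv_of_natDegree_eq_zero hc
    by_contra h
    exact Nat.find_min hp hlt ⟨Nat.pos_of_ne_zero h, n, c, hc, rfl⟩
  have hge : ∀ n c, c ∈ D.M n → (D.E n c).natDegree ≠ 0 → d0 ≤ (D.E n c).natDegree :=
    fun n c hc h => Nat.find_min' hp ⟨Nat.pos_of_ne_zero h, n, c, hc, rfl⟩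
  have hsel : (∃ i, (D.E (e i) 1).natDegree = d0) ∨ ∃ c, (D.E 0 c).natDegree = d0 := by
    have hne : c0 ≠ 0 := by rintro rfl; rw [D.E_zero] at hdeg0; simp at hdeg0; omega
    obtain ⟨b, j, c', -, -, -, h3⟩ := hfact n0 c0 hc0 hne
    rw [hdeg0] at h3
    by_cases hc' : (D.E 0 c').natDegree = 0
    · left
      rw [hc', add_zero] at h3
      obtain ⟨i, -, hi⟩ := Finset.exists_ne_zero_of_sum_ne_zero (h3 ▸ hd0.ne')
      refine ⟨i, le_antisymm ?_ (hge _ _ (he i) fun h => hi (by rw [h, mul_zero]))⟩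
      rw [h3]
      refine le_trans ?_ (Finset.single_le_sum (fun _ _ => Nat.zero_le _) (Finset.mem_univ i))
      exact Nat.le_mul_of_pos_left _ (Nat.pos_of_ne_zero fun h => hi (by rw [h, zero_mul]))
    · exact Or.inr ⟨c', le_antisymm (by omega) (hge _ _ (D.mem_zero _) hc')⟩
  -- the remaining variables are invariant
  have hrest : ∀ σ s, s ∈ D.M σ → (D.E σ s).natDegree = d0 → ∀ i, x i σ = 0 →
      (D.E (e i) 1).natDegree = 0 := by
    intro σ s hs hsd i hi
    by_contra hne
    obtain ⟨n', a, ha0, ha, P, hP, hPe⟩ := exists_mul_eq_eval hs (hsd ▸ hd0)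
      (fun n c hc hlt => hmin n c hc (hsd ▸ hlt)) _ (e i) 1 (he i) le_rfl
    have hP0 : P ≠ 0 := by
      rintro rfl
      rw [mul_one, Polynomial.eval_zero] at hPe
      exact ha0 hPe
    obtain ⟨j1, -, -, -, h1⟩ := hinvcoord i hne _ _ ha ha0
    obtain ⟨j2, -, -, -, h2⟩ := hinvcoord i hne _ _ (hP P.natDegree)
      (Polynomial.leadingCoeff_ne_zero.2 hP0)
    rw [map_sub, map_add, map_nsmul, hi, h1, hx, if_pos rfl, smul_zero, sub_zero] at h2
    have h3 : (1 + j2 * r i : ℤ) = j1 * r i := by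
      have : (1 + j2 * r i : ℚ) = j1 * r i := by linarith
      exact_mod_cast this
    have h4 : (r i : ℤ) ∣ 1 := ⟨j1 - j2, by linear_combination h3⟩
    have h5 := Int.le_of_dvd one_pos h4
    have := hr i
    omega
  by_cases hA : ∃ c, (D.E 0 c).natDegree = d0
  · obtain ⟨s, hs⟩ := hA
    have hall : ∀ i, (D.E (e i) 1).natDegree = 0 :=
      fun i => hrest 0 s (D.mem_zero s) hs i (map_zero _)
    have hfC : D.Inv 0 f := inv_of_natDegree_eq_zero (D.mem_zero _) (by
      rw [hfdeg]; exact Finset.sum_eq_zero fun i _ => by rw [hall, mul_zero])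
    have hto : ∀ n c, D.Inv n c → D.Inv 0 c := by
      intro n c hc
      rcases eq_or_ne c 0 with rfl | hc0
      · exact inv_zero _
      obtain ⟨b, j, c', -, -, h2, h3⟩ := hfact n c hc.1 hc0
      rw [hc.natDegree] at h3
      have h4 : D.Inv 0 c' := inv_of_natDegree_eq_zero (D.mem_zero _) (by omega)
      rw [h2]
      simpa using (hfC.pow j).mul h4
    refine ⟨⟨D.invSubalgebra hk, s, fun a b hab hne => ?_, fun b => ?_, ?_, Or.inl hfC⟩⟩
    · exact (Inv.of_mul (D.mem_zero a) (D.mem_zero b) (left_ne_zero_of_mul hne)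
        (right_ne_zero_of_mul hne) (by rw [add_zero]; exact hab)).1
    · obtain ⟨n', a, ha0, ha, P, hP, hPe⟩ := exists_mul_eq_eval (D.mem_zero s) (hs ▸ hd0)
        (fun n c hc hlt => hmin n c hc (hs ▸ hlt)) _ 0 b (D.mem_zero b) le_rfl
      exact ⟨a, hto _ _ ha, ha0, P, fun l => hto _ _ (hP l), hPe⟩
    · exact fun P hP h => eq_zero_of_eval_eq_zero (hs ▸ hd0) P hP h
  · obtain ⟨i1, hi1⟩ := hsel.resolve_right hA
    have hi1' : (D.E (e i1) 1).natDegree ≠ 0 := by omega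
    have hfpos : 0 < (D.E 0 f).natDegree := by
      rw [hfdeg]
      refine lt_of_lt_of_le ?_ (Finset.single_le_sum (fun _ _ => Nat.zero_le _) (Finset.mem_univ i1))
      have := hr i1
      rw [hi1]
      positivity
    refine ⟨⟨D.invSubalgebra hk, f, fun a b hab hne => ?_, fun b => ?_, ?_, Or.inr rfl⟩⟩
    · exact (Inv.of_mul (D.mem_zero a) (D.mem_zero b) (left_ne_zero_of_mul hne)
        (right_ne_zero_of_mul hne) (by rw [add_zero]; exact hab)).1
    · obtain ⟨n', a, ha0, ha, P, hP, hPe⟩ := exists_mul_eq_eval (he i1) (hi1 ▸ hd0)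
        (fun n c hc hlt => hmin n c hc (hi1 ▸ hlt)) _ 0 b (D.mem_zero b) le_rfl
      obtain ⟨j1, a', ha', haa, h1⟩ := hinvcoord i1 hi1' _ _ ha ha0
      have hterm : ∀ l, ∃ (t : ℕ) (c : N), D.Inv 0 c ∧ P.coeff l = f ^ j1 * (c * f ^ t) := by
        intro l
        by_cases hl : P.coeff l = 0
        · exact ⟨0, 0, inv_zero _, by rw [hl]; ring⟩
        obtain ⟨j2, c, hc, hcc, h2⟩ := hinvcoord i1 hi1' _ _ (hP l) hl
        rw [add_zero, map_sub, map_nsmul, h1, hx, if_pos rfl, nsmul_one] at h2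
        have h3 : (j1 * r i1 + l : ℚ) = j2 * r i1 := by linarith
        have h4 : j1 * r i1 + l = j2 * r i1 := by exact_mod_cast h3
        have h5 : j1 ≤ j2 := by
          have := hr i1
          exact Nat.le_of_mul_le_mul_right (by omega : j1 * r i1 ≤ j2 * r i1) (by omega)
        obtain ⟨t, rfl⟩ := Nat.exists_eq_add_of_le h5
        exact ⟨t, c, hc, by rw [hcc, pow_add]; ring⟩
      choose t c hc hcc using hterm
      refine ⟨a', ha', by rintro rfl; exact ha0 (by rw [haa, mul_zero]),
        ∑ l ∈ Finset.range (P.natDegree + 1), Polynomial.monomial (t l) (c l), fun l => ?_, ?_⟩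
      · rw [Polynomial.finsetSum_coeff]
        refine Subalgebra.sum_mem _ fun i _ => ?_
        rw [Polynomial.coeff_monomial]
        split_ifs
        · exact hc i
        · exact zero_mem _
      · apply mul_left_cancel₀ (pow_ne_zero j1 hf0)
        rw [← mul_assoc, ← haa, hPe, Polynomial.eval_finsetSum, Polynomial.eval_eq_sum_range,
          Finset.mul_sum]
        refine Finset.sum_congr rfl fun l _ => ?_
        rw [hcc, one_pow, mul_one, Polynomial.eval_monomial]
    · exact fun P hP h => eq_zero_of_eval_eq_zero hfpos P hP h

end GExp

end

section

section Lead
variable {N Γ : Type} [CommRing N] [AddCommGroup Γ] [LinearOrder Γ] [IsOrderedCancelAddMonoid Γ]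

/-- `a` has no coefficients in degrees less than `n`, and its coefficient in degree `n` is `c`. -/
def Lead (n : Γ) (c : N) (a : AddMonoidAlgebra N Γ) : Prop :=
  (∀ γ < n, a.coeff γ = 0) ∧ a.coeff n = c

namespace Lead

omit [AddCommGroup Γ] [IsOrderedCancelAddMonoid Γ] in
lemma single (n : Γ) (c : N) : Lead n c (AddMonoidAlgebra.single n c) := by
  classical
  refine ⟨fun γ hγ => ?_, ?_⟩
  · rw [AddMonoidAlgebra.coeff_single, Finsupp.single_apply, if_neg hγ.ne']
  · rw [AddMonoidAlgebra.coeff_single, Finsupp.single_apply, if_pos rfl]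

omit [IsOrderedCancelAddMonoid Γ] in
lemma zero (n : Γ) : Lead n (0 : N) 0 := ⟨fun _ _ => rfl, rfl⟩

omit [IsOrderedCancelAddMonoid Γ] in
lemma one : Lead (0 : Γ) (1 : N) 1 := by
  rw [AddMonoidAlgebra.one_def]; exact single 0 1

omit [IsOrderedCancelAddMonoid Γ] in
lemma add {n : Γ} {c c' : N} {a a' : AddMonoidAlgebra N Γ} (h : Lead n c a) (h' : Lead n c' a') :
    Lead n (c + c') (a + a') :=
  ⟨fun γ hγ => by rw [AddMonoidAlgebra.coeff_add, Finsupp.add_apply, h.1 γ hγ, h'.1 γ hγ, add_zero],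
    by rw [AddMonoidAlgebra.coeff_add, Finsupp.add_apply, h.2, h'.2]⟩

omit [IsOrderedCancelAddMonoid Γ] in
lemma sum {ι : Type} (s : Finset ι) {n : Γ} {c : ι → N} {a : ι → AddMonoidAlgebra N Γ}
    (h : ∀ i ∈ s, Lead n (c i) (a i)) : Lead n (∑ i ∈ s, c i) (∑ i ∈ s, a i) := by
  classical
  induction s using Finset.induction_on with
  | empty => exact zero n
  | insert i s hi ih =>
    rw [Finset.sum_insert hi, Finset.sum_insert hi]
    exact (h i (Finset.mem_insert_self _ _)).add (ih fun j hj => h j (Finset.mem_insert_of_mem hj))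

lemma mul {n n' : Γ} {c c' : N} {a a' : AddMonoidAlgebra N Γ} (h : Lead n c a)
    (h' : Lead n' c' a') : Lead (n + n') (c * c') (a * a') := by
  classical
  constructor
  · intro γ hγ
    rw [AddMonoidAlgebra.coeff_mul, Finsupp.sum]
    refine Finset.sum_eq_zero fun i _ => Finset.sum_eq_zero fun j _ => ?_
    beta_reduce
    split_ifs with hij
    · by_cases hi : i < n
      · rw [h.1 i hi, zero_mul]
      · by_cases hj : j < n'
        · rw [h'.1 j hj, mul_zero]
        · exact absurd (hij ▸ hγ) (not_lt.2 (add_le_add (not_lt.1 hi) (not_lt.1 hj)))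
    · rfl
  · rw [AddMonoidAlgebra.coeff_mul, Finsupp.sum, Finset.sum_eq_single n]
    · rw [Finsupp.sum, Finset.sum_eq_single n']
      · rw [if_pos rfl, h.2, h'.2]
      · intro j _ hj
        rw [if_neg fun hh => hj (add_left_cancel hh)]
      · intro hn'
        rw [if_pos rfl, Finsupp.notMem_support_iff.1 hn', mul_zero]
    · intro i _ hi
      refine Finset.sum_eq_zero fun j _ => ?_
      beta_reduce
      split_ifs with hij
      · rcases lt_or_gt_of_ne hi with hi | hi
        · rw [h.1 i hi, zero_mul]
        · have hj : j < n' := by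
            by_contra hj
            exact (add_lt_add_of_lt_of_le hi (not_lt.1 hj)).ne' hij
          rw [h'.1 j hj, mul_zero]
      · rfl
    · intro hn
      rw [Finsupp.notMem_support_iff.1 hn]
      exact Finset.sum_eq_zero fun j _ => by beta_reduce; rw [zero_mul, ite_self]

lemma pow {n : Γ} {c : N} {a : AddMonoidAlgebra N Γ} (h : Lead n c a) (t : ℕ) :
    Lead (t • n) (c ^ t) (a ^ t) := by
  induction t with
  | zero => rw [zero_smul, pow_zero, pow_zero]; exact one
  | succ t ih => rw [pow_succ, pow_succ, succ_nsmul]; exact ih.mul h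

lemma prod {ι : Type} (s : Finset ι) {n : ι → Γ} {c : ι → N} {a : ι → AddMonoidAlgebra N Γ}
    (h : ∀ i ∈ s, Lead (n i) (c i) (a i)) :
    Lead (∑ i ∈ s, n i) (∏ i ∈ s, c i) (∏ i ∈ s, a i) := by
  classical
  induction s using Finset.induction_on with
  | empty => exact one
  | insert i s hi ih =>
    rw [Finset.sum_insert hi, Finset.prod_insert hi, Finset.prod_insert hi]
    exact (h i (Finset.mem_insert_self _ _)).mul (ih fun j hj => h j (Finset.mem_insert_of_mem hj))

omit [AddCommGroup Γ] [IsOrderedCancelAddMonoid Γ] in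
lemma of_lt {n n' : Γ} {c : N} {a : AddMonoidAlgebra N Γ} (h : Lead n c a) (hn : n' < n) :
    Lead n' 0 a :=
  ⟨fun γ hγ => h.1 γ (hγ.trans hn), h.1 n' hn⟩

omit [AddCommGroup Γ] [IsOrderedCancelAddMonoid Γ] in
lemma exists_of_le {n n' : Γ} {c : N} {a : AddMonoidAlgebra N Γ} (h : Lead n c a) (hn : n' ≤ n) :
    ∃ c', Lead n' c' a := by
  rcases hn.eq_or_lt with rfl | hn
  · exact ⟨c, h⟩
  · exact ⟨0, h.of_lt hn⟩

omit [AddCommGroup Γ] [IsOrderedCancelAddMonoid Γ] in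
lemma unique {n : Γ} {c c' : N} {a : AddMonoidAlgebra N Γ} (h : Lead n c a) (h' : Lead n c' a) :
    c = c' := h.2.symm.trans h'.2

end Lead

end Lead

section Setup
variable (k : Type) [Field k] (m : ℕ) (r : Fin m → ℕ)

/-- Weights. -/
abbrev Wt := Lex (Fin m → ℚ)

/-- Weight of the `i`-th variable. -/
def eps (i : Fin m) : Wt m := toLex (Pi.single i 1)

variable {m}

/-- Weight of `∏ X_i ^ r_i`. -/
def rho : Wt m := ∑ i, r i • eps m i

/-- Weight of a monomial in the `X_i` and `Y`. -/
def wt (s : (Fin m → ℕ) × ℕ) : Wt m := ∑ i, s.1 i • eps m i - s.2 • rho r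

variable (m) in
/-- Coordinates of weights. -/
def crd (i : Fin m) : Wt m →+ ℚ where
  toFun n := ofLex n i
  map_zero' := rfl
  map_add' _ _ := rfl

lemma crd_eps (i j : Fin m) : crd m i (eps m j) = if i = j then 1 else 0 :=
  Pi.single_apply j (1 : ℚ) i

lemma crd_wt (s : (Fin m → ℕ) × ℕ) (i : Fin m) :
    crd m i (wt r s) = (s.1 i : ℚ) - s.2 * r i := by
  rw [wt, rho, map_sub, map_nsmul, map_sum, map_sum]
  simp only [map_nsmul, crd_eps]
  simp

/-- Reduced monomials. -/
def Red (s : (Fin m → ℕ) × ℕ) : Prop := s.2 = 0 ∨ ∃ i, s.1 i < r i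

lemma wt_injective_aux {s s' : (Fin m → ℕ) × ℕ} (h' : Red r s') (h : wt r s = wt r s') :
    s'.2 ≤ s.2 := by
  by_contra hlt
  push Not at hlt
  rcases h' with h' | ⟨i, hi⟩
  · omega
  · have h1 := congrArg (crd m i) h
    simp only [crd_wt] at h1
    have h2 : (s.1 i + s'.2 * r i : ℚ) = s'.1 i + s.2 * r i := by linarith
    have h3 : s.1 i + s'.2 * r i = s'.1 i + s.2 * r i := by exact_mod_cast h2
    have h4 : (s.2 + 1) * r i ≤ s'.2 * r i := Nat.mul_le_mul_right _ hlt
    rw [add_mul] at h4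
    omega

lemma wt_injective {s s' : (Fin m → ℕ) × ℕ} (hs : Red r s) (hs' : Red r s')
    (h : wt r s = wt r s') : s = s' := by
  have h2 : s.2 = s'.2 := le_antisymm (wt_injective_aux r hs h.symm) (wt_injective_aux r hs' h)
  refine Prod.ext (funext fun i => ?_) h2
  have h1 := congrArg (crd m i) h
  simp only [crd_wt, h2] at h1
  have h3 : (s.1 i : ℚ) = s'.1 i := by linarith
  exact_mod_cast h3

/-- A ring with elements `x_i`, `y` and a copy of `k[Z, T]`, whose elements have reduced
expressions, together with a homomorphism to a Laurent polynomial ring sending `y` to an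
element with lowest term `f` divided by `∏ x_i ^ r_i`. -/
structure Setup (A : Type) [CommRing A] [Algebra k A] (f : MvPolynomial (Fin 2) k) where
  x : Fin m → A
  y : A
  ν : MvPolynomial (Fin 2) k →ₐ[k] A
  ι : A →ₐ[k] AddMonoidAlgebra (MvPolynomial (Fin 2) k) (Wt m)
  ι_x : ∀ i, ι (x i) = AddMonoidAlgebra.single (eps m i) 1
  ι_ν : ∀ c, ι (ν c) = AddMonoidAlgebra.single 0 c
  lead_y : Lead (-rho r) f (ι y)
  dvd_rel : (∏ i, x i) ∣ (∏ i, x i ^ r i) * y - ν f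
  exists_eq_sum : ∀ a, ∃ u : ((Fin m → ℕ) × ℕ) →₀ MvPolynomial (Fin 2) k,
    (∀ s ∈ u.support, Red r s) ∧ a = u.sum fun s c => (∏ i, x i ^ s.1 i) * y ^ s.2 * ν c

variable {k r}

namespace Setup
variable {A : Type} [CommRing A] [Algebra k A] {f : MvPolynomial (Fin 2) k} (S : Setup k r A f)

/-- Monomials. -/
def mon (s : (Fin m → ℕ) × ℕ) (c : MvPolynomial (Fin 2) k) : A :=
  (∏ i, S.x i ^ s.1 i) * S.y ^ s.2 * S.ν c

lemma lead_x (i : Fin m) : Lead (eps m i) 1 (S.ι (S.x i)) := by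
  rw [S.ι_x]; exact Lead.single _ _

lemma lead_ν (c : MvPolynomial (Fin 2) k) : Lead 0 c (S.ι (S.ν c)) := by
  rw [S.ι_ν]; exact Lead.single _ _

lemma lead_mon (s : (Fin m → ℕ) × ℕ) (c : MvPolynomial (Fin 2) k) :
    Lead (wt r s) (f ^ s.2 * c) (S.ι (S.mon s c)) := by
  have h1 : Lead (∑ i, s.1 i • eps m i) (∏ i, (1 : MvPolynomial (Fin 2) k) ^ s.1 i)
      (∏ i, S.ι (S.x i) ^ s.1 i) := Lead.prod _ fun i _ => (S.lead_x i).pow _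
  have := (h1.mul (S.lead_y.pow s.2)).mul (S.lead_ν c)
  rw [add_zero, neg_nsmul, ← sub_eq_add_neg] at this
  simp only [one_pow, Finset.prod_const_one, one_mul] at this
  rw [mon, map_mul, map_mul, map_pow, map_prod]
  simpa only [map_pow, wt] using this

variable {S}

lemma exists_mon (hf : f ≠ 0) {a : A} {u : ((Fin m → ℕ) × ℕ) →₀ MvPolynomial (Fin 2) k}
    (hu : ∀ s ∈ u.support, Red r s) (ha : a = u.sum S.mon) {n : Wt m}
    {c : MvPolynomial (Fin 2) k} (h : Lead n c (S.ι a)) :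
    (∀ s ∈ u.support, n ≤ wt r s) ∧ (c = 0 → ∀ s ∈ u.support, n < wt r s) ∧ (c ≠ 0 → ∃ s ∈ u.support, wt r s = n ∧ c = f ^ s.2 * u s) := by
  have hιa : S.ι a = ∑ s ∈ u.support, S.ι (S.mon s (u s)) := by
    rw [ha, Finsupp.sum, map_sum]
  have key : ∀ s0 ∈ u.support, (∀ s ∈ u.support, wt r s0 ≤ wt r s) →
      (S.ι a).coeff (wt r s0) = f ^ s0.2 * u s0 := by
    intro s0 hs0 hmin
    have := Lead.sum u.support (n := wt r s0)
      (c := fun s => if s = s0 then f ^ s0.2 * u s0 else 0)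
      (a := fun s => S.ι (S.mon s (u s))) fun s hs => by
        split_ifs with h
        · subst h; exact S.lead_mon _ _
        · refine (S.lead_mon s (u s)).of_lt (lt_of_le_of_ne (hmin s hs) fun hh => h ?_)
          exact wt_injective r (hu s hs) (hu s0 hs0) hh.symm
    rw [← hιa, Finset.sum_ite_eq', if_pos hs0] at this
    exact this.2
  have h1 : ∀ s ∈ u.support, n ≤ wt r s := by
    intro s hs
    obtain ⟨s0, hs0, hmin⟩ := Finset.exists_min_image u.support (wt r) ⟨s, hs⟩
    refine le_trans ?_ (hmin s hs)
    by_contra hlt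
    push Not at hlt
    have := key s0 hs0 hmin
    rw [h.1 _ hlt] at this
    exact mul_ne_zero (pow_ne_zero _ hf) (Finsupp.mem_support_iff.1 hs0) this.symm
  refine ⟨h1, fun hc s hs => lt_of_le_of_ne (h1 s hs) fun hn => ?_, fun hc => ?_⟩
  · have h2 := key s hs fun s' hs' => hn ▸ h1 s' hs'
    rw [← hn, h.2, hc] at h2
    exact mul_ne_zero (pow_ne_zero _ hf) (Finsupp.mem_support_iff.1 hs) h2.symm
  by_contra hcon
  push Not at hcon
  have hlt : ∀ s ∈ u.support, n < wt r s := by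
    intro s hs
    refine lt_of_le_of_ne (h1 s hs) fun hn => ?_
    have h2 := key s hs fun s' hs' => hn ▸ h1 s' hs'
    rw [← hn, h.2] at h2
    exact hcon s hs hn.symm h2
  have := Lead.sum u.support (n := n) (c := fun _ => 0) (a := fun s => S.ι (S.mon s (u s)))
    fun s hs => (S.lead_mon s (u s)).of_lt (hlt s hs)
  rw [← hιa, Finset.sum_const_zero] at this
  exact hc (h.unique this)

lemma exists_of_lead (hf : f ≠ 0) {a : A} {n : Wt m} {c : MvPolynomial (Fin 2) k}
    (h : Lead n c (S.ι a)) (hc : c ≠ 0) : ∃ (b : Fin m → ℕ) (j : ℕ) (c' : MvPolynomial (Fin 2) k),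
      n = ∑ i, b i • eps m i - j • ∑ i, r i • eps m i ∧ c = f ^ j * c' := by
  obtain ⟨u, hu, ha⟩ := S.exists_eq_sum a
  obtain ⟨s, -, h1, h2⟩ := (exists_mon hf hu ha h).2.2 hc
  exact ⟨s.1, s.2, u s, h1.symm, h2⟩

lemma ι_injective (hm : 0 < m) (hf : f ≠ 0) : Function.Injective S.ι := by
  rw [injective_iff_map_eq_zero]
  intro a h
  obtain ⟨u, hu, ha⟩ := S.exists_eq_sum a
  rcases eq_or_ne u 0 with rfl | hne
  · simpa using ha
  obtain ⟨s, hs⟩ := Finsupp.support_nonempty_iff.2 hne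
  have hpos : (0 : Wt m) < eps m ⟨0, hm⟩ := by
    rw [eps, ← toLex_zero]
    apply Pi.toLex_strictMono
    rw [Pi.lt_def]
    refine ⟨fun i => ?_, ⟨0, hm⟩, by simp⟩
    rw [Pi.zero_apply, Pi.single_apply]
    split_ifs <;> norm_num
  have := (exists_mon hf hu ha (n := wt r s + eps m ⟨0, hm⟩) (c := 0)
    (by rw [h]; exact Lead.zero _)).1 s hs
  exact absurd this (not_le.2 (lt_add_of_pos_right _ hpos))

end Setup

end Setup

end

section

section RingASetup
variable {k : Type} [Field k] {m : ℕ} {r : Fin m → ℕ}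

/-- Sums of reduced monomials. -/
def reducedSums {A : Type} [CommRing A] [Algebra k A] (r : Fin m → ℕ) (x : Fin m → A) (y : A)
    (ν : MvPolynomial (Fin 2) k →ₐ[k] A) : AddSubmonoid A where
  carrier := {a | ∃ u : ((Fin m → ℕ) × ℕ) →₀ MvPolynomial (Fin 2) k,
    (∀ s ∈ u.support, Red r s) ∧ a = u.sum fun s c => (∏ i, x i ^ s.1 i) * y ^ s.2 * ν c}
  zero_mem' := ⟨0, by simp, by simp⟩
  add_mem' := by
    classical
    rintro _ _ ⟨u, hu, rfl⟩ ⟨v, hv, rfl⟩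
    refine ⟨u + v, fun s hs => ?_, ?_⟩
    · rcases Finset.mem_union.1 (Finsupp.support_add hs) with h | h
      · exact hu s h
      · exact hv s h
    · rw [Finsupp.sum_add_index']
      · intro s; rw [map_zero, mul_zero]
      · intro s c d; rw [map_add, mul_add]

lemma mem_reducedSums {A : Type} [CommRing A] [Algebra k A] (x : Fin m → A) (y : A)
    (ν : MvPolynomial (Fin 2) k →ₐ[k] A) {P : MvPolynomial (Fin m ⊕ Fin 2) k}
    (hrel : (∏ i, x i ^ r i) * y = aeval (Sum.elim x fun j => ν (X j)) P) (j : ℕ) :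
    ∀ (b : Fin m → ℕ) (c : MvPolynomial (Fin 2) k),
      (∏ i, x i ^ b i) * y ^ j * ν c ∈ reducedSums r x y ν := by
  classical
  have base : ∀ (b : Fin m → ℕ) (j : ℕ) (c : MvPolynomial (Fin 2) k), Red r (b, j) →
      (∏ i, x i ^ b i) * y ^ j * ν c ∈ reducedSums r x y ν := by
    intro b j c h
    refine ⟨Finsupp.single (b, j) c, fun s hs => ?_, ?_⟩
    · rw [Finset.mem_singleton.1 (Finsupp.support_single_subset hs)]; exact h
    · rw [Finsupp.sum_single_index]
      rw [map_zero, mul_zero]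
  induction j with
  | zero => exact fun b c => base b 0 c (Or.inl rfl)
  | succ j ih =>
    intro b c
    by_cases h : Red r (b, j + 1)
    · exact base b (j + 1) c h
    have h' : ∀ i, r i ≤ b i := fun i => not_lt.1 fun hi => h (Or.inr ⟨i, hi⟩)
    have hb : ∏ i, x i ^ b i = (∏ i, x i ^ (b i - r i)) * ∏ i, x i ^ r i := by
      rw [← Finset.prod_mul_distrib]
      exact Finset.prod_congr rfl fun i _ => by rw [← pow_add, Nat.sub_add_cancel (h' i)]
    have key : ∀ (Q : MvPolynomial (Fin m ⊕ Fin 2) k) (b : Fin m → ℕ) (c : MvPolynomial (Fin 2) k),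
        (∏ i, x i ^ b i) * y ^ j * ν c * aeval (Sum.elim x fun j => ν (X j)) Q ∈
          reducedSums r x y ν := by
      intro Q
      induction Q using MvPolynomial.induction_on with
      | C a =>
        intro b c
        rw [show (aeval (Sum.elim x fun j => ν (X j))) (C a : MvPolynomial (Fin m ⊕ Fin 2) k) =
          ν (C a) by rw [aeval_C, ← ν.commutes]; rfl, mul_assoc, ← map_mul]
        exact ih b _
      | add p q hp hq =>
        intro b c
        rw [map_add, mul_add]
        exact add_mem (hp b c) (hq b c)
      | mul_X p i hp =>
        intro b c
        rw [map_mul, aeval_X]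
        rcases i with i | i
        · rw [Sum.elim_inl]
          have e : (∏ l, x l ^ (b + Pi.single i 1 : Fin m → ℕ) l) = (∏ l, x l ^ b l) * x i := by
            simp only [Pi.add_apply, pow_add, Finset.prod_mul_distrib]
            congr 1
            rw [Finset.prod_eq_single i]
            · rw [Pi.single_eq_same, pow_one]
            · intro l _ hl; rw [Pi.single_eq_of_ne hl, pow_zero]
            · exact fun hi => absurd (Finset.mem_univ i) hi
          have := hp (b + Pi.single i 1) c
          rw [e] at this
          convert this using 1
          ring
        · rw [Sum.elim_inr]
          have := hp b (c * X i)
          rw [map_mul] at this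
          convert this using 1
          ring
    have := key P (fun i => b i - r i) c
    rw [← hrel] at this
    rw [hb]
    convert this using 1
    ring

lemma exists_setup (hm : 0 < m) (f : MvPolynomial (Fin 2) k) (g : MvPolynomial (Fin m ⊕ Fin 2) k)
    (F : MvPolynomial (Fin m ⊕ Fin 2) k) (hF : F = rename Sum.inr f + (∏ i, X (Sum.inl i)) * g) :
    ∃ S : Setup k r (RingA k m r F) f, S.x = xA k m r F := by
  classical
  set q := Ideal.Quotient.mkₐ k (Ideal.span {relG k m r F}) with hq
  have hqrel : q (relG k m r F) = 0 :=
    Ideal.Quotient.eq_zero_iff_mem.2 (Ideal.mem_span_singleton_self _)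
  let ν : MvPolynomial (Fin 2) k →ₐ[k] RingA k m r F :=
    q.comp (rename fun j => Sum.inr (Fin.succ j))
  have hincl : ∀ P, aeval (Sum.elim (xA k m r F) fun j => ν (X j)) P = q (incl k m P) := by
    intro P
    have : aeval (Sum.elim (xA k m r F) fun j => ν (X j)) = q.comp (incl k m) := by
      apply MvPolynomial.algHom_ext
      rintro (i | i)
      · simp [incl, q, xA]
      · simp [incl, ν]
    rw [this]; rfl
  have hrel : (∏ i, xA k m r F i ^ r i) * yA k m r F =
      aeval (Sum.elim (xA k m r F) fun j => ν (X j)) F := by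
    have h : q ((∏ i, X (Sum.inl i) ^ r i) * X (Sum.inr 0) - incl k m F) = 0 := hqrel
    rw [map_sub, map_mul, map_prod] at h
    simp only [map_pow] at h
    rw [hincl]
    exact sub_eq_zero.1 h
  have hνf : ν f = aeval (Sum.elim (xA k m r F) fun j => ν (X j)) (rename Sum.inr f) := by
    rw [aeval_rename]
    have : ν = aeval ((Sum.elim (xA k m r F) fun j => ν (X j)) ∘ Sum.inr) := by
      apply MvPolynomial.algHom_ext
      intro i; simp
    exact congrArg (fun u => u f) this
  let L := AddMonoidAlgebra (MvPolynomial (Fin 2) k) (Wt m)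
  let xs : Fin m → L := fun i => AddMonoidAlgebra.single (eps m i) 1
  let s0 : MvPolynomial (Fin 2) k →ₐ[k] L := AddMonoidAlgebra.singleZeroAlgHom
  have hs0 : ∀ c, s0 c = AddMonoidAlgebra.single 0 c := fun c => rfl
  let β : MvPolynomial (Fin m ⊕ Fin 2) k →ₐ[k] L := aeval (Sum.elim xs fun j => s0 (X j))
  let Φ : BigP k m →ₐ[k] L :=
    aeval (Sum.elim xs ![AddMonoidAlgebra.single (-rho r) 1 * β F, s0 (X 0), s0 (X 1)])
  have hΦincl : ∀ P, Φ (incl k m P) = β P := by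
    intro P
    have : Φ.comp (incl k m) = β := by
      apply MvPolynomial.algHom_ext
      rintro (i | i)
      · simp [incl, β, Φ]
      · fin_cases i <;> simp [incl, β, Φ]
    rw [← this]; rfl
  have hxs : ∏ i, xs i ^ r i = AddMonoidAlgebra.single (rho r) 1 := by
    have : ∀ t : Finset (Fin m), ∏ i ∈ t, xs i ^ r i =
        AddMonoidAlgebra.single (∑ i ∈ t, r i • eps m i) (1 : MvPolynomial (Fin 2) k) := by
      intro t
      induction t using Finset.induction_on with
      | empty => rfl
      | insert i t hi ih =>
        rw [Finset.prod_insert hi, Finset.sum_insert hi, ih, AddMonoidAlgebra.single_pow,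
          AddMonoidAlgebra.single_mul_single, one_pow, one_mul]
    exact this _
  have hΦrel : Φ (relG k m r F) = 0 := by
    rw [relG, map_sub, hΦincl, map_mul, map_prod]
    simp only [map_pow]
    have h1 : ∀ i, Φ (X (Sum.inl i)) = xs i := fun i => by simp [Φ]
    have h2 : Φ (X (Sum.inr 0)) = AddMonoidAlgebra.single (-rho r) 1 * β F := by simp [Φ]
    simp only [h1]
    rw [hxs, h2, ← mul_assoc, AddMonoidAlgebra.single_mul_single, add_neg_cancel, one_mul,
      ← AddMonoidAlgebra.one_def, one_mul, sub_self]
  have heps : ∀ i, (0 : Wt m) < eps m i := by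
    intro i
    rw [eps, ← toLex_zero]
    apply Pi.toLex_strictMono
    rw [Pi.lt_def]
    refine ⟨fun j => ?_, i, by simp⟩
    rw [Pi.zero_apply, Pi.single_apply]
    split_ifs <;> norm_num
  have hxlead : ∀ i, Lead (eps m i) 1 (xs i) := fun i => Lead.single _ _
  have hβ : ∀ P, ∃ c, Lead 0 c (β P) := by
    intro P
    induction P using MvPolynomial.induction_on with
    | C a =>
      refine ⟨C a, ?_⟩
      rw [show β (C a) = s0 (C a) by
        rw [show β (C a) = algebraMap k L a from aeval_C _ a, ← s0.commutes]; rfl, hs0]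
      exact Lead.single _ _
    | add p q hp hq =>
      obtain ⟨c, hc⟩ := hp
      obtain ⟨d, hd⟩ := hq
      exact ⟨c + d, by rw [map_add]; exact hc.add hd⟩
    | mul_X p i hp =>
      obtain ⟨c, hc⟩ := hp
      rw [map_mul]
      rcases i with i | i
      · refine ⟨c * 0, ?_⟩
        have := hc.mul ((hxlead i).of_lt (heps i))
        rw [add_zero] at this
        simpa [β] using this
      · refine ⟨c * X i, ?_⟩
        have := hc.mul (Lead.single (0 : Wt m) (X i : MvPolynomial (Fin 2) k))
        rw [add_zero, ← hs0] at this
        simpa [β] using this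
  have hβF : Lead 0 f (β F) := by
    rw [hF, map_add, map_mul, map_prod]
    have h1 : β (rename Sum.inr f) = s0 f := by
      have : β.comp (rename Sum.inr) = s0 := by
        apply MvPolynomial.algHom_ext
        intro i; simp [β]
      rw [← this]; rfl
    have h2 : Lead (∑ i, eps m i) (∏ i : Fin m, (1 : MvPolynomial (Fin 2) k))
        (∏ i, β (X (Sum.inl i))) := by
      refine Lead.prod _ fun i _ => ?_
      have : β (X (Sum.inl i)) = xs i := by simp [β]
      rw [this]; exact hxlead i
    have h3 : (0 : Wt m) < ∑ i, eps m i :=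
      Finset.sum_pos (fun i _ => heps i) ⟨⟨0, hm⟩, Finset.mem_univ _⟩
    obtain ⟨c, hc⟩ := hβ g
    have h4 := (h2.of_lt h3).mul hc
    have h5 := (Lead.single (0 : Wt m) f).add (by simpa using h4)
    rw [add_zero] at h5
    rw [h1, hs0]
    exact h5
  let ι : RingA k m r F →ₐ[k] L := Ideal.Quotient.liftₐ _ Φ (by
    intro a ha
    obtain ⟨b, rfl⟩ := Ideal.mem_span_singleton.1 ha
    rw [map_mul, hΦrel, zero_mul])
  have hι : ∀ p, ι (q p) = Φ p := fun p => rfl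
  refine ⟨⟨xA k m r F, yA k m r F, ν, ι, fun i => ?_, fun c => ?_, ?_, ?_, fun a => ?_⟩, rfl⟩
  · change ι (q _) = _
    rw [hι]; simp [Φ, xs]
  · change ι (q _) = _
    rw [hι, ← hs0]
    have : Φ.comp (rename fun j => Sum.inr (Fin.succ j)) = s0 := by
      apply MvPolynomial.algHom_ext
      intro i
      fin_cases i <;> simp [Φ]
    exact congrArg (fun u => u c) this
  · have : ι (yA k m r F) = AddMonoidAlgebra.single (-rho r) 1 * β F := by
      change ι (q _) = _
      rw [hι]; simp [Φ]
    rw [this]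
    have := (Lead.single (-rho r) (1 : MvPolynomial (Fin 2) k)).mul hβF
    rwa [add_zero, one_mul] at this
  · have e := congrArg (aeval (Sum.elim (xA k m r F) fun j => ν (X j))) hF
    rw [map_add, map_mul, map_prod] at e
    simp only [aeval_X, Sum.elim_inl] at e
    rw [hrel, hνf, e, add_sub_cancel_left]
    exact dvd_mul_right _ _
  · obtain ⟨p, rfl⟩ := Ideal.Quotient.mk_surjective a
    have key : ∀ (b : Fin m → ℕ) (j : ℕ) (c : MvPolynomial (Fin 2) k),
        (∏ i, xA k m r F i ^ b i) * yA k m r F ^ j * ν c * q p ∈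
          reducedSums r (xA k m r F) (yA k m r F) ν := by
      induction p using MvPolynomial.induction_on with
      | C a =>
        intro b j c
        rw [show q (C a) = ν (C a) by simp [ν], mul_assoc, ← map_mul]
        exact mem_reducedSums _ _ ν hrel j b _
      | add p q' hp hq =>
        intro b j c
        rw [map_add, mul_add]
        exact add_mem (hp b j c) (hq b j c)
      | mul_X p i hp =>
        intro b j c
        rw [map_mul]
        rcases i with i | i
        · have e : (∏ l, xA k m r F l ^ (b + Pi.single i 1 : Fin m → ℕ) l) =
              (∏ l, xA k m r F l ^ b l) * xA k m r F i := by
            simp only [Pi.add_apply, pow_add, Finset.prod_mul_distrib]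
            congr 1
            rw [Finset.prod_eq_single i]
            · rw [Pi.single_eq_same, pow_one]
            · intro l _ hl; rw [Pi.single_eq_of_ne hl, pow_zero]
            · exact fun hi => absurd (Finset.mem_univ i) hi
          have := hp (b + Pi.single i 1) j c
          rw [e] at this
          convert this using 1
          change _ * (_ * xA k m r F i) = _
          ring
        · refine Fin.cases ?_ (fun i => ?_) i
          · have := hp b (j + 1) c
            convert this using 1
            change _ * (_ * yA k m r F) = _
            ring
          · have := hp b j (c * X i)
            rw [map_mul] at this
            convert this using 1
            rw [show ν (X i) = q (X (Sum.inr i.succ)) by simp [ν]]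
            ring
    have := key 0 0 1
    simp only [Pi.zero_apply, pow_zero, Finset.prod_const_one, map_one, one_mul] at this
    exact this

end RingASetup

end

section

/-- A locally finite iterative higher derivation. -/
structure HasseFamily (k A : Type) [CommRing k] [CommRing A] [Algebra k A] where
  D : ℕ → A →ₗ[k] A
  D_zero : ∀ a, D 0 a = a
  D_one : ∀ i, i ≠ 0 → D i 1 = 0
  D_mul : ∀ i a b, D i (a * b) =
    ∑ x ∈ Finset.HasAntidiagonal.antidiagonal i, D x.1 a * D x.2 b
  D_comp : ∀ i j a, D j (D i a) = (i + j).choose i • D (i + j) a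
  bound : ∀ a, ∃ B, ∀ i, B < i → D i a = 0

/-- The divided derivatives of a polynomial ring. -/
def HasseFamily.ofEquiv {k A B : Type} [CommRing k] [CommRing A] [Algebra k A] [CommRing B]
    [Algebra k B] (ψ : A ≃ₐ[k] Polynomial B) : HasseFamily k A where
  D i := ψ.symm.toLinearMap ∘ₗ ((Polynomial.hasseDeriv i).restrictScalars k) ∘ₗ ψ.toLinearMap
  D_zero a := by simp
  D_one i hi := by
    simp [Polynomial.hasseDeriv_eq_zero_of_lt_natDegree (1 : Polynomial B) i
      (by rw [Polynomial.natDegree_one]; omega)]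
  D_mul i a b := by simp [Polynomial.hasseDeriv_mul]
  D_comp i j a := by
    have := congrArg (fun u => u (ψ a)) (Polynomial.hasseDeriv_comp (R := B) j i)
    simp only [LinearMap.comp_apply, LinearMap.smul_apply] at this
    rw [add_comm j i, ← Nat.choose_symm_add] at this
    simp [this]
  bound a := ⟨(ψ a).natDegree, fun i hi => by
    simp [Polynomial.hasseDeriv_eq_zero_of_lt_natDegree _ _ hi]⟩

lemma Lead.neg {N Γ : Type} [CommRing N] [AddCommGroup Γ] [LinearOrder Γ] {n : Γ} {c : N}
    {a : AddMonoidAlgebra N Γ} (h : Lead n c a) : Lead n (-c) (-a) :=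
  ⟨fun γ hγ => by rw [AddMonoidAlgebra.coeff_neg, Finsupp.neg_apply, h.1 γ hγ, neg_zero],
    by rw [AddMonoidAlgebra.coeff_neg, Finsupp.neg_apply, h.2]⟩

namespace Setup
variable {k : Type} [Field k] {m : ℕ} {r : Fin m → ℕ} {A : Type} [CommRing A] [Algebra k A]
  {f : MvPolynomial (Fin 2) k} (S : Setup k r A f) (H : HasseFamily k A)

/-- The generators. -/
def gen : Fin m ⊕ Fin 3 → A := Sum.elim S.x ![S.y, S.ν (X 0), S.ν (X 1)]

/-- The weights of the generators. -/
def genWt (r : Fin m → ℕ) : Fin m ⊕ Fin 3 → Wt m := Sum.elim (eps m) ![-rho r, 0, 0]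

lemma exists_lead_gen (g) : ∃ c, Lead (genWt r g) c (S.ι (S.gen g)) := by
  rcases g with i | i
  · exact ⟨_, S.lead_x i⟩
  · fin_cases i
    · exact ⟨_, S.lead_y⟩
    · exact ⟨_, S.lead_ν _⟩
    · exact ⟨_, S.lead_ν _⟩

lemma adjoin_gen : Algebra.adjoin k (Set.range S.gen) = ⊤ := by
  rw [eq_top_iff]
  intro a _
  obtain ⟨u, -, rfl⟩ := S.exists_eq_sum a
  have hx : ∀ i, S.x i ∈ Algebra.adjoin k (Set.range S.gen) :=
    fun i => Algebra.subset_adjoin ⟨Sum.inl i, rfl⟩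
  have hy : S.y ∈ Algebra.adjoin k (Set.range S.gen) :=
    Algebra.subset_adjoin ⟨Sum.inr 0, rfl⟩
  have hν : ∀ c, S.ν c ∈ Algebra.adjoin k (Set.range S.gen) := by
    intro c
    induction c using MvPolynomial.induction_on with
    | C a => rw [← algebraMap_eq, S.ν.commutes]; exact Subalgebra.algebraMap_mem _ _
    | add p q hp hq => rw [map_add]; exact add_mem hp hq
    | mul_X p i hp =>
      rw [map_mul]
      refine mul_mem hp (Algebra.subset_adjoin ?_)
      fin_cases i
      · exact ⟨Sum.inr 1, rfl⟩
      · exact ⟨Sum.inr 2, rfl⟩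
  exact sum_mem fun s _ => mul_mem (mul_mem (prod_mem fun i _ => pow_mem (hx i) _)
    (pow_mem hy _)) (hν _)

lemma exists_D_gen_ne_zero (h : ∃ a, ∃ i, i ≠ 0 ∧ H.D i a ≠ 0) :
    ∃ g, ∃ i, i ≠ 0 ∧ H.D i (S.gen g) ≠ 0 := by
  by_contra hcon
  push Not at hcon
  let K : Subalgebra k A :=
    { carrier := {a | ∀ i, i ≠ 0 → H.D i a = 0}
      mul_mem' := fun {a b} ha hb i hi => by
        rw [H.D_mul]
        refine Finset.sum_eq_zero fun x hx => ?_
        have := Finset.HasAntidiagonal.mem_antidiagonal.1 hx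
        by_cases h1 : x.1 = 0
        · rw [hb x.2 (by omega), mul_zero]
        · rw [ha x.1 h1, zero_mul]
      add_mem' := fun ha hb i hi => by rw [map_add, ha i hi, hb i hi, add_zero]
      algebraMap_mem' := fun a i hi => by
        rw [Algebra.algebraMap_eq_smul_one, map_smul, H.D_one i hi, smul_zero] }
  have hK : K = ⊤ := by
    rw [eq_top_iff, ← S.adjoin_gen, Algebra.adjoin_le_iff]
    rintro _ ⟨g, rfl⟩
    exact hcon g
  obtain ⟨a, i, hi, ha⟩ := h
  have : a ∈ K := hK ▸ Algebra.mem_top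
  exact ha (this i hi)

/-- Division of weights by natural numbers. -/
def divWt (v : Wt m) (i : ℕ) : Wt m := toLex fun j => ofLex v j / i

lemma wt_ext {v w : Wt m} (h : ∀ i, crd m i v = crd m i w) : v = w :=
  ofLex.injective (funext h)

lemma nsmul_divWt (v : Wt m) {i : ℕ} (hi : i ≠ 0) : i • divWt v i = v := by
  apply wt_ext
  intro j
  rw [map_nsmul]
  change i • (crd m j v / i) = _
  rw [nsmul_eq_mul]
  field_simp

lemma exists_delta (hm : 0 < m) (hf : f ≠ 0) (h : ∃ a, ∃ i, i ≠ 0 ∧ H.D i a ≠ 0) : ∃ δ : Wt m,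
    (∀ g i, ∃ c, Lead (genWt r g + i • δ) c (S.ι (H.D i (S.gen g)))) ∧
    ∃ g i, i ≠ 0 ∧ (S.ι (H.D i (S.gen g))).coeff (genWt r g + i • δ) ≠ 0 := by
  classical
  choose B hB using H.bound
  let T : Finset (Wt m) := Finset.univ.biUnion fun g => (Finset.Icc 1 (B (S.gen g))).biUnion fun i =>
    (S.ι (H.D i (S.gen g))).coeff.support.image fun n => divWt (n - genWt r g) i
  have memT : ∀ g i n, i ≠ 0 → (S.ι (H.D i (S.gen g))).coeff n ≠ 0 →
      divWt (n - genWt r g) i ∈ T := by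
    intro g i n hi hn
    simp only [T, Finset.mem_biUnion, Finset.mem_image]
    refine ⟨g, Finset.mem_univ _, i, Finset.mem_Icc.2 ⟨Nat.pos_of_ne_zero hi, ?_⟩, n,
      Finsupp.mem_support_iff.2 hn, rfl⟩
    by_contra hlt
    apply hn
    rw [hB _ i (not_le.1 hlt), map_zero]
    rfl
  have hT : T.Nonempty := by
    obtain ⟨g, i, hi, hne⟩ := S.exists_D_gen_ne_zero H h
    have : S.ι (H.D i (S.gen g)) ≠ 0 := fun h0 => hne (S.ι_injective hm hf (h0.trans (map_zero _).symm))
    obtain ⟨n, hn⟩ : ∃ n, (S.ι (H.D i (S.gen g))).coeff n ≠ 0 := by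
      by_contra hcon
      push Not at hcon
      exact this (AddMonoidAlgebra.ext (Finsupp.ext hcon))
    exact ⟨_, memT g i n hi hn⟩
  refine ⟨T.min' hT, fun g i => ?_, ?_⟩
  · by_cases hi : i = 0
    · obtain ⟨c, hc⟩ := S.exists_lead_gen g
      exact ⟨c, by rw [hi, zero_nsmul, add_zero, H.D_zero]; exact hc⟩
    · refine ⟨_, fun γ hγ => ?_, rfl⟩
      by_contra hne
      have h1 := nsmul_le_nsmul_right (T.min'_le _ (memT g i γ hi hne)) i
      rw [nsmul_divWt _ hi, le_sub_iff_add_le'] at h1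
      exact absurd hγ (not_lt.2 h1)
  · have := T.min'_mem hT
    simp only [T, Finset.mem_biUnion, Finset.mem_image] at this
    obtain ⟨g, -, i, hi, n, hn, h1⟩ := this
    have hi0 : i ≠ 0 := by have := (Finset.mem_Icc.1 hi).1; omega
    refine ⟨g, i, hi0, ?_⟩
    have h2 : genWt r g + i • T.min' hT = n := by
      simp only [T]
      rw [← h1, nsmul_divWt _ hi0, add_sub_cancel]
    rw [h2]
    exact Finsupp.mem_support_iff.1 hn

/-- Compatibility of the weights with the derivatives. -/
def Compat (δ n : Wt m) (a : A) : Prop := ∀ i, ∃ c, Lead (n + i • δ) c (S.ι (H.D i a))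

variable {S H} {δ : Wt m}

lemma Compat.add {n : Wt m} {a b : A} (ha : S.Compat H δ n a) (hb : S.Compat H δ n b) :
    S.Compat H δ n (a + b) := fun i => by
  obtain ⟨c, hc⟩ := ha i
  obtain ⟨d, hd⟩ := hb i
  exact ⟨c + d, by rw [map_add, map_add]; exact hc.add hd⟩

lemma lead_D_mul {n n' : Wt m} {a b : A} {c d : ℕ → MvPolynomial (Fin 2) k}
    (ha : ∀ i, Lead (n + i • δ) (c i) (S.ι (H.D i a)))
    (hb : ∀ i, Lead (n' + i • δ) (d i) (S.ι (H.D i b))) (i : ℕ) :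
    Lead (n + n' + i • δ) (∑ x ∈ Finset.HasAntidiagonal.antidiagonal i, c x.1 * d x.2)
      (S.ι (H.D i (a * b))) := by
  rw [H.D_mul, map_sum]
  refine Lead.sum _ fun x hx => ?_
  rw [map_mul]
  convert (ha x.1).mul (hb x.2) using 1
  rw [← Finset.HasAntidiagonal.mem_antidiagonal.1 hx, add_nsmul]
  abel

lemma Compat.mul {n n' : Wt m} {a b : A} (ha : S.Compat H δ n a) (hb : S.Compat H δ n' b) :
    S.Compat H δ (n + n') (a * b) := fun i => by
  choose c hc using ha
  choose d hd using hb
  exact ⟨_, lead_D_mul hc hd i⟩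

lemma Compat.const (a : k) : S.Compat H δ 0 (algebraMap k A a) := fun i => by
  rw [Algebra.algebraMap_eq_smul_one, map_smul]
  by_cases hi : i = 0
  · rw [hi, H.D_zero, zero_nsmul, add_zero]
    refine ⟨C a, ?_⟩
    have h1 : S.ν (C a) = a • 1 := by
      rw [← algebraMap_eq, S.ν.commutes, Algebra.algebraMap_eq_smul_one]
    rw [← h1]
    exact S.lead_ν (C a)
  · rw [H.D_one i hi, smul_zero, map_zero]
    exact ⟨0, Lead.zero _⟩

lemma Compat.one : S.Compat H δ 0 (1 : A) := by
  rw [← map_one (algebraMap k A)]; exact Compat.const 1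

lemma Compat.pow {n : Wt m} {a : A} (ha : S.Compat H δ n a) (t : ℕ) :
    S.Compat H δ (t • n) (a ^ t) := by
  induction t with
  | zero => rw [zero_nsmul, pow_zero]; exact Compat.one
  | succ t ih => rw [succ_nsmul, pow_succ]; exact ih.mul ha

lemma Compat.prod {ι : Type} (t : Finset ι) {n : ι → Wt m} {a : ι → A}
    (h : ∀ i ∈ t, S.Compat H δ (n i) (a i)) : S.Compat H δ (∑ i ∈ t, n i) (∏ i ∈ t, a i) := by
  classical
  induction t using Finset.induction_on with
  | empty => exact Compat.one
  | insert i t hi ih =>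
    rw [Finset.sum_insert hi, Finset.prod_insert hi]
    exact (h i (Finset.mem_insert_self _ _)).mul (ih fun j hj => h j (Finset.mem_insert_of_mem hj))

variable (hgen : ∀ g, S.Compat H δ (genWt r g) (S.gen g))
include hgen

lemma compat_ν (c : MvPolynomial (Fin 2) k) : S.Compat H δ 0 (S.ν c) := by
  induction c using MvPolynomial.induction_on with
  | C a => rw [← algebraMap_eq, S.ν.commutes]; exact Compat.const a
  | add p q hp hq => rw [map_add]; exact hp.add hq
  | mul_X p i hp =>
    rw [map_mul, ← add_zero (0 : Wt m)]
    refine hp.mul ?_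
    fin_cases i
    · exact hgen (Sum.inr 1)
    · exact hgen (Sum.inr 2)

lemma compat_mon (s : (Fin m → ℕ) × ℕ) (c : MvPolynomial (Fin 2) k) :
    S.Compat H δ (wt r s) (S.mon s c) := by
  have := ((Compat.prod Finset.univ fun i _ => (hgen (Sum.inl i)).pow (s.1 i)).mul
    ((hgen (Sum.inr 0)).pow s.2)).mul (compat_ν hgen c)
  have e : ∑ i, s.1 i • genWt r (Sum.inl i) + s.2 • genWt r (Sum.inr 0) + 0 = wt r s := by
    change ∑ i, s.1 i • eps m i + s.2 • (-rho r) + 0 = _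
    rw [add_zero, neg_nsmul, ← sub_eq_add_neg]; rfl
  rw [e] at this
  exact this

lemma compat_of_lead (hf : f ≠ 0) {n : Wt m} {c : MvPolynomial (Fin 2) k} {a : A}
    (h : Lead n c (S.ι a)) : S.Compat H δ n a := by
  obtain ⟨u, hu, ha⟩ := S.exists_eq_sum a
  have h1 := (exists_mon hf hu ha h).1
  intro i
  have h2 : ∀ s ∈ u.support, ∃ c', Lead (n + i • δ) c' (S.ι (H.D i (S.mon s (u s)))) := by
    intro s hs
    obtain ⟨c', hc'⟩ := compat_mon hgen s (u s) i
    exact hc'.exists_of_le (add_le_add_left (h1 s hs) _)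
  choose! c' hc' using h2
  refine ⟨∑ s ∈ u.support, c' s, ?_⟩
  rw [ha, Finsupp.sum, map_sum, map_sum]
  exact Lead.sum _ hc'

lemma lead_zero_D (hf : f ≠ 0) {n : Wt m} {a : A}
    (h : Lead n 0 (S.ι a)) (i : ℕ) : Lead (n + i • δ) 0 (S.ι (H.D i a)) := by
  obtain ⟨u, hu, ha⟩ := S.exists_eq_sum a
  have h1 := (exists_mon hf hu ha h).2.1 rfl
  have h2 : ∀ s ∈ u.support, Lead (n + i • δ) 0 (S.ι (H.D i (S.mon s (u s)))) := by
    intro s hs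
    obtain ⟨c', hc'⟩ := compat_mon hgen s (u s) i
    exact hc'.of_lt (add_lt_add_left (h1 s hs) _)
  have := Lead.sum _ h2
  rw [Finset.sum_const_zero] at this
  rw [ha, Finsupp.sum, map_sum, map_sum]
  exact this

end Setup

end

section

/-- The divided derivatives of a polynomial ring with respect to one of the variables. -/
lemma exists_hasseFamily {k A : Type} [Field k] [CommRing A] [Algebra k A]
    {σ : Type} [DecidableEq σ] (e : A ≃ₐ[k] MvPolynomial σ k)
    {i j : σ} (hij : j ≠ i) :
    ∃ H : HasseFamily k A, H.D 1 (e.symm (X i)) ≠ 0 ∧ ∀ l, l ≠ 0 → H.D l (e.symm (X j)) = 0 := by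
  let τ := (Equiv.optionSubtypeNe i).symm
  let ψ := e.trans ((renameEquiv k τ).trans (optionEquivLeft k {a // a ≠ i}))
  have hi : ψ (e.symm (X i)) = Polynomial.X := by
    simp [ψ, τ, optionEquivLeft_X_none]
  have hj : ψ (e.symm (X j)) = Polynomial.C (X ⟨j, hij⟩) := by
    simp [ψ, τ, Equiv.optionSubtypeNe_symm_of_ne hij, optionEquivLeft_X_some]
  refine ⟨HasseFamily.ofEquiv ψ, ?_, fun l hl => ?_⟩
  · change ψ.symm (Polynomial.hasseDeriv 1 (ψ (e.symm (X i)))) ≠ 0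
    rw [hi, Polynomial.hasseDeriv_one, Polynomial.derivative_X, map_one]
    intro h
    have := congrArg e h
    rw [map_one, map_zero] at this
    exact one_ne_zero this
  · change ψ.symm (Polynomial.hasseDeriv l (ψ (e.symm (X j)))) = 0
    rw [hj, Polynomial.hasseDeriv_C _ _ (Nat.pos_of_ne_zero hl), map_zero]

namespace Setup
variable {k : Type} [Field k] {m : ℕ} {r : Fin m → ℕ} {A : Type} [CommRing A] [Algebra k A]
  {f : MvPolynomial (Fin 2) k} (S : Setup k r A f) (H : HasseFamily k A) (δ : Wt m)

/-- The polynomial collecting the lowest terms of the derivatives of an element. -/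
def Rel (n : Wt m) (c : MvPolynomial (Fin 2) k) (P : Polynomial (MvPolynomial (Fin 2) k)) : Prop :=
  ∃ a, Lead n c (S.ι a) ∧ ∀ i, P.coeff i = (S.ι (H.D i a)).coeff (n + i • δ)

open Classical in
/-- The graded exponential map, on homogeneous elements. -/
def expE (n : Wt m) (c : MvPolynomial (Fin 2) k) : Polynomial (MvPolynomial (Fin 2) k) :=
  if h : ∃ P, S.Rel H δ n c P then h.choose else 0

/-- The lowest coefficients in degree `n`. -/
def leadGroup (n : Wt m) : AddSubgroup (MvPolynomial (Fin 2) k) where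
  carrier := {c | ∃ a, Lead n c (S.ι a)}
  zero_mem' := ⟨0, by rw [map_zero]; exact Lead.zero n⟩
  add_mem' := fun ⟨a, ha⟩ ⟨b, hb⟩ => ⟨a + b, by rw [map_add]; exact ha.add hb⟩
  neg_mem' := fun ⟨a, ha⟩ => ⟨-a, by rw [map_neg]; exact ha.neg⟩

variable {S H δ} (hgen : ∀ g, S.Compat H δ (genWt r g) (S.gen g)) (hf : f ≠ 0)
include hgen hf

lemma Rel.unique {n : Wt m} {c : MvPolynomial (Fin 2) k}
    {P Q : Polynomial (MvPolynomial (Fin 2) k)} (hP : S.Rel H δ n c P) (hQ : S.Rel H δ n c Q) :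
    P = Q := by
  obtain ⟨a, ha, hP⟩ := hP
  obtain ⟨b, hb, hQ⟩ := hQ
  ext1 i
  have h0 : Lead n 0 (S.ι (a - b)) := by
    have := ha.add hb.neg
    rwa [add_neg_cancel, ← sub_eq_add_neg, ← map_sub] at this
  have := (lead_zero_D hgen hf h0 i).2
  rw [map_sub, map_sub, AddMonoidAlgebra.coeff_sub, Finsupp.sub_apply, sub_eq_zero] at this
  rw [hP, hQ, this]

lemma coeff_expE {n : Wt m} {c : MvPolynomial (Fin 2) k} {a : A} (h : Lead n c (S.ι a)) (i : ℕ) :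
    (S.expE H δ n c).coeff i = (S.ι (H.D i a)).coeff (n + i • δ) := by
  have hex : ∃ P, S.Rel H δ n c P ∧ ∀ i, P.coeff i = (S.ι (H.D i a)).coeff (n + i • δ) := by
    obtain ⟨B, hB⟩ := H.bound a
    have : ∀ i, (∑ l ∈ Finset.range (B + 1), Polynomial.monomial l
        ((S.ι (H.D l a)).coeff (n + l • δ))).coeff i = (S.ι (H.D i a)).coeff (n + i • δ) := by
      intro i
      rw [Polynomial.finsetSum_coeff]
      simp only [Polynomial.coeff_monomial]
      rw [Finset.sum_ite_eq']
      split_ifs with hi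
      · rfl
      · rw [hB i (by simpa using hi), map_zero]; rfl
    exact ⟨_, ⟨a, h, this⟩, this⟩
  obtain ⟨P, hP, hP'⟩ := hex
  have hex' : ∃ P, S.Rel H δ n c P := ⟨P, hP⟩
  rw [expE, dif_pos hex', Rel.unique hgen hf hex'.choose_spec hP, hP']

lemma lead_D {n : Wt m} {c : MvPolynomial (Fin 2) k} {a : A} (h : Lead n c (S.ι a)) (i : ℕ) :
    Lead (n + i • δ) ((S.expE H δ n c).coeff i) (S.ι (H.D i a)) := by
  obtain ⟨c', hc'⟩ := compat_of_lead hgen hf h i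
  rw [coeff_expE hgen hf h, hc'.2]
  exact hc'

/-- The graded exponential map induced by a locally finite iterative higher derivation. -/
def gexp : GExp (MvPolynomial (Fin 2) k) (Wt m) where
  δ := δ
  M := S.leadGroup
  E := S.expE H δ
  mem_zero c := ⟨S.ν c, S.lead_ν c⟩
  E_one := by
    ext1 i
    have h1 : Lead 0 1 (S.ι 1) := by rw [map_one]; exact Lead.one
    rw [coeff_expE hgen hf h1]
    rcases eq_or_ne i 0 with rfl | hi
    · rw [H.D_zero, zero_nsmul, add_zero, h1.2, Polynomial.coeff_one_zero]
    · rw [H.D_one i hi, map_zero, Polynomial.coeff_one, if_neg hi]; rfl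
  E_add := by
    rintro n c c' ⟨a, ha⟩ ⟨b, hb⟩
    ext1 i
    have hab : Lead n (c + c') (S.ι (a + b)) := by rw [map_add]; exact ha.add hb
    rw [Polynomial.coeff_add, coeff_expE hgen hf ha, coeff_expE hgen hf hb,
      coeff_expE hgen hf hab, map_add (H.D i), map_add S.ι]
    rfl
  mul_mem := by
    rintro n n' c c' ⟨a, ha⟩ ⟨b, hb⟩
    exact ⟨a * b, by rw [map_mul]; exact ha.mul hb⟩
  E_mul := by
    rintro n n' c c' ⟨a, ha⟩ ⟨b, hb⟩
    ext1 i
    have hab : Lead (n + n') (c * c') (S.ι (a * b)) := by rw [map_mul]; exact ha.mul hb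
    rw [Polynomial.coeff_mul, coeff_expE hgen hf hab,
      (lead_D_mul (lead_D hgen hf ha) (lead_D hgen hf hb) i).2]
  coeff_zero := by
    rintro n c ⟨a, ha⟩
    rw [coeff_expE hgen hf ha, H.D_zero, zero_nsmul, add_zero, ha.2]
  coeff_mem := by
    rintro n c ⟨a, ha⟩ i
    exact ⟨H.D i a, lead_D hgen hf ha i⟩
  coeff_coeff := by
    rintro n c ⟨a, ha⟩ i j
    rw [coeff_expE hgen hf (lead_D hgen hf ha i), H.D_comp, map_nsmul, coeff_expE hgen hf ha,
      add_nsmul, add_assoc, ← nsmul_eq_mul]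
    rfl

lemma inv_of_D_eq_zero {n : Wt m} {c : MvPolynomial (Fin 2) k} {a : A} (h : Lead n c (S.ι a))
    (ha : ∀ i, i ≠ 0 → H.D i a = 0) : (gexp hgen hf).Inv n c := by
  refine ⟨⟨a, h⟩, ?_⟩
  ext1 i
  change (S.expE H δ n c).coeff i = _
  rw [coeff_expE hgen hf h]
  rcases eq_or_ne i 0 with rfl | hi
  · rw [H.D_zero, zero_nsmul, add_zero, h.2, Polynomial.coeff_C_zero]
  · rw [ha i hi, map_zero, Polynomial.coeff_C, if_neg hi]; rfl

omit hgen hf in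
/-- A nontrivial locally finite iterative higher derivation killing an element with negative
lowest weight yields slice data. -/
lemma exists_sliceData (hm : 0 < m) (hr : ∀ i, 1 < r i) (hf : f ≠ 0)
    (hH : ∃ a, ∃ i, i ≠ 0 ∧ H.D i a ≠ 0) {v : A} (hv : ∀ i, i ≠ 0 → H.D i v = 0)
    {n : Wt m} {c : MvPolynomial (Fin 2) k} (hc : c ≠ 0) (hl : Lead n c (S.ι v))
    (hn : crd m ⟨0, hm⟩ n < 0) : Nonempty (SliceData k f) := by
  obtain ⟨δ, hgen, g, i, hi, hne⟩ := S.exists_delta H hm hf hH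
  have hx : ∀ i, (1 : MvPolynomial (Fin 2) k) ∈ (gexp hgen hf).M (eps m i) :=
    fun i => ⟨_, S.lead_x i⟩
  have hxs : ∀ b : Fin m → ℕ, (1 : MvPolynomial (Fin 2) k) ∈
      (gexp hgen hf).M (∑ i, b i • eps m i) := fun b =>
    ⟨∏ i, S.x i ^ b i, by
      rw [map_prod]
      have := Lead.prod Finset.univ fun i _ => (S.lead_x i).pow (b i)
      simp only [one_pow, Finset.prod_const_one] at this
      simpa only [map_pow] using this⟩
  have hfM : f ∈ (gexp hgen hf).M (-rho r) := ⟨_, S.lead_y⟩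
  refine GExp.exists_sliceData (D := gexp hgen hf) (r := r) (e := eps m) (x := crd m) ?_ hr
    (fun i j => crd_eps i j) hx hf ?_ ?_ ?_
  · intro a
    refine inv_of_D_eq_zero hgen hf (S.lead_ν _) fun i hi => ?_
    rw [S.ν.commutes, Algebra.algebraMap_eq_smul_one, map_smul, H.D_one i hi, smul_zero]
  · have hinv := inv_of_D_eq_zero hgen hf hl hv
    obtain ⟨u, hu, hv'⟩ := S.exists_eq_sum v
    obtain ⟨s, -, hs, hcs⟩ := (exists_mon hf hu hv' hl).2.2 hc
    obtain ⟨j, hj⟩ : ∃ j, s.2 = j + 1 := by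
      refine Nat.exists_eq_succ_of_ne_zero fun h0 => ?_
      rw [← hs, crd_wt, h0, Nat.cast_zero, zero_mul, sub_zero] at hn
      exact absurd hn (not_lt.2 (Nat.cast_nonneg _))
    have hM : f ^ j * u s ∈ (gexp hgen hf).M (wt r (s.1, j)) := ⟨_, S.lead_mon (s.1, j) (u s)⟩
    have hn' : n = wt r (s.1, j) + -rho r := by
      rw [← hs, wt, wt, hj, succ_nsmul]; abel
    have hcc : c = (f ^ j * u s) * f := by rw [hcs, hj, pow_succ]; ring
    have hu0 : f ^ j * u s ≠ 0 := fun h0 => hc (by rw [hcc, h0, zero_mul])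
    rw [hn', hcc] at hinv
    exact (GExp.Inv.of_mul hM hfM hu0 hf hinv).2
  · rintro n c ⟨a, ha⟩ hc
    exact exists_of_lead hf ha hc
  · obtain ⟨c, hc⟩ := S.exists_lead_gen g
    refine ⟨genWt r g, c, ⟨_, hc⟩, Nat.pos_of_ne_zero fun h0 => hne ?_⟩
    rw [← coeff_expE hgen hf hc]
    exact Polynomial.coeff_eq_zero_of_natDegree_lt (by
      have : (S.expE H δ (genWt r g) c).natDegree = 0 := h0
      omega)

end Setup

namespace Setup
variable {k : Type} [Field k] {m : ℕ} {r : Fin m → ℕ} {A : Type} [CommRing A] [Algebra k A]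
  {f : MvPolynomial (Fin 2) k} (S : Setup k r A f)

include S in
/-- A polynomial ring in at least two variables with a `Setup` has slice data. -/
theorem nonempty_sliceData (hm : 0 < m) (hr : ∀ i, 1 < r i) (hf : f ≠ 0)
    (e : A ≃ₐ[k] MvPolynomial (Fin (m + 2)) k) : Nonempty (SliceData k f) := by
  have key : ∃ j, ∃ γ, (S.ι (e.symm (X j))).coeff γ ≠ 0 ∧ crd m ⟨0, hm⟩ γ < 0 := by
    by_contra hcon
    push Not at hcon
    let K : Subalgebra k A :=
      { carrier := {a | ∀ γ, (S.ι a).coeff γ ≠ 0 → 0 ≤ crd m ⟨0, hm⟩ γ}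
        add_mem' := fun {a b} ha hb γ hγ => by
          rw [map_add, AddMonoidAlgebra.coeff_add, Finsupp.add_apply] at hγ
          by_cases h : (S.ι a).coeff γ = 0
          · rw [h, zero_add] at hγ; exact hb γ hγ
          · exact ha γ h
        mul_mem' := fun {a b} ha hb γ hγ => by
          classical
          rw [map_mul] at hγ
          obtain ⟨x, hx, y, hy, rfl⟩ := Finset.mem_add.1 (
            AddMonoidAlgebra.support_coeff_mul_subset _ _
            (Finsupp.mem_support_iff.2 hγ))
          rw [map_add]
          exact add_nonneg (ha x (Finsupp.mem_support_iff.1 hx))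
            (hb y (Finsupp.mem_support_iff.1 hy))
        algebraMap_mem' := fun a γ hγ => by
          rw [← S.ν.commutes, S.ι_ν, AddMonoidAlgebra.coeff_single, Finsupp.single_apply] at hγ
          split_ifs at hγ with h
          · rw [← h, map_zero]
          · exact absurd rfl hγ }
    have hK : ∀ p, e.symm p ∈ K := by
      intro p
      induction p using MvPolynomial.induction_on with
      | C a => rw [← algebraMap_eq, e.symm.commutes]; exact Subalgebra.algebraMap_mem _ _
      | add p q hp hq => rw [map_add]; exact add_mem hp hq
      | mul_X p i hp => rw [map_mul]; exact mul_mem hp (hcon i)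
    have hy : S.y ∈ K := by simpa using hK (e S.y)
    have := hy (-rho r) (by rw [S.lead_y.2]; exact hf)
    have h0 := crd_wt r (fun _ => 0, 1) ⟨0, hm⟩
    simp only [wt, zero_nsmul, Finset.sum_const_zero, one_nsmul, zero_sub, Nat.cast_zero,
      Nat.cast_one, one_mul] at h0
    rw [h0] at this
    have h1 : (0 : ℚ) < r ⟨0, hm⟩ := by exact_mod_cast (zero_lt_one.trans (hr _))
    linarith
  obtain ⟨j, γ, hγ, hneg⟩ := key
  have hne : (S.ι (e.symm (X j))).coeff.support.Nonempty := ⟨γ, Finsupp.mem_support_iff.2 hγ⟩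
  obtain ⟨i, hij⟩ := exists_ne j
  obtain ⟨H, h1, h2⟩ := exists_hasseFamily e hij.symm
  refine exists_sliceData (S := S) (H := H) hm hr hf ⟨_, 1, one_ne_zero, h1⟩ h2
    (n := (S.ι (e.symm (X j))).coeff.support.min' hne)
    (Finsupp.mem_support_iff.1 (Finset.min'_mem _ hne)) ⟨fun γ' hγ' => ?_, rfl⟩ ?_
  · by_contra h
    exact absurd (Finset.min'_le _ _ (Finsupp.mem_support_iff.2 h)) (not_le.2 hγ')
  · have hle : (S.ι (e.symm (X j))).coeff.support.min' hne ≤ γ :=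
      Finset.min'_le _ _ (Finsupp.mem_support_iff.2 hγ)
    refine lt_of_le_of_lt ?_ hneg
    exact Pi.apply_le_of_toLex (i := (⟨0, hm⟩ : Fin m)) hle
      fun j hj => absurd (Fin.lt_def.1 hj) (Nat.not_lt_zero _)

end Setup

end

section

lemma exists_eq_single_of_mul_eq_single {N Γ : Type} [CommRing N] [IsDomain N] [AddCommGroup Γ]
    [TwoUniqueSums Γ] {a b : AddMonoidAlgebra N Γ} {n : Γ}
    (h : a * b = AddMonoidAlgebra.single n 1) : ∃ n₁ n₂ c₁ c₂,
      a = AddMonoidAlgebra.single n₁ c₁ ∧ b = AddMonoidAlgebra.single n₂ c₂ ∧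
      n₁ + n₂ = n ∧ c₁ * c₂ = 1 := by
  classical
  have ha : a ≠ 0 := by
    rintro rfl
    have := congrArg (fun u => u.coeff n) h
    rw [zero_mul] at this
    simp at this
  have hb : b ≠ 0 := by
    rintro rfl
    have := congrArg (fun u => u.coeff n) h
    rw [mul_zero] at this
    simp at this
  have hcard : ∀ u : AddMonoidAlgebra N Γ, u ≠ 0 → 0 < u.coeff.support.card := by
    intro u hu
    rw [Finset.card_pos, Finsupp.support_nonempty_iff]
    exact fun h0 => hu (AddMonoidAlgebra.ext h0)
  have hle : a.coeff.support.card * b.coeff.support.card ≤ 1 := by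
    by_contra hlt
    push Not at hlt
    obtain ⟨p, hp, q, hq, hne, hup, huq⟩ := TwoUniqueSums.uniqueAdd_of_one_lt_card hlt
    rw [Finset.mem_product, Finsupp.mem_support_iff, Finsupp.mem_support_iff] at hp hq
    have key : ∀ p : Γ × Γ, a.coeff p.1 ≠ 0 → b.coeff p.2 ≠ 0 →
        UniqueAdd a.coeff.support b.coeff.support p.1 p.2 → p.1 + p.2 = n := by
      intro p h1 h2 hu
      by_contra hpn
      have := AddMonoidAlgebra.coeff_mul_add_of_uniqueAdd hu
      rw [h, AddMonoidAlgebra.coeff_single, Finsupp.single_apply, if_neg (Ne.symm hpn)] at this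
      exact mul_ne_zero h1 h2 this.symm
    have h1 := key p hp.1 hp.2 hup
    have h2 := key q hq.1 hq.2 huq
    have := hup (Finsupp.mem_support_iff.2 hq.1) (Finsupp.mem_support_iff.2 hq.2) (h2.trans h1.symm)
    exact hne (Prod.ext this.1.symm this.2.symm)
  have ha1 := hcard a ha
  have hb1 := hcard b hb
  obtain ⟨h1, h2⟩ := mul_eq_one.1 (le_antisymm hle (Nat.mul_pos ha1 hb1))
  obtain ⟨n₁, -, e₁⟩ := Finsupp.card_support_eq_one.1 h1
  obtain ⟨n₂, -, e₂⟩ := Finsupp.card_support_eq_one.1 h2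
  have e₁' : a = AddMonoidAlgebra.single n₁ (a.coeff n₁) := AddMonoidAlgebra.ext e₁
  have e₂' : b = AddMonoidAlgebra.single n₂ (b.coeff n₂) := AddMonoidAlgebra.ext e₂
  have hs := h
  rw [e₁', e₂', AddMonoidAlgebra.single_mul_single] at hs
  have hc := congrArg (fun u => u.coeff n) hs
  simp only [AddMonoidAlgebra.coeff_single, Finsupp.single_apply, if_true] at hc
  split_ifs at hc with hn
  · exact ⟨n₁, n₂, _, _, e₁', e₂', hn, hc⟩
  · exact absurd hc zero_ne_one

namespace Setup
variable {k : Type} [Field k] {m : ℕ} {r : Fin m → ℕ} {A : Type} [CommRing A] [Algebra k A]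
  {f : MvPolynomial (Fin 2) k} (S : Setup k r A f)

include S in
/-- If a ring with a `Setup` is a polynomial ring, then `f` is prime. -/
theorem prime_f (hm : 0 < m) (hr : ∀ i, 0 < r i) (hf : f ≠ 0) {σ : Type}
    (e : A ≃ₐ[k] MvPolynomial σ k) : Prime f := by
  have : IsDomain A := e.toMulEquiv.isDomain _
  have : UniqueFactorizationMonoid A :=
    e.symm.toMulEquiv.uniqueFactorizationMonoid inferInstance
  have hunit : ∀ a : A, IsUnit a → ∃ u : k, a = algebraMap k A u := by
    intro a ha
    obtain ⟨u, -, hu⟩ := isUnit_iff_eq_C_of_isReduced.1 (ha.map e)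
    exact ⟨u, e.injective (by rw [hu, e.commutes]; rfl)⟩
  let i₀ : Fin m := ⟨0, hm⟩
  have hxν : S.x i₀ ∣ S.ν f := by
    have h1 := (Finset.dvd_prod_of_mem S.x (Finset.mem_univ i₀)).trans S.dvd_rel
    have h2 : S.x i₀ ∣ (∏ i, S.x i ^ r i) * S.y := Dvd.dvd.mul_right
      ((dvd_pow_self _ (hr i₀).ne').trans
        (Finset.dvd_prod_of_mem (fun i => S.x i ^ r i) (Finset.mem_univ i₀))) _
    exact (dvd_sub_right h2).1 h1
  have hxu : ¬ IsUnit (S.x i₀) := by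
    intro h
    obtain ⟨u, hu⟩ := hunit _ h
    have h1 := congrArg (fun v => (S.ι v).coeff (eps m i₀)) hu
    have h2 : (0 : Wt m) ≠ eps m i₀ := by
      intro h
      have := congrArg (crd m i₀) h
      rw [map_zero, crd_eps, if_pos rfl] at this
      exact zero_ne_one this
    simp only [S.ι_x, ← S.ν.commutes, S.ι_ν, AddMonoidAlgebra.coeff_single, Finsupp.single_apply, if_true,
      if_neg h2] at h1
    exact one_ne_zero h1
  have hfu : ¬ IsUnit f := fun h => hxu (isUnit_of_dvd_unit hxν (h.map S.ν))
  have hirr : Irreducible (S.x i₀) := by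
    refine ⟨hxu, fun a b hab => ?_⟩
    have h1 : S.ι a * S.ι b = AddMonoidAlgebra.single (eps m i₀) 1 := by
      rw [← map_mul, ← hab, S.ι_x]
    obtain ⟨n₁, n₂, c₁, c₂, ha, hb, hn, hc⟩ := exists_eq_single_of_mul_eq_single h1
    have key : ∀ a n c, IsUnit c → S.ι a = AddMonoidAlgebra.single n c →
        (n = 0 → IsUnit a) ∧ ∃ b : Fin m → ℕ, ∀ i, crd m i n = b i := by
      intro a n c hcu h
      constructor
      · rintro rfl
        obtain ⟨u, hu0, hu⟩ := isUnit_iff_eq_C_of_isReduced.1 hcu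
        have : a = algebraMap k A u := by
          apply S.ι_injective hm hf
          rw [h, ← S.ν.commutes, S.ι_ν, hu]; rfl
        rw [this]
        exact hu0.map (algebraMap k A)
      · have hl : Lead n c (S.ι a) := h ▸ Lead.single n c
        obtain ⟨b, j, c', hn, hcc⟩ := exists_of_lead hf hl hcu.ne_zero
        have hj : j = 0 := by
          by_contra hj
          exact hfu (isUnit_of_dvd_unit ((dvd_pow_self f hj).trans ⟨c', hcc⟩) hcu)
        refine ⟨b, fun i => ?_⟩
        have := crd_wt r (b, j) i
        rw [wt, rho, ← hn] at this
        rw [this, hj]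
        simp
    obtain ⟨hz₁, b₁, hb₁⟩ := key a n₁ c₁ (IsUnit.of_mul_eq_one _ hc) ha
    obtain ⟨hz₂, b₂, hb₂⟩ := key b n₂ c₂ (IsUnit.of_mul_eq_one _ (by rw [mul_comm]; exact hc)) hb
    have hsum : ∀ i, b₁ i + b₂ i = if i = i₀ then 1 else 0 := by
      intro i
      have := congrArg (crd m i) hn
      rw [map_add, hb₁, hb₂, crd_eps] at this
      split_ifs at this ⊢ <;> exact_mod_cast this
    by_cases h0 : b₁ i₀ = 0
    · left
      refine hz₁ (wt_ext fun i => ?_)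
      rw [hb₁, map_zero]
      have := hsum i
      split_ifs at this with hi
      · rw [hi, h0, Nat.cast_zero]
      · rw [show b₁ i = 0 by omega, Nat.cast_zero]
    · right
      refine hz₂ (wt_ext fun i => ?_)
      rw [hb₂, map_zero]
      have h2 := hsum i
      split_ifs at h2 with hi
      · subst hi; rw [show b₂ i₀ = 0 by omega, Nat.cast_zero]
      · rw [show b₂ i = 0 by omega, Nat.cast_zero]
  have hprime := hirr.prime
  have hdvd : ∀ a, S.x i₀ ∣ S.ν a → f ∣ a := by
    rintro a ⟨w, hw⟩
    rcases eq_or_ne a 0 with rfl | ha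
    · exact dvd_zero f
    have h1 := congrArg S.ι hw
    rw [map_mul, S.ι_ν, S.ι_x] at h1
    have h2 : S.ι w = AddMonoidAlgebra.single (-eps m i₀) a := by
      have := congrArg (fun u => AddMonoidAlgebra.single (-eps m i₀) 1 * u) h1
      simp only [← mul_assoc, AddMonoidAlgebra.single_mul_single, neg_add_cancel, one_mul,
        add_zero] at this
      rw [this, ← AddMonoidAlgebra.one_def, one_mul]
    have hl : Lead (-eps m i₀) a (S.ι w) := h2 ▸ Lead.single _ _
    obtain ⟨b, j, c', hn, hcc⟩ := exists_of_lead hf hl ha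
    have hj : j ≠ 0 := by
      rintro rfl
      have := crd_wt r (b, 0) i₀
      rw [wt, rho, ← hn, map_neg, crd_eps, if_pos rfl] at this
      have h0 : (0 : ℚ) ≤ b i₀ := Nat.cast_nonneg _
      simp only [Nat.cast_zero, zero_mul, sub_zero] at this
      linarith
    exact (dvd_pow_self f hj).trans ⟨c', hcc⟩
  refine ⟨hf, hfu, fun a b hab => ?_⟩
  have := hxν.trans (map_dvd S.ν hab)
  rw [map_mul] at this
  exact (hprime.dvd_or_dvd this).imp (hdvd a) (hdvd b)

end Setup

end

section

namespace SliceData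
variable {k : Type} [Field k] {f : MvPolynomial (Fin 2) k} (S : SliceData k f)

lemma constantCoeff_aeval_eq_eval {k : Type} [CommRing k] (c : MvPolynomial (Fin 2) k) (q : Polynomial k) :
    constantCoeff (Polynomial.aeval c q) = q.eval (constantCoeff c) := by
  rw [Polynomial.aeval_def, Polynomial.hom_eval₂]
  have : (constantCoeff.comp (algebraMap k (MvPolynomial (Fin 2) k))) = RingHom.id k := by
    ext; simp
  rw [this]; rfl

lemma exists_mem_C : ∃ h ∈ S.C, h ≠ 0 ∧ constantCoeff h = 0 := by
  by_contra hcon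
  push Not at hcon
  have hC : ∀ c ∈ S.C, c = MvPolynomial.C (constantCoeff c) := by
    intro c hc
    by_contra hne
    exact hcon (c - MvPolynomial.C (constantCoeff c)) (sub_mem hc (Subalgebra.algebraMap_mem S.C _))
      (sub_ne_zero.2 hne) (by simp)
  have hsurj : Function.Surjective (aeval (R := k) (fun _ : Unit => S.s)) := by
    intro b
    obtain ⟨c, hc, hc0, P, hP, hcb⟩ := S.exists_eval b
    set u := constantCoeff c with hu
    have hcu : c = MvPolynomial.C u := hC c hc
    have hu0 : u ≠ 0 := fun h => hc0 (by rw [hcu, h, map_zero])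
    refine ⟨MvPolynomial.C u⁻¹ * ∑ l ∈ Finset.range (P.natDegree + 1), MvPolynomial.C (constantCoeff (P.coeff l)) *
      X () ^ l, ?_⟩
    have h2 : P.eval S.s = ∑ l ∈ Finset.range (P.natDegree + 1),
        MvPolynomial.C (constantCoeff (P.coeff l)) * S.s ^ l := by
      rw [Polynomial.eval_eq_sum_range]
      exact Finset.sum_congr rfl fun l _ => by rw [← hC _ (hP l)]
    simp only [map_mul, map_sum, map_pow, aeval_C, aeval_X, algebraMap_eq]
    rw [← h2, ← hcb, hcu, ← mul_assoc, ← C_mul, inv_mul_cancel₀ hu0, C_1, one_mul]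
  have := trdeg_le_of_surjective _ hsurj
  rw [trdeg_of_isDomain, trdeg_of_isDomain] at this
  simp at this

lemma not_algebraicIndependent {h c : MvPolynomial (Fin 2) k} (hh : h ∈ S.C) (hc : c ∈ S.C) :
    ¬ AlgebraicIndependent k ![h, c] := by
  intro hind
  have hle : Algebra.adjoin k (Set.range ![h, c]) ≤ S.C := by
    rw [Algebra.adjoin_le_iff]
    rintro _ ⟨i, rfl⟩
    fin_cases i
    · exact hh
    · exact hc
  have htr : Transcendental (Algebra.adjoin k (Set.range ![h, c])) S.s := by
    rw [transcendental_iff]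
    intro p hp
    have h1 := S.eq_zero_of_eval (p.map (Algebra.adjoin k (Set.range ![h, c])).subtype)
      (fun l => by rw [Polynomial.coeff_map]; exact hle (p.coeff l).2)
      (by rw [Polynomial.eval_map]; exact hp)
    exact (Polynomial.map_eq_zero_iff Subtype.val_injective).1 h1
  have := (AlgebraicIndependent.option_iff.2 ⟨hind, htr⟩).cardinalMk_le_trdeg
  rw [trdeg_of_isDomain] at this
  simp at this
  exact absurd this (by norm_num)

/-- The ring of constants is generated by one polynomial. -/
lemma exists_C_eq : ∃ h, Transcendental k h ∧ S.C = Algebra.adjoin k {h} := by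
  classical
  have hex : ∃ n, ∃ h ∈ S.C, h ≠ 0 ∧ constantCoeff h = 0 ∧ h.totalDegree = n := by
    obtain ⟨h, h1, h2, h3⟩ := S.exists_mem_C
    exact ⟨_, h, h1, h2, h3, rfl⟩
  obtain ⟨h, hC, h0, hconst, hdeg⟩ := Nat.find_spec hex
  have hmin : ∀ a ∈ S.C, a ≠ 0 → constantCoeff a = 0 → h.totalDegree ≤ a.totalDegree := by
    intro a ha ha0 hac
    rw [hdeg]
    exact Nat.find_min' hex ⟨a, ha, ha0, hac, rfl⟩
  have hpos : ∀ a : MvPolynomial (Fin 2) k, a ≠ 0 → constantCoeff a = 0 → 0 < a.totalDegree := by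
    intro a ha hac
    refine Nat.pos_of_ne_zero fun h => ha ?_
    rw [totalDegree_eq_zero_iff_eq_C.1 h] at hac ⊢
    rw [constantCoeff_C] at hac
    rw [hac, map_zero]
  have hirr : Irreducible h := by
    have hnu : ¬ IsUnit h := by
      intro hu
      have := hu.map constantCoeff
      rw [hconst] at this
      exact not_isUnit_zero this
    have key : ∀ a b, h = a * b → constantCoeff a = 0 → IsUnit b := by
      intro a b hab hac
      have hab0 : a * b ≠ 0 := hab ▸ h0
      have ha := S.mem_of_mul a b (hab ▸ hC) hab0
      have ha0 := left_ne_zero_of_mul hab0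
      have hb0 := right_ne_zero_of_mul hab0
      have h1 := hmin a ha ha0 hac
      rw [hab, totalDegree_mul_of_isDomain ha0 hb0] at h1
      have h2 := totalDegree_eq_zero_iff_eq_C.1 (show b.totalDegree = 0 by omega)
      rw [h2]
      refine IsUnit.map MvPolynomial.C (Ne.isUnit fun h3 => hb0 ?_)
      rw [h2, h3, map_zero]
    refine ⟨hnu, fun a b hab => ?_⟩
    have h1 := hconst
    rw [hab, map_mul, mul_eq_zero] at h1
    rcases h1 with h1 | h1
    · exact Or.inr (key a b hab h1)
    · exact Or.inl (key b a (hab.trans (mul_comm _ _)) h1)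
  have hprime := hirr.prime
  have hdvd : ∀ c ∈ S.C, constantCoeff c = 0 → h ∣ c := by
    intro c hc hcc
    have hnind : ¬ Function.Injective (ev (R := k) c h) := by
      intro hinj
      refine S.not_algebraicIndependent hc hC ?_
      rw [algebraicIndependent_iff_injective_aeval, injective_iff_map_eq_zero]
      intro P hP
      obtain ⟨Q, rfl⟩ := (Polynomial.Bivariate.equivMvPolynomial k).surjective P
      rw [← ev_eq_aeval] at hP
      rw [hinj (hP.trans (map_zero _).symm), map_zero]
    rw [injective_iff_map_eq_zero] at hnind
    push Not at hnind
    obtain ⟨Q, hQ, hQ0⟩ := hnind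
    obtain ⟨Q₁, hQ₁, hnd⟩ := Polynomial.exists_eq_pow_rootMultiplicity_mul_and_not_dvd Q hQ0 0
    rw [map_zero, sub_zero] at hQ₁ hnd
    rw [hQ₁, map_mul, map_pow, ev_X] at hQ
    have hQ₁0 := (mul_eq_zero.1 hQ).resolve_left (pow_ne_zero _ h0)
    rw [Polynomial.X_dvd_iff] at hnd
    have hq : h ∣ Polynomial.aeval c (Q₁.coeff 0) := by
      rw [← Polynomial.divX_mul_X_add Q₁, map_add, map_mul, ev_X, ev_C] at hQ₁0
      exact ⟨-ev c h Q₁.divX, by linear_combination hQ₁0⟩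
    obtain ⟨q, hqe, hqd⟩ := Polynomial.exists_eq_pow_rootMultiplicity_mul_and_not_dvd
      (Q₁.coeff 0) hnd 0
    rw [map_zero, sub_zero] at hqe hqd
    rw [hqe, map_mul, map_pow, Polynomial.aeval_X] at hq
    rcases hprime.dvd_or_dvd hq with h1 | h1
    · exact hprime.dvd_of_dvd_pow h1
    · exfalso
      obtain ⟨w, hw⟩ := h1
      have h2 := congrArg constantCoeff hw
      rw [map_mul, hconst, zero_mul] at h2
      rw [constantCoeff_aeval_eq_eval, hcc, ← Polynomial.coeff_zero_eq_eval_zero] at h2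
      exact hqd (Polynomial.X_dvd_iff.2 h2)
  refine ⟨h, ?_, le_antisymm ?_ ?_⟩
  · rw [transcendental_iff]
    intro P hP
    by_contra hP0
    obtain ⟨q, hqe, hqd⟩ := Polynomial.exists_eq_pow_rootMultiplicity_mul_and_not_dvd P hP0 0
    rw [map_zero, sub_zero] at hqe hqd
    rw [hqe, map_mul, map_pow, Polynomial.aeval_X] at hP
    have h1 := congrArg constantCoeff ((mul_eq_zero.1 hP).resolve_left (pow_ne_zero _ h0))
    rw [map_zero, constantCoeff_aeval_eq_eval h q, hconst,
      ← Polynomial.coeff_zero_eq_eval_zero] at h1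
    exact hqd (Polynomial.X_dvd_iff.2 h1)
  · have key : ∀ n, ∀ c ∈ S.C, c.totalDegree ≤ n → c ∈ Algebra.adjoin k {h} := by
      intro n
      induction n with
      | zero =>
        intro c _ hn
        rw [totalDegree_eq_zero_iff_eq_C.1 (Nat.le_zero.1 hn)]
        exact Subalgebra.algebraMap_mem _ _
      | succ n ih =>
        intro c hc hn
        have hc' : c - MvPolynomial.C (constantCoeff c) ∈ S.C :=
          sub_mem hc (Subalgebra.algebraMap_mem S.C _)
        obtain ⟨d, hd⟩ := hdvd _ hc' (by simp)
        have hcd : c = h * d + MvPolynomial.C (constantCoeff c) := by rw [← hd]; ring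
        rw [hcd]
        refine add_mem (mul_mem (Algebra.self_mem_adjoin_singleton k h) ?_)
          (Subalgebra.algebraMap_mem _ _)
        rcases eq_or_ne d 0 with rfl | hd0
        · exact zero_mem _
        refine ih d (S.mem_of_mul d h ?_ (mul_ne_zero hd0 h0)) ?_
        · rw [mul_comm, ← hd]; exact hc'
        · have h1 := totalDegree_mul_of_isDomain h0 hd0
          have h2 := totalDegree_sub_C_le c (constantCoeff c)
          rw [hd] at h2
          have := hpos h h0 hconst
          omega
    exact fun c hc => key _ c hc le_rfl
  · rw [Algebra.adjoin_le_iff, Set.singleton_subset_iff]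
    exact hC

end SliceData

end

section

section Functional
variable {k K σ τ : Type} [Field k] [Field K] [Algebra k K] (l : K →ₗ[k] k)

/-- Application of a linear functional to all coefficients of a polynomial. -/
def mvFunctional (p : MvPolynomial σ K) : MvPolynomial σ k :=
  ∑ n ∈ p.support, monomial n (l (coeff n p))

/-- Application of a linear functional to all coefficients of a univariate polynomial. -/
def polyFunctional (p : Polynomial K) : Polynomial k :=
  ∑ n ∈ p.support, Polynomial.monomial n (l (p.coeff n))

@[simp] lemma coeff_mvFunctional (p : MvPolynomial σ K) (n : σ →₀ ℕ) :
    coeff n (mvFunctional l p) = l (coeff n p) := by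
  classical
  rw [mvFunctional, coeff_sum]
  simp only [coeff_monomial]
  rw [Finset.sum_ite_eq']
  split_ifs with h
  · rfl
  · rw [notMem_support_iff.1 h, map_zero]

@[simp] lemma coeff_polyFunctional (p : Polynomial K) (n : ℕ) :
    (polyFunctional l p).coeff n = l (p.coeff n) := by
  classical
  rw [polyFunctional, Polynomial.finsetSum_coeff]
  simp only [Polynomial.coeff_monomial]
  rw [Finset.sum_ite_eq']
  split_ifs with h
  · rfl
  · rw [Polynomial.notMem_support_iff.1 h, map_zero]

lemma mvFunctional_add (p q : MvPolynomial σ K) :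
    mvFunctional l (p + q) = mvFunctional l p + mvFunctional l q := by
  ext n; simp

lemma polyFunctional_add (p q : Polynomial K) :
    polyFunctional l (p + q) = polyFunctional l p + polyFunctional l q := by
  ext n; simp

lemma mvFunctional_map_mul (a : MvPolynomial σ k) (b : MvPolynomial σ K) :
    mvFunctional l (map (algebraMap k K) a * b) = a * mvFunctional l b := by
  classical
  ext n
  simp only [coeff_mvFunctional, coeff_mul, map_sum, coeff_map]
  refine Finset.sum_congr rfl fun x _ => ?_
  rw [← Algebra.smul_def, map_smul, smul_eq_mul]

lemma mvFunctional_mul_map (a : MvPolynomial σ K) (b : MvPolynomial σ k) :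
    mvFunctional l (a * map (algebraMap k K) b) = mvFunctional l a * b := by
  rw [mul_comm, mvFunctional_map_mul, mul_comm]

lemma polyFunctional_mul_map (a : Polynomial K) (b : Polynomial k) :
    polyFunctional l (a * b.map (algebraMap k K)) = polyFunctional l a * b := by
  classical
  ext n
  simp only [coeff_polyFunctional, Polynomial.coeff_mul, map_sum, Polynomial.coeff_map]
  refine Finset.sum_congr rfl fun x _ => ?_
  rw [mul_comm (Polynomial.coeff a _), ← Algebra.smul_def, map_smul, smul_eq_mul, mul_comm]

@[simp] lemma mvFunctional_C (x : K) : mvFunctional l (C x : MvPolynomial σ K) = C (l x) := by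
  classical
  ext n
  rw [coeff_mvFunctional, coeff_C, coeff_C]
  split_ifs <;> simp

lemma mvFunctional_map (hl : l 1 = 1) (a : MvPolynomial σ k) :
    mvFunctional l (map (algebraMap k K) a) = a := by
  have := mvFunctional_map_mul l a 1
  rwa [mul_one, ← C_1, mvFunctional_C, hl, C_1, mul_one] at this

lemma mvFunctional_aeval (h : MvPolynomial σ k) (p : Polynomial K) :
    mvFunctional l (Polynomial.aeval (map (algebraMap k K) h) p) =
      Polynomial.aeval h (polyFunctional l p) := by
  induction p using Polynomial.induction_on' with
  | add p q hp hq => rw [map_add, mvFunctional_add, hp, hq, polyFunctional_add, map_add]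
  | monomial n a =>
    have h1 : polyFunctional l (Polynomial.monomial n a) = Polynomial.monomial n (l a) := by
      ext i
      rw [coeff_polyFunctional, Polynomial.coeff_monomial, Polynomial.coeff_monomial]
      split_ifs <;> simp
    rw [h1, Polynomial.aeval_monomial, Polynomial.aeval_monomial, algebraMap_eq, algebraMap_eq,
      ← map_pow, mvFunctional_mul_map, mvFunctional_C]

lemma mvFunctional_mvAeval (g : τ → MvPolynomial σ k) (p : MvPolynomial τ K) :
    mvFunctional l (aeval (fun i => map (algebraMap k K) (g i)) p) =
      aeval g (mvFunctional l p) := by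
  classical
  induction p using MvPolynomial.induction_on' with
  | monomial u a =>
    have h1 : mvFunctional l (monomial u a) = monomial u (l a) := by
      ext i
      rw [coeff_mvFunctional, coeff_monomial, coeff_monomial]
      split_ifs <;> simp
    rw [h1, aeval_monomial, aeval_monomial, algebraMap_eq, algebraMap_eq]
    simp only [← map_pow]
    rw [← map_finsuppProd, mvFunctional_mul_map, mvFunctional_C]
  | add p q hp hq => rw [map_add, mvFunctional_add, hp, hq, mvFunctional_add, map_add]

lemma totalDegree_mvFunctional_le (p : MvPolynomial σ K) :
    (mvFunctional l p).totalDegree ≤ p.totalDegree := by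
  refine Finset.sup_mono fun n hn => ?_
  rw [mem_support_iff, coeff_mvFunctional] at hn
  rw [mem_support_iff]
  intro h
  rw [h, map_zero] at hn
  exact hn rfl

lemma totalDegree_map_algebraMap (p : MvPolynomial σ k) :
    (map (algebraMap k K) p).totalDegree = p.totalDegree := by
  rw [totalDegree, totalDegree, support_map_of_injective _ (algebraMap k K).injective]

lemma mem_of_forall_mvFunctional_mem (M : Submodule K (MvPolynomial σ K)) (b : MvPolynomial σ K)
    (hb : ∀ l : K →ₗ[k] k, map (algebraMap k K) (mvFunctional l b) ∈ M) : b ∈ M := by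
  classical
  let B := Module.Basis.ofVectorSpace k K
  let J := b.support.biUnion fun n => (B.repr (coeff n b)).support
  have : b = ∑ j ∈ J, B j • map (algebraMap k K) (mvFunctional (B.coord j) b) := by
    ext n
    simp only [coeff_sum, coeff_smul, coeff_map, coeff_mvFunctional, Module.Basis.coord_apply,
      smul_eq_mul]
    conv_lhs => rw [← B.linearCombination_repr (coeff n b), Finsupp.linearCombination_apply]
    rw [Finsupp.sum_of_support_subset (s := J)]
    · refine Finset.sum_congr rfl fun j _ => ?_
      rw [Algebra.smul_def, mul_comm]
    · by_cases hn : n ∈ b.support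
      · exact Finset.subset_biUnion_of_mem (fun n => (B.repr (coeff n b)).support) hn
      · rw [notMem_support_iff.1 hn]; simp
    · simp
  rw [this]
  exact sum_mem fun j _ => M.smul_mem _ (hb _)

variable (k K) in
lemma exists_functional_one : ∃ l : K →ₗ[k] k, l 1 = 1 := by
  obtain ⟨l, hl⟩ := (Algebra.linearMap k K).exists_leftInverse_of_injective
    (LinearMap.ker_eq_bot.2 (algebraMap k K).injective)
  exact ⟨l, by simpa using LinearMap.congr_fun hl 1⟩

end Functional

end

section

/-- Extension of scalars for polynomials in two variables. -/
abbrev emb {k : Type} (K : Type) [Field k] [Field K] [Algebra k K] :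
    MvPolynomial (Fin 2) k →+* MvPolynomial (Fin 2) K :=
  MvPolynomial.map (algebraMap k K)

/-- Two elements such that the ring of constants of the first one is factorially closed, and over
which the polynomial ring is generated up to denominators. -/
structure PreGen {k : Type} [Field k] (h s : MvPolynomial (Fin 2) k) : Prop where
  inj : Function.Injective (ev (R := k) h s)
  closed : ∀ a b, a * b ∈ Algebra.adjoin k {h} → a * b ≠ 0 → a ∈ Algebra.adjoin k {h}
  exists_ev : ∀ b, ∃ c : Polynomial k, c ≠ 0 ∧ ∃ P, Polynomial.aeval h c * b = ev (R := k) h s P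

lemma SliceData.exists_preGen {k : Type} [Field k] {f : MvPolynomial (Fin 2) k}
    (S : SliceData k f) :
    ∃ h, PreGen h S.s ∧ ((∃ w : Polynomial k, f = Polynomial.aeval h w) ∨ S.s = f) := by
  obtain ⟨h, htr, hC⟩ := S.exists_C_eq
  have hmem : ∀ c, c ∈ S.C ↔ ∃ p : Polynomial k, Polynomial.aeval h p = c := by
    intro c
    rw [hC, Algebra.adjoin_singleton_eq_range_aeval]
    rfl
  have hev : ∀ Q, ev h S.s Q =
      (Q.map (Polynomial.aeval h : Polynomial k →ₐ[k] _).toRingHom).eval S.s := by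
    intro Q
    rw [Polynomial.eval_map]
    rfl
  refine ⟨h, ⟨?_, ?_, ?_⟩, ?_⟩
  · rw [injective_iff_map_eq_zero]
    intro Q hQ
    have hi : Function.Injective (Polynomial.aeval h : Polynomial k →ₐ[k] _).toRingHom :=
      transcendental_iff_injective.1 htr
    rw [← Polynomial.map_eq_zero_iff hi]
    refine S.eq_zero_of_eval _ (fun n => ?_) ((hev Q).symm.trans hQ)
    rw [Polynomial.coeff_map, hmem]
    exact ⟨_, rfl⟩
  · rw [← hC]; exact S.mem_of_mul
  · intro b
    obtain ⟨c, hc, hc0, P, hP, hcb⟩ := S.exists_eval b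
    obtain ⟨c, rfl⟩ := (hmem c).1 hc
    refine ⟨c, fun h => hc0 (by rw [h, map_zero]), ?_⟩
    obtain ⟨Q, hQ⟩ := (Polynomial.lifts_iff_coeff_lifts
      (f := (Polynomial.aeval h : Polynomial k →ₐ[k] _).toRingHom) P).2 fun n => (hmem _).1 (hP n)
    refine ⟨Q, ?_⟩
    rw [hev, hcb]
    exact congrArg _ hQ.symm
  · refine S.mem_or_eq.imp_left fun hf => ?_
    obtain ⟨w, hw⟩ := (hmem f).1 hf
    exact ⟨w, hw.symm⟩

namespace PreGen
variable {k : Type} [Field k] {h s : MvPolynomial (Fin 2) k}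

lemma injective_aeval (H : PreGen h s) : Function.Injective (Polynomial.aeval (R := k) h) := by
  intro p q hpq
  refine Polynomial.C_injective (H.inj ?_)
  rw [ev_C, ev_C, hpq]

variable {K : Type} [Field K] [Algebra k K]

lemma injective_ev_map (H : PreGen h s) [Algebra.IsAlgebraic k K] :
    Function.Injective (ev (R := K) (emb K h) (emb K s)) := by
  have h1 : AlgebraicIndependent k ![h, s] := by
    rw [algebraicIndependent_iff_injective_aeval, injective_iff_map_eq_zero]
    intro P hP
    obtain ⟨Q, rfl⟩ := (Polynomial.Bivariate.equivMvPolynomial k).surjective P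
    rw [← ev_eq_aeval] at hP
    rw [H.inj (hP.trans (map_zero _).symm), map_zero]
  let φ : MvPolynomial (Fin 2) k →ₐ[k] MvPolynomial (Fin 2) K := mapAlgHom (Algebra.ofId k K)
  have h2 : AlgebraicIndependent k (φ ∘ ![h, s]) :=
    h1.map' (map_injective _ (algebraMap k K).injective)
  have h3 := h2.extendScalars K
  rw [algebraicIndependent_iff_injective_aeval] at h3
  have h4 : (φ ∘ ![h, s]) = ![emb K h, emb K s] := by
    ext i; fin_cases i <;> rfl
  rw [h4] at h3
  intro p q hpq
  rw [ev_eq_aeval, ev_eq_aeval] at hpq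
  exact (Polynomial.Bivariate.equivMvPolynomial K).injective (h3 hpq)

lemma aeval_map_ne_zero (H : PreGen h s) {c : Polynomial K} [Algebra.IsAlgebraic k K] (hc : c ≠ 0) :
    Polynomial.aeval (emb K h) c ≠ 0 := by
  intro h0
  rw [← ev_C (emb K h) (emb K s)] at h0
  exact hc (Polynomial.C_injective (H.injective_ev_map (h0.trans (map_zero _).symm) |>.trans
    (map_zero _).symm))

lemma map_aeval (p : Polynomial k) :
    emb K (Polynomial.aeval h p) = Polynomial.aeval (emb K h) (p.map (algebraMap k K)) := by
  rw [Polynomial.aeval_map_algebraMap, Polynomial.aeval_def, Polynomial.hom_eval₂,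
    Polynomial.aeval_def]
  congr 1
  ext
  simp

lemma exists_ev_map (H : PreGen h s) (b : MvPolynomial (Fin 2) K) : ∃ c : Polynomial k, c ≠ 0 ∧
    ∃ P, emb K (Polynomial.aeval h c) * b = ev (R := K) (emb K h) (emb K s) P := by
  have hemb : ∀ b : MvPolynomial (Fin 2) k, ∃ c : Polynomial k, c ≠ 0 ∧
      ∃ P, emb K (Polynomial.aeval h c) * emb K b = ev (R := K) (emb K h) (emb K s) P := by
    intro b
    obtain ⟨c, hc, P, hP⟩ := H.exists_ev b
    exact ⟨c, hc, _, by rw [← map_mul, hP, map_ev]⟩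
  induction b using MvPolynomial.induction_on with
  | C a => exact ⟨1, one_ne_zero, Polynomial.C (Polynomial.C a), by simp⟩
  | add p q hp hq =>
    obtain ⟨c, hc, P, hP⟩ := hp
    obtain ⟨d, hd, Q, hQ⟩ := hq
    refine ⟨c * d, mul_ne_zero hc hd, Polynomial.C (d.map (algebraMap k K)) * P +
      Polynomial.C (c.map (algebraMap k K)) * Q, ?_⟩
    rw [map_add, map_mul (ev (R := K) _ _), map_mul (ev (R := K) _ _), ← hP, ← hQ, ev_C, ev_C,
      ← map_aeval, ← map_aeval, map_mul, map_mul]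
    ring
  | mul_X p i hp =>
    obtain ⟨c, hc, P, hP⟩ := hp
    obtain ⟨d, hd, Q, hQ⟩ := hemb (X i)
    refine ⟨c * d, mul_ne_zero hc hd, P * Q, ?_⟩
    rw [map_mul (ev (R := K) _ _), ← hP, ← hQ, map_X, map_mul, map_mul]
    ring

lemma mem_range_of_mul (H : PreGen h s) {c : Polynomial k} (hc : c ≠ 0) {b : MvPolynomial (Fin 2) K}
    {p : Polynomial K} (hb : emb K (Polynomial.aeval h c) * b = Polynomial.aeval (emb K h) p) :
    ∃ q : Polynomial K, Polynomial.aeval (emb K h) q = b := by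
  have key : b ∈ Subalgebra.toSubmodule (Polynomial.aeval (R := K) (emb K h)).range := by
    refine mem_of_forall_mvFunctional_mem (k := k) _ _ fun l => ?_
    have h1 := congrArg (mvFunctional l) hb
    rw [mvFunctional_map_mul, mvFunctional_aeval] at h1
    have h2 : mvFunctional l b ∈ Algebra.adjoin k {h} := by
      rcases eq_or_ne (mvFunctional l b) 0 with h3 | h3
      · rw [h3]; exact zero_mem _
      · refine H.closed _ (Polynomial.aeval h c) ?_ (mul_ne_zero h3 ?_)
        · rw [mul_comm, h1]; exact Polynomial.aeval_mem_adjoin_singleton _ _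
        · rw [← map_zero (Polynomial.aeval (R := k) h)]; exact H.injective_aeval.ne hc
    rw [Algebra.adjoin_singleton_eq_range_aeval] at h2
    obtain ⟨q, hq⟩ := h2
    refine ⟨q.map (algebraMap k K), ?_⟩
    rw [← hq]
    exact (map_aeval q).symm
  exact key

lemma mem_range_of_mul_eq (H : PreGen h s) [Algebra.IsAlgebraic k K] {a b : MvPolynomial (Fin 2) K}
    {p : Polynomial K} (hp : p ≠ 0) (hab : a * b = Polynomial.aeval (emb K h) p) :
    ∃ q : Polynomial K, Polynomial.aeval (emb K h) q = a := by
  obtain ⟨c, hc, P, hP⟩ := H.exists_ev_map (K := K) a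
  obtain ⟨d, hd, Q, hQ⟩ := H.exists_ev_map (K := K) b
  have h1 : P * Q = Polynomial.C (c.map (algebraMap k K) * d.map (algebraMap k K) * p) := by
    apply H.injective_ev_map (K := K)
    rw [map_mul, ← hP, ← hQ, ev_C, map_mul, map_mul, ← map_aeval, ← map_aeval, ← hab]
    ring
  have h0 : P * Q ≠ 0 := by
    rw [h1, Ne, Polynomial.C_eq_zero]
    refine mul_ne_zero (mul_ne_zero ?_ ?_) hp <;>
    rwa [Ne, Polynomial.map_eq_zero]
  have h2 := congrArg Polynomial.natDegree h1
  rw [Polynomial.natDegree_mul (left_ne_zero_of_mul h0) (right_ne_zero_of_mul h0),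
    Polynomial.natDegree_C] at h2
  rw [Polynomial.eq_C_of_natDegree_eq_zero (Nat.eq_zero_of_add_eq_zero_right h2), ev_C] at hP
  exact H.mem_range_of_mul hc hP

lemma prime_sub_C (H : PreGen h s) [Algebra.IsAlgebraic k K] (x : K) : Prime (emb K h - C x) := by
  have h1 : emb K h - C x = Polynomial.aeval (emb K h) (Polynomial.X - Polynomial.C x) := by
    simp [algebraMap_eq]
  have hx : (Polynomial.X - Polynomial.C x) ≠ 0 := Polynomial.X_sub_C_ne_zero x
  have hinj : Function.Injective (Polynomial.aeval (R := K) (emb K h)) := by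
    rw [injective_iff_map_eq_zero]
    intro p hp
    by_contra h0
    exact H.aeval_map_ne_zero h0 hp
  refine Irreducible.prime ⟨fun hu => ?_, fun a b hab => ?_⟩
  · obtain ⟨v, hv⟩ := hu.exists_right_inv
    have h2 : v * (emb K h - C x) = Polynomial.aeval (emb K h) (1 : Polynomial K) := by
      rw [map_one, mul_comm, hv]
    obtain ⟨q, rfl⟩ := H.mem_range_of_mul_eq one_ne_zero h2
    rw [h1, ← map_mul] at h2
    exact Polynomial.not_isUnit_X_sub_C x (IsUnit.of_mul_eq_one_right _ (hinj h2))
  · rw [h1] at hab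
    obtain ⟨p, rfl⟩ := H.mem_range_of_mul_eq hx hab.symm
    obtain ⟨q, rfl⟩ := H.mem_range_of_mul_eq hx ((mul_comm _ _).trans hab.symm)
    rw [← map_mul] at hab
    exact ((Polynomial.irreducible_X_sub_C x).isUnit_or_isUnit (hinj hab)).imp
      (fun h => h.map _) (fun h => h.map _)

end PreGen

end

section

/-- `T` can replace `s` after inverting polynomials in `h`. -/
def IsSubst {k : Type} [Field k] (h s T : MvPolynomial (Fin 2) k) : Prop :=
  ∃ c p q : Polynomial k, c ≠ 0 ∧ q ≠ 0 ∧
    Polynomial.aeval h c * T = Polynomial.aeval h p + Polynomial.aeval h q * s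

namespace PreGen
variable {k : Type} [Field k] {h s T : MvPolynomial (Fin 2) k}
variable {K : Type} [Field K] [Algebra k K]

lemma not_dvd_sub_C (H : PreGen h s) [Algebra.IsAlgebraic k K] (hT : IsSubst h s T)
    (hmin : ∀ T', IsSubst h s T' → T.totalDegree ≤ T'.totalDegree) (x μ : K) :
    ¬ (emb K h - C x) ∣ (emb K T - C μ) := by
  rintro ⟨T', hT'⟩
  obtain ⟨c, p, q, hc, hq, hcT⟩ := hT
  obtain ⟨l, hl⟩ := exists_functional_one k K
  have hx : IsIntegral k x := Algebra.IsIntegral.isIntegral x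
  obtain ⟨d₁, hd₁⟩ : Polynomial.X - Polynomial.C x ∣ (minpoly k x).map (algebraMap k K) := by
    rw [Polynomial.dvd_iff_isRoot, Polynomial.IsRoot, Polynomial.eval_map_algebraMap,
      minpoly.aeval]
  have hmon : d₁.Monic := by
    refine (Polynomial.monic_X_sub_C x).of_mul_monic_left ?_
    rw [← hd₁]
    exact (minpoly.monic hx).map _
  have hld : polyFunctional l d₁ ≠ 0 := by
    intro h0
    have := congrArg (fun p => Polynomial.coeff p d₁.natDegree) h0
    simp only [coeff_polyFunctional, Polynomial.coeff_zero] at this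
    rw [Polynomial.coeff_natDegree, hmon, hl] at this
    exact one_ne_zero this
  have h1 : emb K (Polynomial.aeval h (c * minpoly k x)) * T' =
      Polynomial.aeval (emb K h) (d₁ * (p.map (algebraMap k K) -
        Polynomial.C μ * c.map (algebraMap k K))) +
      Polynomial.aeval (emb K h) (d₁ * q.map (algebraMap k K)) * emb K s := by
    have h2 := congrArg (emb K) hcT
    rw [map_mul, map_add, map_mul] at h2
    rw [map_mul, map_mul, map_aeval (minpoly k x), hd₁]
    simp only [map_mul, map_sub, ← map_aeval, Polynomial.aeval_X, Polynomial.aeval_C, algebraMap_eq]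
    linear_combination (Polynomial.aeval (emb K h) d₁) * h2 -
      (Polynomial.aeval (emb K h) d₁) * emb K (Polynomial.aeval h c) * hT'
  have h2 := congrArg (mvFunctional l) h1
  rw [mvFunctional_map_mul, mvFunctional_add, mvFunctional_mul_map, mvFunctional_aeval,
    mvFunctional_aeval, polyFunctional_mul_map] at h2
  have h3 := hmin _ ⟨_, _, _, mul_ne_zero hc (minpoly.ne_zero hx), mul_ne_zero hld hq, h2⟩
  have hT0 : T' ≠ 0 := by
    intro h0
    rw [h0, mul_zero, sub_eq_zero] at hT'
    have h4 := congrArg (emb K) hcT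
    rw [map_mul, hT', map_add, map_mul, map_aeval, map_aeval, map_aeval] at h4
    have h5 : ev (R := K) (emb K h) (emb K s) (Polynomial.C (q.map (algebraMap k K)) *
        Polynomial.X + Polynomial.C (p.map (algebraMap k K) -
          Polynomial.C μ * c.map (algebraMap k K))) = ev (R := K) (emb K h) (emb K s) 0 := by
      simp only [map_add, map_mul, map_sub, ev_C, ev_X, Polynomial.aeval_C, algebraMap_eq, map_zero]
      linear_combination -h4
    have h6 := congrArg (fun p => Polynomial.coeff p 1) (H.injective_ev_map h5)
    simp only [Polynomial.coeff_add, Polynomial.coeff_C_mul, Polynomial.coeff_X_one, mul_one,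
      Polynomial.coeff_C_succ, add_zero, Polynomial.coeff_zero] at h6
    exact hq ((Polynomial.map_eq_zero _).1 h6)
  have hprime := H.prime_sub_C x
  have hpos : 0 < (emb K h - C x).totalDegree := by
    refine Nat.pos_of_ne_zero fun h0 => hprime.not_isUnit ?_
    have h4 := totalDegree_eq_zero_iff_eq_C.1 h0
    rw [h4]
    refine IsUnit.map C (Ne.isUnit fun h5 => hprime.ne_zero ?_)
    rw [h4, h5, map_zero]
  have h7 := totalDegree_mul_of_isDomain hprime.ne_zero hT0
  rw [← hT'] at h7
  have h8 := totalDegree_sub_C_le (emb K T) μ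
  rw [totalDegree_map_algebraMap] at h8
  have h9 := totalDegree_mvFunctional_le l T'
  omega

lemma mem_range_ev_of_mul (H : PreGen h s) [IsAlgClosed K] [Algebra.IsAlgebraic k K]
    (hT : IsSubst h s T) (hmin : ∀ T', IsSubst h s T' → T.totalDegree ≤ T'.totalDegree)
    (n : ℕ) : ∀ (c : Polynomial K), c ≠ 0 → c.natDegree = n → ∀ b P,
      Polynomial.aeval (emb K h) c * b = ev (R := K) (emb K h) (emb K T) P →
      ∃ Q, ev (R := K) (emb K h) (emb K T) Q = b := by
  induction n with
  | zero =>
    intro c hc hcn b P hP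
    obtain ⟨u, rfl⟩ : ∃ u, c = Polynomial.C u := ⟨_, Polynomial.eq_C_of_natDegree_eq_zero hcn⟩
    have hu : u ≠ 0 := fun h => hc (by rw [h, map_zero])
    refine ⟨Polynomial.C (Polynomial.C u⁻¹) * P, ?_⟩
    rw [map_mul, ← hP, ev_C, Polynomial.aeval_C, Polynomial.aeval_C, ← mul_assoc, ← map_mul,
      inv_mul_cancel₀ hu, map_one, one_mul]
  | succ n ih =>
    intro c hc hcn b P hP
    obtain ⟨x, hx⟩ := IsAlgClosed.exists_root c (by
      rw [Polynomial.degree_eq_natDegree hc, hcn]; exact_mod_cast Nat.succ_ne_zero n)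
    obtain ⟨c', rfl⟩ := Polynomial.dvd_iff_isRoot.2 hx
    have hc' := right_ne_zero_of_mul hc
    rw [Polynomial.natDegree_mul (Polynomial.X_sub_C_ne_zero x) hc', Polynomial.natDegree_X_sub_C]
      at hcn
    have hprime := H.prime_sub_C x
    set P₀ : Polynomial K := P.map (Polynomial.evalRingHom x) with hP₀
    obtain ⟨P₁, hP₁⟩ : Polynomial.C (Polynomial.X - Polynomial.C x) ∣ P - P₀.map Polynomial.C := by
      rw [Polynomial.C_dvd_iff_dvd_coeff]
      intro i
      rw [Polynomial.coeff_sub, Polynomial.coeff_map, hP₀, Polynomial.coeff_map]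
      exact Polynomial.X_sub_C_dvd_sub_C_eval
    have hX : ∀ y : K, Polynomial.aeval (emb K h) (Polynomial.X - Polynomial.C y) =
      emb K h - C y := fun y => by simp [algebraMap_eq]
    have h1 : ev (R := K) (emb K h) (emb K T) P = (emb K h - C x) * ev (emb K h) (emb K T) P₁ +
        Polynomial.aeval (emb K T) P₀ := by
      have h2 : ev (R := K) (emb K h) (emb K T) (P₀.map Polynomial.C) =
          Polynomial.aeval (emb K T) P₀ := by
        change Polynomial.eval₂ _ _ _ = _
        rw [Polynomial.eval₂_map, Polynomial.aeval_def]
        congr 1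
        ext
        simp
      rw [← h2, ← hX, ← ev_C (emb K h) (emb K T), ← map_mul, ← map_add, ← hP₁]
      congr 1; ring
    rw [map_mul, hX, h1] at hP
    have hdvd : (emb K h - C x) ∣ Polynomial.aeval (emb K T) P₀ :=
      ⟨Polynomial.aeval (emb K h) c' * b - ev (emb K h) (emb K T) P₁, by linear_combination -hP⟩
    have hP0 : P₀ = 0 := by
      by_contra h0
      rw [(IsAlgClosed.splits P₀).eq_prod_roots, map_mul, Polynomial.aeval_C, algebraMap_eq,
        map_multiset_prod, Multiset.map_map] at hdvd
      rcases hprime.dvd_or_dvd hdvd with h2 | h2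
      · refine hprime.not_isUnit (isUnit_of_dvd_unit h2 (IsUnit.map C (Ne.isUnit ?_)))
        exact Polynomial.leadingCoeff_ne_zero.2 h0
      · obtain ⟨a, ha, h3⟩ := hprime.exists_mem_multiset_dvd h2
        obtain ⟨μ, -, rfl⟩ := Multiset.mem_map.1 ha
        refine H.not_dvd_sub_C hT hmin x μ ?_
        simpa [algebraMap_eq] using h3
    rw [hP0, map_zero, add_zero, mul_assoc] at hP
    exact ih c' hc' (by omega) b P₁ (mul_left_cancel₀ hprime.ne_zero hP)

lemma exists_gen (H : PreGen h s) : ∃ T, Gen h T ∧ ∃ a b : Polynomial k, b ≠ 0 ∧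
    s = Polynomial.aeval h a + Polynomial.aeval h b * T := by
  classical
  have hex : ∃ n, ∃ T, IsSubst h s T ∧ T.totalDegree = n :=
    ⟨_, s, ⟨1, 0, 1, one_ne_zero, one_ne_zero, by simp⟩, rfl⟩
  obtain ⟨T, hT, hdeg⟩ := Nat.find_spec hex
  have hmin : ∀ T', IsSubst h s T' → T.totalDegree ≤ T'.totalDegree := by
    intro T' h'
    rw [hdeg]
    exact Nat.find_min' hex ⟨T', h', rfl⟩
  let K := AlgebraicClosure k
  have hmem : ∀ (c : Polynomial K), c ≠ 0 → ∀ b,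
      (∃ P, ev (R := K) (emb K h) (emb K T) P = Polynomial.aeval (emb K h) c * b) →
      ∃ Q, ev (R := K) (emb K h) (emb K T) Q = b := fun c hc b ⟨P, hP⟩ =>
    H.mem_range_ev_of_mul hT hmin _ c hc rfl b P hP.symm
  obtain ⟨c, p, q, hc, hq, hcT⟩ := hT
  have hmap : ∀ {p : Polynomial k}, p ≠ 0 → p.map (algebraMap k K) ≠ 0 := fun hp => by
    rwa [Ne, Polynomial.map_eq_zero]
  have hs : ∃ Q, ev (R := K) (emb K h) (emb K T) Q = emb K s := by
    refine hmem _ (hmap hq) _ ⟨Polynomial.C (c.map (algebraMap k K)) * Polynomial.X -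
      Polynomial.C (p.map (algebraMap k K)), ?_⟩
    have h2 := congrArg (emb K) hcT
    rw [map_mul, map_add, map_mul] at h2
    simp only [map_sub, map_mul, ev_C, ev_X, ← map_aeval]
    linear_combination h2
  have hall : ∀ b, b ∈ Algebra.adjoin K {emb K h, emb K T} := by
    intro b
    rw [mem_adjoin_pair]
    obtain ⟨d, hd, P, hP⟩ := H.exists_ev_map (K := K) b
    refine hmem _ (hmap hd) b ?_
    rw [← map_aeval, hP, ← mem_adjoin_pair]
    have h1 : ev (R := K) (emb K h) (emb K s) P ∈ Algebra.adjoin K {emb K h, emb K s} :=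
      (mem_adjoin_pair _ _).2 ⟨P, rfl⟩
    refine Algebra.adjoin_le ?_ h1
    rintro _ (rfl | rfl)
    · exact Algebra.subset_adjoin (by simp)
    · exact (mem_adjoin_pair _ _).2 hs
  have hgen : Gen h T := by
    obtain ⟨l, hl⟩ := exists_functional_one k K
    rw [Gen, eq_top_iff]
    rintro b -
    obtain ⟨P, hP⟩ := (mem_adjoin_pair _ _).1 (hall (emb K b))
    rw [ev_eq_aeval] at hP
    have h4 : ![emb K h, emb K T] = fun i => emb K (![h, T] i) := by
      ext i; fin_cases i <;> rfl
    rw [h4] at hP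
    have h5 := congrArg (mvFunctional l) hP
    rw [mvFunctional_mvAeval, mvFunctional_map l hl] at h5
    obtain ⟨Q, hQ⟩ := (Polynomial.Bivariate.equivMvPolynomial k).surjective
      (mvFunctional l (Polynomial.Bivariate.equivMvPolynomial K P))
    rw [mem_adjoin_pair]
    exact ⟨Q, by rw [ev_eq_aeval, hQ, h5]⟩
  refine ⟨T, hgen, ?_⟩
  obtain ⟨Q, hQ⟩ := gen_iff_surjective.1 hgen s
  have h1 : Polynomial.C q * Q = Polynomial.C c * Polynomial.X - Polynomial.C p := by
    apply hgen.injective_ev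
    simp only [map_sub, map_mul, ev_C, ev_X, hQ]
    linear_combination -hcT
  have h2 : Q = Polynomial.C (Q.coeff 0) + Polynomial.C (Q.coeff 1) * Polynomial.X := by
    ext1 n
    rcases n with _ | _ | n
    · simp
    · simp [Polynomial.coeff_C]
    · have := congrArg (fun p => Polynomial.coeff p (n + 2)) h1
      simp [hq] at this
      simp [this]
  refine ⟨Q.coeff 0, Q.coeff 1, fun h0 => ?_, ?_⟩
  · have := congrArg (fun p => Polynomial.coeff p 1) h1
    simp [Polynomial.coeff_C, h0] at this
    exact hc this.symm
  · rw [← hQ, h2]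
    simp

end PreGen

/-- A polynomial with slice data is a polynomial in one of two generators, or linear in the
other one. -/
lemma SliceData.exists_gen {k : Type} [Field k] {f : MvPolynomial (Fin 2) k}
    (S : SliceData k f) : ∃ h T, Gen h T ∧ ((∃ w : Polynomial k, f = Polynomial.aeval h w) ∨
      ∃ a b : Polynomial k, b ≠ 0 ∧ f = Polynomial.aeval h a + Polynomial.aeval h b * T) := by
  obtain ⟨h, H, hf⟩ := S.exists_preGen
  obtain ⟨T, hT, hs⟩ := H.exists_gen
  exact ⟨h, T, hT, hf.imp_right fun h => by rwa [h] at hs⟩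

end

section

/-- Mutually inverse substitutions between the hypersurface `G = 0` and an affine space. -/
structure PolyData {R σ : Type} [CommRing R] (τ : Type) (G : MvPolynomial σ R) where
  p : τ → MvPolynomial σ R
  q : σ → MvPolynomial τ R
  c : σ → MvPolynomial σ R
  aeval_rel : aeval q G = 0
  aeval_p : ∀ j, aeval q (p j) = X j
  aeval_q : ∀ i, aeval p (q i) - X i = G * c i

namespace PolyData
variable {R S σ τ : Type} [CommRing R] [CommRing S] {G : MvPolynomial σ R}

lemma nonempty_of_algEquiv
    (e : (MvPolynomial σ R ⧸ Ideal.span {G}) ≃ₐ[R] MvPolynomial τ R) :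
    Nonempty (PolyData τ G) := by
  let π := Ideal.Quotient.mkₐ R (Ideal.span {G})
  have hπ : Function.Surjective π := Ideal.Quotient.mkₐ_surjective R _
  choose p hp using fun j => hπ (e.symm (X j))
  have hq : ∀ P, aeval (fun i => e (π (X i))) P = e (π P) := by
    intro P
    have : aeval (fun i => e (π (X i))) = e.toAlgHom.comp π := by
      ext i; simp
    rw [this]; rfl
  have hp' : ∀ P, π (aeval p P) = e.symm P := by
    intro P
    have : π.comp (aeval p) = e.symm.toAlgHom := by
      ext i; simp [hp]
    exact AlgHom.congr_fun this P
  have hc : ∀ i, G ∣ aeval p (e (π (X i))) - X i := by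
    intro i
    rw [← Ideal.mem_span_singleton, ← Ideal.Quotient.eq_zero_iff_mem]
    change π _ = 0
    rw [map_sub, hp', AlgEquiv.symm_apply_apply, sub_self]
  choose c hc using hc
  refine ⟨⟨p, fun i => e (π (X i)), c, ?_, fun j => ?_, hc⟩⟩
  · rw [hq]
    have : π G = 0 := Ideal.Quotient.eq_zero_iff_mem.2 (Ideal.mem_span_singleton_self _)
    rw [this, map_zero]
  · rw [hq, hp, AlgEquiv.apply_symm_apply]

/-- The hypersurface is an affine space. -/
def algEquiv (D : PolyData τ G) :
    (MvPolynomial σ R ⧸ Ideal.span {G}) ≃ₐ[R] MvPolynomial τ R :=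
  AlgEquiv.ofAlgHom
    (Ideal.Quotient.liftₐ (Ideal.span {G}) (aeval D.q) (by
      intro a ha
      obtain ⟨b, rfl⟩ := Ideal.mem_span_singleton.1 ha
      rw [map_mul, D.aeval_rel, zero_mul]))
    ((Ideal.Quotient.mkₐ R (Ideal.span {G})).comp (aeval D.p))
    (by
      refine MvPolynomial.algHom_ext fun j => ?_
      rw [AlgHom.comp_apply, AlgHom.comp_apply, aeval_X]
      exact D.aeval_p j)
    (by
      apply Ideal.Quotient.algHom_ext
      refine MvPolynomial.algHom_ext fun i => ?_
      have : (Ideal.Quotient.mk (Ideal.span {G})) (aeval D.p (D.q i)) =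
          (Ideal.Quotient.mk (Ideal.span {G})) (X i) := by
        rw [Ideal.Quotient.mk_eq_mk_iff_sub_mem, D.aeval_q]
        exact Ideal.mul_mem_right _ _ (Ideal.mem_span_singleton_self _)
      rw [AlgHom.comp_apply, AlgHom.comp_apply, AlgHom.comp_apply]
      refine Eq.trans ?_ this
      refine congrArg (fun a => Ideal.Quotient.mk (Ideal.span {G}) (aeval D.p a)) ?_
      exact aeval_X D.q i)

lemma map_aeval' (φ : R →+* S) (q : σ → MvPolynomial τ R) (P : MvPolynomial σ R) :
    map φ (aeval q P) = aeval (fun i => map φ (q i)) (map φ P) := by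
  rw [aeval_def, aeval_def, algebraMap_eq, algebraMap_eq, map_eval₂]
  rfl

/-- Change of scalars. -/
def map (D : PolyData τ G) (φ : R →+* S) : PolyData τ (MvPolynomial.map φ G) where
  p j := MvPolynomial.map φ (D.p j)
  q i := MvPolynomial.map φ (D.q i)
  c i := MvPolynomial.map φ (D.c i)
  aeval_rel := by rw [← map_aeval', D.aeval_rel, map_zero]
  aeval_p j := by rw [← map_aeval', D.aeval_p, map_X]
  aeval_q i := by rw [← map_aeval', ← map_mul, ← D.aeval_q, map_sub, map_X]

/-- Descent along an injection, when all the coefficients lift. -/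
def ofMap (φ : R →+* S) (hφ : Function.Injective φ) (D : PolyData τ (MvPolynomial.map φ G))
    (p : τ → MvPolynomial σ R) (q : σ → MvPolynomial τ R) (c : σ → MvPolynomial σ R)
    (hp : ∀ j, MvPolynomial.map φ (p j) = D.p j) (hq : ∀ i, MvPolynomial.map φ (q i) = D.q i)
    (hc : ∀ i, MvPolynomial.map φ (c i) = D.c i) : PolyData τ G where
  p := p
  q := q
  c := c
  aeval_rel := map_injective φ hφ (by
    rw [map_aeval', funext hq, D.aeval_rel, map_zero])
  aeval_p j := map_injective φ hφ (by
    rw [map_aeval', funext hq, hp, D.aeval_p, map_X])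
  aeval_q i := map_injective φ hφ (by
    rw [map_sub, map_aeval', funext hp, hq, map_mul, hc, ← D.aeval_q, map_X])

lemma eval_aeval (v : τ → R) (q : σ → MvPolynomial τ R) (P : MvPolynomial σ R) :
    eval v (aeval q P) = eval (fun i => eval v (q i)) P := by
  rw [← coe_aeval_eq_eval, ← coe_aeval_eq_eval]
  change ((aeval v).comp (aeval q)) P = _
  rw [comp_aeval]
  rfl

/-- The points of the hypersurface are the points of the affine space. -/
def pointsEquiv (D : PolyData τ G) : {v : σ → R // eval v G = 0} ≃ (τ → R) where
  toFun v j := eval v.1 (D.p j)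
  invFun w := ⟨fun i => eval w (D.q i), by rw [← eval_aeval, D.aeval_rel, map_zero]⟩
  left_inv v := by
    ext i
    have := congrArg (eval v.1) (D.aeval_q i)
    rw [map_sub, map_mul, v.2, zero_mul, sub_eq_zero, eval_aeval, eval_X] at this
    exact this
  right_inv w := by
    ext j
    dsimp only
    rw [← eval_aeval, D.aeval_p, eval_X]

end PolyData

section
variable {R S : Type} [CommRing R] [CommRing S] {m : ℕ} (r : Fin m → ℕ)

/-- The polynomial `F` of the statement, as a function of `f` and `g`. -/
abbrev fgPoly (f : MvPolynomial (Fin 2) R) (g : MvPolynomial (Fin m ⊕ Fin 2) R) :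
    MvPolynomial (Fin m ⊕ Fin 2) R :=
  rename Sum.inr f + (∏ i, X (Sum.inl i)) * g

lemma map_relG (φ : R →+* S) (f : MvPolynomial (Fin 2) R) (g : MvPolynomial (Fin m ⊕ Fin 2) R) :
    map φ (relG R m r (fgPoly f g)) = relG S m r (fgPoly (map φ f) (map φ g)) := by
  simp only [relG, incl, fgPoly, map_sub, map_mul, map_add, map_prod, map_pow, map_X, map_rename,
    rename_X]

lemma eval_relG (f : MvPolynomial (Fin 2) R) (g : MvPolynomial (Fin m ⊕ Fin 2) R)
    (v : Fin m ⊕ Fin 3 → R) : eval v (relG R m r (fgPoly f g)) =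
      (∏ i, v (Sum.inl i) ^ r i) * v (Sum.inr 0) - (eval (fun j => v (Sum.inr j.succ)) f +
        (∏ i, v (Sum.inl i)) * eval (v ∘ Sum.map id Fin.succ) g) := by
  simp only [relG, incl, fgPoly, map_sub, map_mul, map_add, map_prod, map_pow, eval_X, rename_X,
    eval_rename]
  rfl

/-- A presentation of the hypersurface as an affine space, with `f` linear in one of two
generators `y` of the polynomial ring in two variables and degenerate over the point `x`. -/
structure LineData (R : Type) [CommRing R] {m : ℕ} (r : Fin m → ℕ) where
  f : MvPolynomial (Fin 2) R
  g : MvPolynomial (Fin m ⊕ Fin 2) R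
  D : PolyData (Fin (m + 2)) (relG R m r (fgPoly f g))
  y : Fin 2 → MvPolynomial (Fin 2) R
  u : Fin 2 → MvPolynomial (Fin 2) R
  a : Fin 4 → Polynomial R
  x : R
  aeval_u : ∀ i, aeval y (u i) = X i
  f_eq : f = Polynomial.aeval (y 0) (a 0) + Polynomial.aeval (y 0) (a 1) * y 1
  bezout : a 2 * a 0 + a 3 * a 1 = 1
  root : (a 1).eval x = 0

lemma map_polynomial_aeval {σ : Type} (φ : R →+* S) (h : MvPolynomial σ R) (p : Polynomial R) :
    map φ (Polynomial.aeval h p) = Polynomial.aeval (map φ h) (p.map φ) := by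
  rw [Polynomial.aeval_def, Polynomial.hom_eval₂, Polynomial.aeval_def, Polynomial.eval₂_map]
  congr 1
  ext
  simp

namespace LineData
variable {r}

lemma map (L : LineData R r) (φ : R →+* S) : Nonempty (LineData S r) := by
  refine ⟨⟨MvPolynomial.map φ L.f, MvPolynomial.map φ L.g, map_relG r φ L.f L.g ▸ L.D.map φ,
    fun i => MvPolynomial.map φ (L.y i), fun i => MvPolynomial.map φ (L.u i),
    fun i => (L.a i).map φ, φ L.x, fun i => ?_, ?_, ?_, ?_⟩⟩
  · rw [← PolyData.map_aeval', L.aeval_u, map_X]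
  · rw [← map_polynomial_aeval, ← map_polynomial_aeval, ← map_mul, ← map_add, ← L.f_eq]
  · simp only [← Polynomial.map_mul, ← Polynomial.map_add, L.bezout, Polynomial.map_one]
  · rw [Polynomial.eval_map_apply, L.root, map_zero]

lemma exists_lift {σ : Type} {R₀ : Subalgebra ℤ R} {p : MvPolynomial σ R}
    (hp : (p.coeffs : Set R) ⊆ R₀) : ∃ q, MvPolynomial.map (algebraMap R₀ R) q = p := by
  refine mem_range_map_iff_coeffs_subset.2 (hp.trans fun x hx => ⟨⟨x, hx⟩, rfl⟩)

lemma descend (L : LineData R r) : ∃ R₀ : Subalgebra ℤ R, R₀.FG ∧ Nonempty (LineData R₀ r) := by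
  classical
  let T : Set R := L.f.coeffs ∪ L.g.coeffs ∪ (⋃ j, (L.D.p j).coeffs) ∪ (⋃ j, (L.D.q j).coeffs) ∪
    (⋃ j, (L.D.c j).coeffs) ∪ (⋃ j, (L.y j).coeffs) ∪ (⋃ j, (L.u j).coeffs) ∪
    (⋃ j, (L.a j).coeffs) ∪ {L.x}
  have hT : T.Finite := by
    simp only [T, Set.finite_union]
    refine ⟨⟨⟨⟨⟨⟨⟨⟨?_, ?_⟩, ?_⟩, ?_⟩, ?_⟩, ?_⟩, ?_⟩, ?_⟩, Set.finite_singleton _⟩ <;>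
      first
      | exact Finset.finite_toSet _
      | exact Set.finite_iUnion fun _ => Finset.finite_toSet _
  have hsub : T ⊆ Algebra.adjoin ℤ T := Algebra.subset_adjoin
  refine ⟨Algebra.adjoin ℤ T, Subalgebra.fg_def.2 ⟨T, hT, rfl⟩, ?_⟩
  generalize Algebra.adjoin ℤ T = R₀ at hsub
  simp only [T, Set.union_subset_iff, Set.iUnion_subset_iff, Set.singleton_subset_iff] at hsub
  obtain ⟨⟨⟨⟨⟨⟨⟨⟨hf, hg⟩, hp⟩, hq⟩, hc⟩, hy⟩, hu⟩, ha⟩, hx⟩ := hsub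
  obtain ⟨f, hf⟩ := exists_lift hf
  obtain ⟨g, hg⟩ := exists_lift hg
  choose p hp using fun j => exists_lift (hp j)
  choose q hq using fun j => exists_lift (hq j)
  choose c hc using fun j => exists_lift (hc j)
  choose y hy using fun j => exists_lift (hy j)
  choose u hu using fun j => exists_lift (hu j)
  have ha' : ∀ j, ∃ b : Polynomial R₀, b.map (algebraMap R₀ R) = L.a j := fun j =>
    (Polynomial.mem_lifts _).1 ((Polynomial.lifts_iff_coeffs_subset_range _).2
      ((ha j).trans fun x hx => ⟨⟨x, hx⟩, rfl⟩))
  choose a ha using ha'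
  have hinj : Function.Injective (algebraMap R₀ R) := Subtype.val_injective
  have hG : MvPolynomial.map (algebraMap R₀ R) (relG R₀ m r (fgPoly f g)) =
      relG R m r (fgPoly L.f L.g) := by rw [map_relG, hf, hg]
  obtain ⟨D, hDp, hDq, hDc⟩ : ∃ D : PolyData (Fin (m + 2))
      (MvPolynomial.map (algebraMap R₀ R) (relG R₀ m r (fgPoly f g))),
      D.p = L.D.p ∧ D.q = L.D.q ∧ D.c = L.D.c := by
    rw [hG]; exact ⟨L.D, rfl, rfl, rfl⟩
  refine ⟨⟨f, g, D.ofMap _ hinj p q c (fun j => by rw [hp, hDp]) (fun j => by rw [hq, hDq])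
    (fun j => by rw [hc, hDc]), y, u, a, ⟨L.x, hx⟩, fun i => ?_, ?_, ?_, ?_⟩⟩
  · apply map_injective _ hinj
    rw [PolyData.map_aeval', funext hy, hu, L.aeval_u, map_X]
  · apply map_injective _ hinj
    rw [map_add, map_mul, map_polynomial_aeval, map_polynomial_aeval, hf, hy, hy, ha, ha]
    exact L.f_eq
  · apply Polynomial.map_injective _ hinj
    rw [Polynomial.map_add, Polynomial.map_mul, Polynomial.map_mul, ha, ha, ha, ha, L.bezout,
      Polynomial.map_one]
  · apply hinj
    rw [← Polynomial.eval_map_apply, ha, map_zero]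
    exact L.root

end LineData
end

end

section

namespace LineData
variable {m : ℕ} {r : Fin m → ℕ}

lemma card_zeros_lt {F : Type} [Field F] [Fintype F] [DecidableEq F] (L : LineData F r) :
    (Finset.univ.filter fun z : Fin 2 → F => eval z L.f = 0).card < Fintype.card F := by
  have hev : ∀ (z : Fin 2 → F) (p : Polynomial F),
      eval z (Polynomial.aeval (L.y 0) p) = p.eval (eval z (L.y 0)) := by
    intro z p
    rw [Polynomial.aeval_def, Polynomial.hom_eval₂, Polynomial.eval]
    congr 1
    ext
    simp
  have hzero : ∀ z, eval z L.f = 0 → (L.a 1).eval (eval z (L.y 0)) ≠ 0 ∧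
      (L.a 0).eval (eval z (L.y 0)) + (L.a 1).eval (eval z (L.y 0)) * eval z (L.y 1) = 0 := by
    intro z hz
    rw [L.f_eq, map_add, map_mul, hev, hev] at hz
    refine ⟨fun h => ?_, hz⟩
    rw [h, zero_mul, add_zero] at hz
    have := congrArg (Polynomial.eval (eval z (L.y 0))) L.bezout
    simp [hz, h] at this
  have hsub : (Finset.univ.filter fun u : F => (L.a 1).eval u ≠ 0).card < Fintype.card F :=
    Finset.card_lt_card ⟨Finset.subset_univ _, fun h => by
      have := h (Finset.mem_univ L.x)
      simp [L.root] at this⟩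
  refine lt_of_le_of_lt (Finset.card_le_card_of_injOn (fun z => eval z (L.y 0)) ?_ ?_) hsub
  · intro z hz
    have := hzero z (by simpa using hz)
    simpa using this.1
  · intro z hz w hw h0
    obtain ⟨hz1, hz2⟩ := hzero z (by simpa using hz)
    obtain ⟨hw1, hw2⟩ := hzero w (by simpa using hw)
    dsimp only at h0
    rw [← h0] at hw1 hw2
    have h1 : eval z (L.y 1) = eval w (L.y 1) :=
      mul_left_cancel₀ hz1 (by linear_combination hz2 - hw2)
    have h2 : (fun i => eval z (L.y i)) = fun i => eval w (L.y i) := by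
      ext i; fin_cases i
      · exact h0
      · exact h1
    ext i
    have h3 := PolyData.eval_aeval z L.y (L.u i)
    have h4 := PolyData.eval_aeval w L.y (L.u i)
    rw [L.aeval_u, eval_X] at h3 h4
    rw [h3, h4, h2]

lemma false_of_finite (hm : 0 < m) (hr : ∀ i, 0 < r i) {F : Type} [Field F] [Fintype F]
    (L : LineData F r) : False := by
  classical
  set q := Fintype.card F with hq
  have hq1 : 0 < q := Fintype.card_pos
  set G := relG F m r (fgPoly L.f L.g) with hG
  have hcard : (Finset.univ.filter fun v : Fin m ⊕ Fin 3 → F => eval v G = 0).card =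
      q ^ (m + 2) := by
    rw [← Fintype.card_subtype, Fintype.card_congr L.D.pointsEquiv]
    simp [hq]
  have hfib : (Finset.univ.filter fun v : Fin m ⊕ Fin 3 → F => eval v G = 0).card =
      ∑ x : Fin m → F, (Finset.univ.filter fun w : Fin 3 → F =>
        eval (Sum.elim x w) G = 0).card := by
    rw [← Finset.card_sigma]
    refine Finset.card_bij' (fun v _ => ⟨v ∘ Sum.inl, v ∘ Sum.inr⟩)
      (fun p _ => Sum.elim p.1 p.2) ?_ ?_ ?_ ?_
    · intro v hv
      simpa using hv
    · intro p hp
      simpa using hp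
    · intro v _
      simp
    · intro p _
      rfl
  have hle : ∀ x : Fin m → F, (∏ i, x i) ≠ 0 → (Finset.univ.filter fun w : Fin 3 → F =>
      eval (Sum.elim x w) G = 0).card ≤ q ^ 2 := by
    intro x hx
    have hx' : (∏ i, x i ^ r i) ≠ 0 :=
      Finset.prod_ne_zero_iff.2 fun i hi => pow_ne_zero _ (Finset.prod_ne_zero_iff.1 hx i hi)
    have h1 : (Finset.univ : Finset (Fin 2 → F)).card = q ^ 2 := by simp [hq]
    rw [← h1]
    refine Finset.card_le_card_of_injOn (fun w j => w j.succ) (fun _ _ => Finset.mem_coe.2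
      (Finset.mem_univ _)) ?_
    intro w hw w' hw' h
    have hw1 : eval (Sum.elim x w) G = 0 := by simpa using hw
    have hw2 : eval (Sum.elim x w') G = 0 := by simpa using hw'
    have h2 : (Sum.elim x w) ∘ Sum.map id Fin.succ = (Sum.elim x w') ∘ Sum.map id Fin.succ := by
      ext j
      rcases j with j | j
      · rfl
      · exact congrFun h j
    rw [hG, eval_relG] at hw1 hw2
    rw [← h2] at hw2
    simp only [Sum.elim_inl, Sum.elim_inr] at hw1 hw2
    dsimp only at h
    rw [← h] at hw2
    have h3 : w 0 = w' 0 := mul_left_cancel₀ hx' (by linear_combination hw1 - hw2)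
    ext j
    refine Fin.cases h3 (fun j => congrFun h j) j
  have hlt : ∀ x : Fin m → F, (∏ i, x i) = 0 → (Finset.univ.filter fun w : Fin 3 → F =>
      eval (Sum.elim x w) G = 0).card < q ^ 2 := by
    intro x hx
    have hx' : (∏ i, x i ^ r i) = 0 := by
      obtain ⟨i, hi, h0⟩ := Finset.prod_eq_zero_iff.1 hx
      exact Finset.prod_eq_zero hi (by rw [h0, zero_pow (hr i).ne'])
    have h1 : (Finset.univ.filter fun w : Fin 3 → F => eval (Sum.elim x w) G = 0).card ≤
        ((Finset.univ : Finset F) ×ˢ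
          (Finset.univ.filter fun z : Fin 2 → F => eval z L.f = 0)).card := by
      refine Finset.card_le_card_of_injOn (fun w => (w 0, fun j => w j.succ)) ?_ ?_
      · intro w hw
        have hw1 : eval (Sum.elim x w) G = 0 := by simpa using hw
        rw [hG, eval_relG] at hw1
        simp only [Sum.elim_inl, Sum.elim_inr, hx, hx', zero_mul, add_zero, zero_sub,
          neg_eq_zero] at hw1
        simpa using hw1
      · intro w _ w' _ h
        have h2 := Prod.ext_iff.1 h
        ext j
        exact Fin.cases h2.1 (fun j => congrFun h2.2 j) j
    rw [Finset.card_product, Finset.card_univ, ← hq] at h1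
    have := L.card_zeros_lt
    calc _ ≤ _ := h1
      _ < q * q := Nat.mul_lt_mul_of_pos_left this hq1
      _ = q ^ 2 := (sq q).symm
  have hsum : (∑ x : Fin m → F, (Finset.univ.filter fun w : Fin 3 → F =>
      eval (Sum.elim x w) G = 0).card) < ∑ _x : Fin m → F, q ^ 2 := by
    refine Finset.sum_lt_sum (fun x _ => ?_) ⟨0, Finset.mem_univ _, hlt 0 ?_⟩
    · by_cases hx : (∏ i, x i) = 0
      · exact (hlt x hx).le
      · exact hle x hx
    · exact Finset.prod_eq_zero (Finset.mem_univ ⟨0, hm⟩) rfl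
  rw [← hfib, hcard, Finset.sum_const, Finset.card_univ, Fintype.card_fun, Fintype.card_fin,
    smul_eq_mul, ← hq, pow_add] at hsum
  exact lt_irrefl _ hsum

lemma isJacobsonRing_int : IsJacobsonRing ℤ := by
  refine isJacobsonRing_iff_prime_eq.2 fun P hP => ?_
  by_cases h : P = ⊥
  · subst h
    refine le_antisymm (fun x hx => ?_) Ideal.le_jacobson
    have := Ideal.mem_jacobson_bot.1 hx x
    rw [Int.isUnit_iff] at this
    rw [Ideal.mem_bot]
    rcases this with h | h <;> nlinarith [mul_self_nonneg x]
  · have := hP.isMaximal h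
    exact Ideal.jacobson_eq_self_of_isMaximal

lemma finite_of_finiteType_int (F : Type) [Field F] [alg : Algebra ℤ F] [Algebra.FiniteType ℤ F] :
    Finite F := by
  obtain rfl : alg = Ring.toIntAlgebra F := Subsingleton.elim _ _
  have := isJacobsonRing_int
  have := finite_of_finite_type_of_isJacobsonRing ℤ F
  have hinj : ¬ Function.Injective (algebraMap ℤ F) := fun h =>
    Int.not_isField (isField_of_isIntegral_of_isField h (Field.toIsField F))
  rw [injective_iff_map_eq_zero] at hinj
  push Not at hinj
  obtain ⟨n, hn, hn0⟩ := hinj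
  have : AddGroup.FG F := Module.Finite.iff_addGroup_fg.1 inferInstance
  refine AddCommGroup.finite_of_fg_isAddTorsion F fun x => ?_
  rw [isOfFinAddOrder_iff_zsmul_eq_zero]
  refine ⟨n, hn0, ?_⟩
  rw [zsmul_eq_mul, ← eq_intCast (algebraMap ℤ F), hn, zero_mul]

lemma false_of_field (hm : 0 < m) (hr : ∀ i, 0 < r i) {K : Type} [Field K]
    (L : LineData K r) : False := by
  obtain ⟨R₀, hfg, ⟨L₀⟩⟩ := L.descend
  have : Algebra.FiniteType ℤ R₀ := Subalgebra.fg_iff_finiteType _ |>.1 hfg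
  obtain ⟨M, hM⟩ := Ideal.exists_maximal R₀
  let := Ideal.Quotient.field M
  have : Algebra.FiniteType ℤ (R₀ ⧸ M) := Algebra.FiniteType.of_surjective
    (Ideal.Quotient.mkₐ ℤ M) (Ideal.Quotient.mkₐ_surjective ℤ M)
  have : Finite (R₀ ⧸ M) :=
    @finite_of_finiteType_int (R₀ ⧸ M) _ (Ideal.Quotient.algebra ℤ) this
  have := Fintype.ofFinite (R₀ ⧸ M)
  obtain ⟨L₁⟩ := L₀.map (Ideal.Quotient.mk M)
  exact L₁.false_of_finite hm hr

end LineData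

end

section

variable {m : ℕ} {r : Fin m → ℕ}

lemma relG_ne_zero {R : Type} [CommRing R] [Nontrivial R] (f : MvPolynomial (Fin 2) R)
    (g : MvPolynomial (Fin m ⊕ Fin 2) R) : relG R m r (fgPoly f g) ≠ 0 := by
  intro h
  let w : ∀ c : R, Fin 3 → R := fun c => Fin.cons c 0
  have h1 : ∀ c, eval (Sum.elim 1 (w c)) (relG R m r (fgPoly f g)) = 0 := fun c => by
    rw [h, map_zero]
  have h2 : ∀ c, (Sum.elim (1 : Fin m → R) (w c)) ∘ Sum.map id Fin.succ =
      Sum.elim (1 : Fin m → R) (0 : Fin 2 → R) := by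
    intro c; ext i; rcases i with i | i <;> simp [w]
  simp only [eval_relG, h2, Sum.elim_inl, Sum.elim_inr, Pi.one_apply, one_pow, Finset.prod_const_one,
    one_mul, w, Fin.cons_zero, Fin.cons_succ] at h1
  exact zero_ne_one (α := R) (by linear_combination h1 0 - h1 1)

lemma ne_zero_of_polyData {R τ : Type} [CommRing R] [IsDomain R] (hm : 0 < m)
    (hr : ∀ i, 0 < r i) {f : MvPolynomial (Fin 2) R} {g : MvPolynomial (Fin m ⊕ Fin 2) R}
    (D : PolyData τ (relG R m r (fgPoly f g))) : f ≠ 0 := by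
  classical
  rintro rfl
  let i₀ : Fin m := ⟨0, hm⟩
  set G := relG R m r (fgPoly 0 g) with hG
  set U : BigP R m := X (Sum.inl i₀) ^ (r i₀ - 1) *
    (∏ i ∈ Finset.univ.erase i₀, X (Sum.inl i) ^ r i) * X (Sum.inr 0) -
      (∏ i ∈ Finset.univ.erase i₀, X (Sum.inl i)) * incl R m g with hU
  have hGU : G = X (Sum.inl i₀) * U := by
    have h1 := Finset.mul_prod_erase Finset.univ (fun i => (X (Sum.inl i) : BigP R m) ^ r i)
      (Finset.mem_univ i₀)
    have h2 := Finset.mul_prod_erase Finset.univ (fun i => (X (Sum.inl i) : BigP R m))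
      (Finset.mem_univ i₀)
    have h3 : (X (Sum.inl i₀) : BigP R m) ^ r i₀ =
        X (Sum.inl i₀) * X (Sum.inl i₀) ^ (r i₀ - 1) := by
      rw [← pow_succ', Nat.sub_add_cancel (hr i₀)]
    have h4 : incl R m (∏ i, X (Sum.inl i)) = ∏ i, X (Sum.inl i) := by
      simp [incl]
    rw [hG, relG, fgPoly, map_zero, zero_add, map_mul, h4, ← h1, ← h2, h3, hU]
    ring
  have hG0 : G ≠ 0 := relG_ne_zero 0 g
  have hU0 : U ≠ 0 := fun h => hG0 (by rw [hGU, h, mul_zero])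
  have : IsDomain (RingA R m r (fgPoly 0 g)) := D.algEquiv.toMulEquiv.isDomain _
  have hmk : ∀ a : BigP R m, (Ideal.Quotient.mk (Ideal.span {G}) a = 0) ↔ G ∣ a := fun a => by
    rw [Ideal.Quotient.eq_zero_iff_mem, Ideal.mem_span_singleton]
  have h5 : xA R m r (fgPoly 0 g) i₀ * Ideal.Quotient.mk (Ideal.span {G}) U = 0 := by
    change Ideal.Quotient.mk (Ideal.span {G}) _ * _ = 0
    rw [← map_mul, hmk, hGU]
  rcases mul_eq_zero.1 h5 with h | h
  · exact (algebraicIndependent_xA r (fgPoly 0 g)).ne_zero i₀ h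
  · obtain ⟨c, hc⟩ := (hmk U).1 h
    have h6 : U * (X (Sum.inl i₀) * c) = U * 1 := by
      rw [mul_one]; conv_rhs => rw [hc, hGU]
      ring
    have h7 := congrArg (eval 0) (mul_left_cancel₀ hU0 h6)
    simp at h7

lemma prime_of_polyData {K : Type} [Field K] (hm : 0 < m) (hr : ∀ i, 0 < r i)
    {f : MvPolynomial (Fin 2) K} {g : MvPolynomial (Fin m ⊕ Fin 2) K}
    (D : PolyData (Fin (m + 2)) (relG K m r (fgPoly f g))) : Prime f := by
  obtain ⟨S, -⟩ := exists_setup (r := r) hm f g _ rfl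
  exact S.prime_f hm hr (ne_zero_of_polyData hm hr D) D.algEquiv

lemma Gen.irreducible_ev {K : Type} [Field K] {h T : MvPolynomial (Fin 2) K} (H : Gen h T)
    {p : Polynomial (Polynomial K)} (hp : Prime (ev h T p)) : Irreducible p := by
  let e := RingEquiv.ofBijective (ev (R := K) h T) ⟨H.injective_ev, gen_iff_surjective.1 H⟩
  exact ((MulEquiv.prime_iff e.toMulEquiv).1 hp).irreducible

theorem isVar_of_polyData {k : Type} [Field k] (hm : 0 < m) (hr : ∀ i, 1 < r i)
    {f : MvPolynomial (Fin 2) k} {g : MvPolynomial (Fin m ⊕ Fin 2) k}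
    (D : PolyData (Fin (m + 2)) (relG k m r (fgPoly f g))) : IsVar f := by
  have hr0 : ∀ i, 0 < r i := fun i => zero_lt_one.trans (hr i)
  have hf0 : f ≠ 0 := ne_zero_of_polyData hm hr0 D
  obtain ⟨S, -⟩ := exists_setup (r := r) hm f g _ rfl
  obtain ⟨S'⟩ := S.nonempty_sliceData hm hr hf0 D.algEquiv
  obtain ⟨h, T, H, hf⟩ := S'.exists_gen
  let K := AlgebraicClosure k
  let φ := algebraMap k K
  have DK : PolyData (Fin (m + 2)) (relG K m r (fgPoly (map φ f) (map φ g))) :=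
    map_relG r φ f g ▸ D.map φ
  have hprime := prime_of_polyData hm hr0 DK
  have HK := H.map φ
  rcases hf with ⟨w, rfl⟩ | ⟨a, b, hb, rfl⟩
  · rw [map_polynomial_aeval, ← ev_C _ (map φ T)] at hprime
    have h1 := HK.irreducible_ev hprime
    have h2 : Irreducible (w.map φ) := by
      refine ⟨fun hu => h1.not_isUnit (hu.map Polynomial.C), fun p q hpq => ?_⟩
      have := h1.isUnit_or_isUnit (a := Polynomial.C p) (b := Polynomial.C q)
        (by rw [hpq, map_mul])
      simpa only [Polynomial.isUnit_C] using this
    have h3 : w.natDegree = 1 := by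
      have := IsAlgClosed.degree_eq_one_of_irreducible K h2
      rw [Polynomial.degree_map] at this
      exact Polynomial.natDegree_eq_of_degree_eq_some this
    have h4 : w.coeff 1 ≠ 0 := by
      rw [← h3, Polynomial.coeff_natDegree, Polynomial.leadingCoeff_ne_zero]
      rintro rfl
      simp at h3
    refine ⟨T, ?_⟩
    rw [Gen, eq_top_iff, ← H, Algebra.adjoin_le_iff]
    set E := Algebra.adjoin k {Polynomial.aeval h w, T}
    have hw : Polynomial.aeval h w ∈ E := Algebra.subset_adjoin (by simp)
    have h6 : Polynomial.aeval h w =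
        algebraMap k _ (w.coeff 1) * h + algebraMap k _ (w.coeff 0) := by
      conv_lhs => rw [Polynomial.eq_X_add_C_of_natDegree_le_one h3.le]
      rw [map_add, map_mul, Polynomial.aeval_C, Polynomial.aeval_C, Polynomial.aeval_X]
    have h5 : h = algebraMap k _ (w.coeff 1)⁻¹ *
        (Polynomial.aeval h w - algebraMap k _ (w.coeff 0)) := by
      rw [h6, add_sub_cancel_right, ← mul_assoc, ← map_mul, inv_mul_cancel₀ h4, map_one, one_mul]
    rintro _ (rfl | rfl)
    · change _ ∈ E
      rw [h5]
      exact mul_mem (E.algebraMap_mem _) (sub_mem hw (E.algebraMap_mem _))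
    · exact Algebra.subset_adjoin (by simp)
  · have hfK : map φ (Polynomial.aeval h a + Polynomial.aeval h b * T) =
        Polynomial.aeval (map φ h) (a.map φ) +
          Polynomial.aeval (map φ h) (b.map φ) * map φ T := by
      rw [map_add, map_mul, map_polynomial_aeval, map_polynomial_aeval]
    have hbK : b.map φ ≠ 0 := (Polynomial.map_ne_zero_iff φ.injective).2 hb
    by_cases hroot : ∃ x, (b.map φ).IsRoot x
    · exfalso
      obtain ⟨x, hx⟩ := hroot
      set p : Polynomial (Polynomial K) :=
        Polynomial.C (a.map φ) + Polynomial.C (b.map φ) * Polynomial.X with hp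
      have h1 : Irreducible p := by
        apply HK.irreducible_ev
        rw [hfK] at hprime
        simpa [hp] using hprime
      have hdeg : p.natDegree ≠ 0 := by
        rw [hp, add_comm, Polynomial.natDegree_linear hbK]
        exact one_ne_zero
      have hprim := h1.isPrimitive hdeg
      have hrel : IsRelPrime (a.map φ) (b.map φ) := by
        intro d hda hdb
        refine hprim d ?_
        rw [Polynomial.C_dvd_iff_dvd_coeff]
        intro i
        simp only [hp, Polynomial.coeff_add, Polynomial.coeff_C_mul]
        refine dvd_add ?_ (dvd_mul_of_dvd_left hdb _)
        rw [Polynomial.coeff_C]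
        split_ifs
        · exact hda
        · exact dvd_zero _
      obtain ⟨c, d, hcd⟩ := hrel.isCoprime
      have hsurj : ∀ q, ∃ u : MvPolynomial (Fin 2) K, aeval ![map φ h, map φ T] u = q := by
        intro q
        obtain ⟨P, hP⟩ := gen_iff_surjective.1 HK q
        exact ⟨_, (ev_eq_aeval _ _ P).symm.trans hP⟩
      choose u hu using hsurj
      exact LineData.false_of_field hm hr0 (r := r)
        { f := _, g := map φ g, D := DK, y := ![map φ h, map φ T], u := fun i => u (X i)
          a := ![a.map φ, b.map φ, c, d], x := x, aeval_u := fun i => hu _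
          f_eq := hfK, bezout := hcd, root := hx }
    · have h1 : (b.map φ).degree = 0 := by
        by_contra hne
        exact hroot (IsAlgClosed.exists_root _ hne)
      rw [Polynomial.degree_map] at h1
      have hb' := Polynomial.eq_C_of_degree_eq_zero h1
      generalize b.coeff 0 = β at hb'
      subst hb'
      have hβ : β ≠ 0 := fun h => hb (by rw [h, map_zero])
      set f := Polynomial.aeval h a + Polynomial.aeval h (Polynomial.C β) * T with hfd
      refine ⟨h, Gen.symm ?_⟩
      rw [Gen, eq_top_iff, ← H, Algebra.adjoin_le_iff]
      set E := Algebra.adjoin k {h, f}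
      have hh : h ∈ E := Algebra.subset_adjoin (by simp)
      have hf : f ∈ E := Algebra.subset_adjoin (by simp)
      have h5 : T = algebraMap k _ β⁻¹ * (f - Polynomial.aeval h a) := by
        rw [hfd, add_sub_cancel_left, Polynomial.aeval_C, ← mul_assoc, ← map_mul,
          inv_mul_cancel₀ hβ, map_one, one_mul]
      rintro _ (rfl | rfl)
      · exact hh
      · change _ ∈ E
        rw [h5]
        refine mul_mem (E.algebraMap_mem _) (sub_mem hf ?_)
        exact Algebra.adjoin_le (Set.singleton_subset_iff.2 hh)
          (Polynomial.aeval_mem_adjoin_singleton _ _)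

end

lemma isVar_of_algEquiv {R : Type} [CommRing R] [IsDomain R] [IsNoetherianRing R]
    (hR : Nonempty (ℚ →+* R) ∨ IsSeminormalDomain R) {m : ℕ} (hm : 0 < m) {r : Fin m → ℕ}
    (hr : ∀ i, 1 < r i) {f : MvPolynomial (Fin 2) R} {g : MvPolynomial (Fin m ⊕ Fin 2) R}
    (e : RingA R m r (fgPoly f g) ≃ₐ[R] MvPolynomial (Fin (m + 2)) R) : IsVar f := by
  obtain ⟨D⟩ := PolyData.nonempty_of_algEquiv e
  have hfields : ∀ (k : Type) [Field k] (φ : R →+* k), IsVar (map φ f) := fun k _ φ =>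
    isVar_of_polyData hm hr (map_relG r φ f g ▸ D.map φ)
  rcases hR with ⟨⟨ψ⟩⟩ | hR
  · let := ψ.toAlgebra
    exact isVar_of_fields_of_rat f hfields
  · exact isVar_of_fields_of_seminormal hR f hfields

theorem statement13 (R : Type) [CommRing R] [IsDomain R] [IsNoetherianRing R]
    (hR : Nonempty (ℚ →+* R) ∨ IsSeminormalDomain R)
    (m : ℕ) (hm : 1 ≤ m) (r : Fin m → ℕ) (hr : ∀ i, 1 < r i)
    (f : MvPolynomial (Fin 2) R) (hf : f ≠ 0)
    (g : MvPolynomial (Fin m ⊕ Fin 2) R)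
    (F : MvPolynomial (Fin m ⊕ Fin 2) R)
    (hF : F = rename Sum.inr f + (∏ i, X (Sum.inl i)) * g) :
    List.TFAE
      [ Nonempty (MvPolynomial (Fin 2)
            ↥(Algebra.adjoin R
              (Set.range (fun i : Fin m => (X (Sum.inl i) : BigP R m)) ∪ {relG R m r F}))
          ≃ₐ[↥(Algebra.adjoin R
              (Set.range (fun i : Fin m => (X (Sum.inl i) : BigP R m)) ∪ {relG R m r F}))]
          BigP R m),
        Nonempty (MvPolynomial (Fin (m + 2)) ↥(Algebra.adjoin R {relG R m r F})
          ≃ₐ[↥(Algebra.adjoin R {relG R m r F})] BigP R m),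
        Nonempty (MvPolynomial (Fin 2) ↥(EA R m r F) ≃ₐ[↥(EA R m r F)] RingA R m r F),
        Nonempty (RingA R m r F ≃ₐ[R] MvPolynomial (Fin (m + 2)) R),
        Nonempty (Polynomial ↥(Algebra.adjoin R {f})
          ≃ₐ[↥(Algebra.adjoin R {f})] MvPolynomial (Fin 2) R) ] := by
  subst hF
  have generators : IsVar f → ∃ y : Fin 2 → BigP R m,
      Algebra.adjoin R (xgSet r (fgPoly f g) ∪ Set.range y) = ⊤ := by
    intro h
    obtain ⟨y, t, hyt⟩ := generators_of_isVar r h g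
    refine ⟨![y, t], ?_⟩
    rw [Matrix.range_cons, Matrix.range_cons, Matrix.range_empty, Set.union_empty,
      Set.singleton_union]
    exact hyt
  tfae_have 1 → 2 := by
    rintro ⟨e⟩
    obtain ⟨y, hy⟩ := exists_generators_of_algEquiv e
    exact stmt_ii_of_generators r _ hy
  tfae_have 2 → 4 := stmt_iv_of_ii r _
  tfae_have 3 → 4 := stmt_iv_of_iii r _
  tfae_have 4 → 5 := fun ⟨e⟩ => stmt_v_of_isVar (isVar_of_algEquiv hR hm hr e)
  tfae_have 5 → 1 := fun h =>
    let ⟨_, hy⟩ := generators (isVar_of_stmt_v h)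
    stmt_i_of_generators r _ hy
  tfae_have 5 → 3 := fun h =>
    let ⟨_, hy⟩ := generators (isVar_of_stmt_v h)
    stmt_iii_of_generators r _ hy
  tfae_finish
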